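/- arXiv:2004.06714 — 2 statements merged into one kernel-verified Lean document; each statement's English description precedes it below -/
import Mathlib

section
/- Let O ⊆ ℝ^d be an open set, let S ⊆ O be compact, and suppose O_∞∖S is connected. Then for every function u harmonic on an open neighborhood of S and every real b > 0, there exists a function h harmonic on O such that |u − h| < b on S. -/
open MeasureTheory Metric Set Filter
open scoped ENNReal Topology OnePoint

noncomputable section

/-- `d`-dimensional Euclidean space. -/
abbrev Euc (d : ℕ) : Type := EuclideanSpace ℝ (Fin d)

/-- A real-valued function is *harmonic on a set* if it is continuous there and satisfies
the mean value equality over every closed ball contained in the set. -/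
def HarmOn {d : ℕ} (h : Euc d → ℝ) (O : Set (Euc d)) : Prop :=
  ContinuousOn h O ∧
    ∀ x : Euc d, ∀ r : ℝ, 0 < r → closedBall x r ⊆ O →
      h x = ⨍ y in closedBall x r, h y ∂volume

/-- An `EReal`-valued function is *subharmonic on a set* if it is upper semicontinuous there,
nowhere `+∞` there, and on every closed ball contained in the set it is dominated by each
continuous function harmonic in the interior that dominates it on the boundary sphere. -/
def SbhOn {d : ℕ} (u : Euc d → EReal) (O : Set (Euc d)) : Prop :=
  UpperSemicontinuousOn u O ∧ (∀ x ∈ O, u x < ⊤) ∧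
    ∀ x : Euc d, ∀ r : ℝ, 0 < r → closedBall x r ⊆ O →
      ∀ h : Euc d → ℝ, ContinuousOn h (closedBall x r) → HarmOn h (ball x r) →
        (∀ y ∈ sphere x r, u y ≤ (h y : EReal)) →
        ∀ y ∈ closedBall x r, u y ≤ (h y : EReal)

/-- The positive part of an extended real number, as a member of `ℝ≥0∞`. -/
def erealPos (x : EReal) : ℝ≥0∞ := if x = ⊤ then ⊤ else ENNReal.ofReal x.toReal

/-- The integral of an `EReal`-valued function against a measure, with values in `EReal`:
the lower integral of the positive part minus the lower integral of the negative part. -/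
def eInt {d : ℕ} (μ : Measure (Euc d)) (u : Euc d → EReal) : EReal :=
  ((∫⁻ x, erealPos (u x) ∂μ : ℝ≥0∞) : EReal) -
    ((∫⁻ x, erealPos (-(u x)) ∂μ : ℝ≥0∞) : EReal)

/-- The (closed) support of a measure: points all of whose open neighbourhoods
have strictly positive measure. -/
def msupp {d : ℕ} (μ : Measure (Euc d)) : Set (Euc d) :=
  {x | ∀ U : Set (Euc d), IsOpen U → x ∈ U → 0 < μ U}

/-- A finite positive Borel measure whose support is a compact subset of `O`. -/
def MeasCompIn {d : ℕ} (μ : Measure (Euc d)) (O : Set (Euc d)) : Prop :=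
  IsCompact (msupp μ) ∧ msupp μ ⊆ O ∧ μ (msupp μ)ᶜ = 0 ∧ μ Set.univ < ⊤

/-- The *inward filling* of `S` with respect to `O`: the union of `S` with all connected
components of `O \ S` that are relatively compact in `O`. -/
def infill {X : Type*} [TopologicalSpace X] (O S : Set X) : Set X :=
  S ∪ {y | ∃ x ∈ O \ S, y ∈ connectedComponentIn (O \ S) x ∧
      IsCompact (closure (connectedComponentIn (O \ S) x)) ∧
      closure (connectedComponentIn (O \ S) x) ⊆ O}

/-- The copy of a subset `S ⊆ O` inside the one-point (Alexandroff) compactification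
`O_∞ = OnePoint ↥O` of `O`. -/
def inOnePoint {X : Type*} (O S : Set X) : Set (OnePoint ↥O) :=
  OnePoint.some '' {x : ↥O | (x : X) ∈ S}

/-- The functions that are uniform limits on `K` of members of `P`. -/
def uniformApprox {X : Type*} (P : Submodule ℝ (X → ℝ)) (K : Set X) :
    Submodule ℝ (X → ℝ) where
  carrier := {f | ∀ ε : ℝ, 0 < ε → ∃ h ∈ P, ∀ x ∈ K, |f x - h x| < ε}
  zero_mem' := fun ε hε => ⟨0, P.zero_mem, fun x _ => by simpa using hε⟩
  add_mem' := by
    intro f g hf hg ε hε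
    obtain ⟨h₁, hh₁, h₁f⟩ := hf (ε / 2) (half_pos hε)
    obtain ⟨h₂, hh₂, h₂g⟩ := hg (ε / 2) (half_pos hε)
    refine ⟨h₁ + h₂, P.add_mem hh₁ hh₂, fun x hx => ?_⟩
    calc |(f + g) x - (h₁ + h₂) x| = |(f x - h₁ x) + (g x - h₂ x)| := by
          simp only [Pi.add_apply]; congr 1; ring
      _ ≤ |f x - h₁ x| + |g x - h₂ x| := abs_add_le _ _
      _ < ε := by linarith [h₁f x hx, h₂g x hx]
  smul_mem' := by
    intro c f hf ε hε
    have hc : 0 < |c| + 1 := by positivity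
    obtain ⟨h, hh, hfh⟩ := hf (ε / (|c| + 1)) (by positivity)
    refine ⟨c • h, P.smul_mem c hh, fun x hx => ?_⟩
    have h1 := hfh x hx
    rw [lt_div_iff₀ hc] at h1
    calc |(c • f) x - (c • h) x| = |c| * |f x - h x| := by
          rw [← abs_mul]; simp only [Pi.smul_apply, smul_eq_mul]; congr 1; ring
      _ ≤ |f x - h x| * (|c| + 1) := by nlinarith [abs_nonneg (f x - h x)]
      _ < ε := h1

lemma subset_uniformApprox {X : Type*} {P : Submodule ℝ (X → ℝ)} (K : Set X) {f : X → ℝ}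
    (hf : f ∈ P) : f ∈ uniformApprox P K :=
  fun ε hε => ⟨f, hf, fun x _ => by simpa using hε⟩

lemma mem_uniformApprox_of_approx {X : Type*} {P : Submodule ℝ (X → ℝ)} {K : Set X}
    {f : X → ℝ} (hf : ∀ ε : ℝ, 0 < ε → ∃ g ∈ uniformApprox P K, ∀ x ∈ K, |f x - g x| < ε) :
    f ∈ uniformApprox P K := by
  intro ε hε
  obtain ⟨g, hg, hfg⟩ := hf (ε / 2) (half_pos hε)
  obtain ⟨h, hh, hgh⟩ := hg (ε / 2) (half_pos hε)
  refine ⟨h, hh, fun x hx => ?_⟩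
  calc |f x - h x| ≤ |f x - g x| + |g x - h x| := abs_sub_le _ _ _
    _ < ε := by linarith [hfg x hx, hgh x hx]

lemma uniformApprox_congr {X : Type*} {P : Submodule ℝ (X → ℝ)} {K : Set X}
    {f g : X → ℝ} (hf : f ∈ uniformApprox P K) (hfg : ∀ x ∈ K, f x = g x) :
    g ∈ uniformApprox P K :=
  mem_uniformApprox_of_approx fun ε hε => ⟨f, hf, fun x hx => by simpa [hfg x hx] using hε⟩

/-- If a family `T t`, `t > 0` small, of uniformly approximable functions has an asymptotic
expansion in powers of `t`, then the coefficients are uniformly approximable. -/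
lemma coeff_mem_uniformApprox {X : Type*} {P : Submodule ℝ (X → ℝ)} {K : Set X}
    {T : ℝ → X → ℝ} {c : ℕ → X → ℝ} {τ : ℝ} (hτ : 0 < τ) (B : ℕ → ℝ)
    (hexp : ∀ t, 0 < t → t < τ → ∀ N, ∀ x ∈ K,
      |T t x - ∑ n ∈ Finset.range N, c n x * t ^ n| ≤ B N * t ^ N)
    (hT : ∀ t, 0 < t → t < τ → T t ∈ uniformApprox P K) (n : ℕ) :
    c n ∈ uniformApprox P K := by
  induction n using Nat.strong_induction_on with
  | _ n ih =>
  refine mem_uniformApprox_of_approx fun ε hε => ?_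
  have hB : 0 < |B (n + 1)| + 1 := by positivity
  obtain ⟨t, ht0, ht⟩ := exists_between (lt_min hτ (div_pos hε hB))
  have htτ := ht.trans_le (min_le_left _ _)
  have htε := ht.trans_le (min_le_right _ _)
  rw [lt_div_iff₀ hB] at htε
  refine ⟨(t ^ n)⁻¹ • (T t - ∑ i ∈ Finset.range n, t ^ i • c i), ?_, fun x hx => ?_⟩
  · refine Submodule.smul_mem _ _ (Submodule.sub_mem _ (hT t ht0 htτ) ?_)
    exact Submodule.sum_mem _ fun i hi =>
      Submodule.smul_mem _ _ (ih i (Finset.mem_range.1 hi))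
  · have h1 := hexp t ht0 htτ (n + 1) x hx
    rw [Finset.sum_range_succ] at h1
    have htn : 0 < t ^ n := pow_pos ht0 n
    have e : c n x - ((t ^ n)⁻¹ • (T t - ∑ i ∈ Finset.range n, t ^ i • c i)) x
        = -((t ^ n)⁻¹ * (T t x - (∑ i ∈ Finset.range n, c i x * t ^ i + c n x * t ^ n))) := by
      simp only [Pi.smul_apply, Pi.sub_apply, Finset.sum_apply, smul_eq_mul]
      have : ∑ i ∈ Finset.range n, t ^ i * c i x = ∑ i ∈ Finset.range n, c i x * t ^ i :=
        Finset.sum_congr rfl fun i _ => mul_comm _ _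
      rw [this]
      field_simp
      ring
    rw [e, abs_neg, abs_mul, abs_of_pos (inv_pos.2 htn)]
    calc (t ^ n)⁻¹ * _ ≤ (t ^ n)⁻¹ * (B (n + 1) * t ^ (n + 1)) := by gcongr
      _ = B (n + 1) * t := by field_simp; ring
      _ ≤ t * (|B (n + 1)| + 1) := by nlinarith [le_abs_self (B (n + 1))]
      _ < ε := htε

/-- Real parts of the Taylor coefficients at `0`. -/
def reTaylor (F : ℂ → ℂ) (n : ℕ) : ℝ := (((n.factorial : ℂ))⁻¹ * iteratedDeriv n F 0).re

lemma abs_re_sub_taylor_le {F : ℂ → ℂ} {ρ C : ℝ} (hρ : 0 < ρ)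
    (hF : DifferentiableOn ℂ F (closedBall 0 ρ)) (hC : ∀ z ∈ closedBall (0 : ℂ) ρ, ‖F z‖ ≤ C)
    {t : ℝ} (ht : |t| ≤ ρ / 2) (N : ℕ) :
    |(F t).re - ∑ n ∈ Finset.range N, reTaylor F n * t ^ n| ≤ 2 * C * (|t| / ρ) ^ N := by
  have hC0 : 0 ≤ C := (norm_nonneg _).trans (hC 0 (by simp [hρ.le]))
  have htb : (t : ℂ) ∈ ball (0 : ℂ) ρ := by
    simp only [mem_ball, dist_zero_right, Complex.norm_real, Real.norm_eq_abs]
    linarith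
  have hs := Complex.hasSum_taylorSeries_on_ball (hF.mono ball_subset_closedBall) htb
  have hdc : DiffContOnCl ℂ F (ball 0 ρ) :=
    ⟨hF.mono ball_subset_closedBall, by
      rw [closure_ball _ hρ.ne']; exact hF.continuousOn⟩
  have hbd : ∀ n, ‖((n.factorial : ℂ))⁻¹ • ((t : ℂ) - 0) ^ n • iteratedDeriv n F 0‖
      ≤ C * (|t| / ρ) ^ n := by
    intro n
    have h1 := Complex.norm_iteratedDeriv_le_of_forall_mem_sphere_norm_le n hρ hdc
      (fun z hz => hC z (sphere_subset_closedBall hz))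
    have hn : (0 : ℝ) < n.factorial := by exact_mod_cast n.factorial_pos
    rw [norm_smul, norm_smul, norm_inv, Complex.norm_natCast, norm_pow, sub_zero,
      Complex.norm_real, Real.norm_eq_abs]
    calc (n.factorial : ℝ)⁻¹ * (|t| ^ n * ‖iteratedDeriv n F 0‖)
        ≤ (n.factorial : ℝ)⁻¹ * (|t| ^ n * (n.factorial * C / ρ ^ n)) := by gcongr
      _ = C * (|t| / ρ) ^ n := by rw [div_pow]; field_simp
  have hr : |t| / ρ ≤ 1 / 2 := by rw [div_le_iff₀ hρ]; linarith
  have h2 := norm_sub_le_of_geometric_bound_of_hasSum (by linarith) hbd hs N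
  have h3 : C * (|t| / ρ) ^ N / (1 - |t| / ρ) ≤ 2 * C * (|t| / ρ) ^ N := by
    rw [div_le_iff₀ (by linarith)]
    have : 0 ≤ C * (|t| / ρ) ^ N := by positivity
    nlinarith
  refine le_trans ?_ (h2.trans h3)
  refine le_trans (le_of_eq ?_) (Complex.abs_re_le_norm _)
  rw [← abs_neg, Complex.sub_re, Complex.re_sum, neg_sub]
  congr 2
  refine Finset.sum_congr rfl fun n _ => ?_
  rw [reTaylor, sub_zero, smul_eq_mul, smul_eq_mul, mul_left_comm, ← Complex.ofReal_pow,
    Complex.re_ofReal_mul, mul_comm]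

/-- A primitive of `z ↦ z ^ (-d / 2)`; the fundamental solution of the Laplace equation is,
up to a constant, `x ↦ radialProfile d (‖x‖ ^ 2)`. -/
def radialProfile (d : ℕ) (z : ℂ) : ℂ :=
  if d = 2 then Complex.log z else z ^ (1 - (d : ℂ) / 2) / (1 - (d : ℂ) / 2)

lemma hasDerivAt_radialProfile (d : ℕ) {z : ℂ} (hz : z ∈ Complex.slitPlane) :
    HasDerivAt (radialProfile d) (z ^ (-(d : ℂ) / 2)) z := by
  unfold radialProfile
  by_cases hd : d = 2
  · subst hd
    simp only [if_true]
    refine (Complex.hasDerivAt_log hz).congr_deriv ?_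
    norm_num
    exact (Complex.cpow_neg_one z).symm
  · simp only [if_neg hd]
    have h0 : (1 - (d : ℂ) / 2) ≠ 0 := by
      intro h
      apply hd
      have : (d : ℂ) = 2 := by linear_combination (-2 : ℂ) * h
      exact_mod_cast this
    have h1 := ((hasDerivAt_id z).cpow_const (c := 1 - (d : ℂ) / 2) hz).div_const
      (1 - (d : ℂ) / 2)
    refine h1.congr_deriv ?_
    rw [mul_one, mul_div_cancel_left₀ _ h0]
    simp only [id]
    congr 1
    ring

/-- The real part of `radialProfile` on the real line. -/
def realProfile (d : ℕ) (s : ℝ) : ℝ := (radialProfile d s).re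

lemma hasDerivAt_realProfile (d : ℕ) {s : ℝ} (hs : 0 < s) :
    HasDerivAt (realProfile d) (s ^ (-(d : ℝ) / 2)) s := by
  have h := (hasDerivAt_radialProfile d (z := (s : ℂ))
    (Complex.ofReal_mem_slitPlane.2 hs)).real_of_complex
  refine h.congr_deriv ?_
  rw [← Complex.ofReal_re (s ^ (-(d : ℝ) / 2)), Complex.ofReal_cpow hs.le]
  push_cast
  rfl

/-- A nonnormalized fundamental solution of the Laplace equation. -/
def newton (d : ℕ) (x : Euc d) : ℝ := realProfile d (‖x‖ ^ 2)

/-- Taylor coefficients of `t ↦ newton d (p + t • q)` at `0`. -/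
def newtonCoeff (d n : ℕ) (p q : Euc d) : ℝ :=
  reTaylor (fun z : ℂ => radialProfile d
    ((‖p‖ ^ 2 : ℝ) + 2 * (inner ℝ p q : ℝ) * z + (‖q‖ ^ 2 : ℝ) * z ^ 2)) n

lemma newton_add_smul (d : ℕ) (p q : Euc d) (t : ℝ) :
    newton d (p + t • q) = (radialProfile d
      ((‖p‖ ^ 2 : ℝ) + 2 * (inner ℝ p q : ℝ) * (t : ℂ) + (‖q‖ ^ 2 : ℝ) * (t : ℂ) ^ 2)).re := by
  rw [newton, realProfile, norm_add_sq_real, inner_smul_right, norm_smul, mul_pow,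
    Real.norm_eq_abs, sq_abs]
  congr 2
  push_cast
  ring

lemma exists_newton_taylor_bound (d : ℕ) {m M Q : ℝ} (hm : 0 < m) (hQ : 0 < Q) :
    ∃ C : ℝ, 0 ≤ C ∧ ∀ p q : Euc d, m ≤ ‖p‖ → ‖p‖ ≤ M → ‖q‖ ≤ Q →
      ∀ t : ℝ, |t| ≤ m / (8 * Q) → ∀ N : ℕ,
        |newton d (p + t • q) - ∑ n ∈ Finset.range N, newtonCoeff d n p q * t ^ n|
          ≤ C * (|t| * (4 * Q / m)) ^ N := by
  set D : Set ℂ := {z | 7 / 16 * m ^ 2 ≤ z.re} ∩ closedBall 0 (2 * M ^ 2) with hD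
  have hDc : IsCompact D := by
    refine (isCompact_closedBall _ _).inter_left ?_
    exact isClosed_le continuous_const Complex.continuous_re
  have hDs : D ⊆ Complex.slitPlane := by
    intro z hz
    left
    have h1 : 7 / 16 * m ^ 2 ≤ z.re := hz.1
    have : 0 < m ^ 2 := by positivity
    linarith
  have hcont : ContinuousOn (radialProfile d) D := fun z hz =>
    (hasDerivAt_radialProfile d (hDs hz)).continuousAt.continuousWithinAt
  obtain ⟨C, hC⟩ := hDc.exists_bound_of_continuousOn hcont
  refine ⟨2 * max C 0, by positivity, fun p q hmp hpM hq t ht N => ?_⟩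
  have hρ : 0 < m / (4 * Q) := by positivity
  set G : ℂ → ℂ := fun z => (‖p‖ ^ 2 : ℝ) + 2 * (inner ℝ p q : ℝ) * z + (‖q‖ ^ 2 : ℝ) * z ^ 2
    with hG
  have hGD : ∀ z ∈ closedBall (0 : ℂ) (m / (4 * Q)), G z ∈ D := by
    intro z hz
    rw [mem_closedBall, dist_zero_right] at hz
    have hzq : ‖z‖ * ‖q‖ ≤ ‖p‖ / 4 := by
      calc ‖z‖ * ‖q‖ ≤ (m / (4 * Q)) * Q := by gcongr
        _ = m / 4 := by field_simp
        _ ≤ ‖p‖ / 4 := by linarith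
    have hin : |(inner ℝ p q : ℝ)| ≤ ‖p‖ * ‖q‖ := abs_real_inner_le_norm p q
    have hp0 := norm_nonneg p
    have hq0 := norm_nonneg q
    have hz0 := norm_nonneg z
    have hw : ‖2 * ((inner ℝ p q : ℝ) : ℂ) * z + (‖q‖ ^ 2 : ℝ) * z ^ 2‖ ≤ 9 / 16 * ‖p‖ ^ 2 := by
      calc _ ≤ ‖2 * ((inner ℝ p q : ℝ) : ℂ) * z‖ + ‖((‖q‖ ^ 2 : ℝ) : ℂ) * z ^ 2‖ := norm_add_le _ _
        _ = 2 * |(inner ℝ p q : ℝ)| * ‖z‖ + (‖z‖ * ‖q‖) ^ 2 := by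
          simp only [norm_mul, norm_pow, Complex.norm_real, Real.norm_eq_abs, Complex.norm_ofNat,
            abs_norm]
          ring
        _ ≤ 2 * (‖p‖ * ‖q‖) * ‖z‖ + (‖p‖ / 4) ^ 2 := by gcongr
        _ = 2 * ‖p‖ * (‖z‖ * ‖q‖) + (‖p‖ / 4) ^ 2 := by ring
        _ ≤ 2 * ‖p‖ * (‖p‖ / 4) + (‖p‖ / 4) ^ 2 := by gcongr
        _ = 9 / 16 * ‖p‖ ^ 2 := by ring
    have hGe : G z = (‖p‖ ^ 2 : ℝ) + (2 * ((inner ℝ p q : ℝ) : ℂ) * z + (‖q‖ ^ 2 : ℝ) * z ^ 2) := by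
      rw [hG]; ring
    constructor
    · show 7 / 16 * m ^ 2 ≤ (G z).re
      rw [hGe, Complex.add_re, Complex.ofReal_re]
      have h1 := (abs_le.1 (Complex.abs_re_le_norm
        (2 * ((inner ℝ p q : ℝ) : ℂ) * z + (‖q‖ ^ 2 : ℝ) * z ^ 2))).1
      have h2 : m ^ 2 ≤ ‖p‖ ^ 2 := by gcongr
      linarith
    · rw [mem_closedBall, dist_zero_right, hGe]
      have h2 : ‖p‖ ^ 2 ≤ M ^ 2 := by gcongr
      refine (norm_add_le _ _).trans ?_
      rw [Complex.norm_real, Real.norm_eq_abs, abs_of_nonneg (sq_nonneg ‖p‖)]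
      nlinarith [sq_nonneg ‖p‖]
  have hGd : Differentiable ℂ G := by rw [hG]; fun_prop
  have h := abs_re_sub_taylor_le (F := fun z => radialProfile d (G z)) (C := max C 0) hρ
    (fun z hz => ((hasDerivAt_radialProfile d (hDs (hGD z hz))).differentiableAt.comp z
      (hGd z)).differentiableWithinAt)
    (fun z hz => (hC _ (hGD z hz)).trans (le_max_left _ _)) (t := t)
    (by rw [div_div]; convert ht using 2; ring) N
  rw [newton_add_smul]
  have e : |t| * (4 * Q / m) = |t| / (m / (4 * Q)) := by rw [div_div_eq_mul_div, mul_div_assoc']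
  rw [e]
  exact h

/-- The Laplacian of `x ↦ F (‖x‖ ^ 2)` on `ℝ^d`, as a function of `s = ‖x‖ ^ 2`. -/
def radialLap (d : ℕ) (F : ℝ → ℝ) (s : ℝ) : ℝ := 4 * s * deriv (deriv F) s + 2 * d * deriv F s

lemma exists_regularized_profile (d : ℕ) {ε : ℝ} (hε : 0 < ε) :
    ∃ F : ℝ → ℝ, ContDiff ℝ (⊤ : ℕ∞) F ∧ (∀ s, ε ^ 2 ≤ s → F s = realProfile d s) ∧
      (∀ s, 0 ≤ radialLap d F s) ∧ (∃ s, 0 < s ∧ 0 < radialLap d F s) ∧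
      ∀ s, ε ^ 2 ≤ s → radialLap d F s = 0 := by
  set a : ℝ := ε ^ 2 / 4 with ha
  have ha0 : 0 < a := by positivity
  set θ : ℝ → ℝ := fun s => Real.smoothTransition ((s - a) / a) with hθ
  have hθs : ContDiff ℝ (⊤ : ℕ∞) θ :=
    Real.smoothTransition.contDiff.comp ((contDiff_id.sub contDiff_const).div_const a)
  have hθd : Differentiable ℝ θ := hθs.differentiable (by simp)
  have hθ0 : ∀ s ≤ a, θ s = 0 := fun s hs =>
    Real.smoothTransition.zero_of_nonpos (div_nonpos_of_nonpos_of_nonneg (by linarith) ha0.le)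
  have hθ1 : ∀ s, 2 * a ≤ s → θ s = 1 := fun s hs =>
    Real.smoothTransition.one_of_one_le (by rw [le_div_iff₀ ha0]; linarith)
  have hθm : Monotone θ := fun s t hst => Real.smoothTransition.monotone (by gcongr)
  set g : ℝ → ℝ := fun s => θ s * s ^ (-(d : ℝ) / 2) with hg
  have hg0 : ∀ s < a, g =ᶠ[𝓝 s] fun _ => 0 := by
    intro s hs
    filter_upwards [Iio_mem_nhds hs] with t ht
    simp [hg, hθ0 t (le_of_lt ht)]
  have hgs : ContDiff ℝ (⊤ : ℕ∞) g := by
    rw [contDiff_iff_contDiffAt]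
    intro s
    rcases lt_or_ge s a with h | h
    · exact contDiffAt_const.congr_of_eventuallyEq (hg0 s h)
    · exact hθs.contDiffAt.mul (Real.contDiffAt_rpow_const_of_ne (by linarith))
  have hgi : ∀ s t, IntervalIntegrable g volume s t := fun s t =>
    hgs.continuous.intervalIntegrable s t
  set F : ℝ → ℝ := fun s => realProfile d (2 * a) + ∫ t in (2 * a)..s, g t with hF
  have hFd : ∀ s, HasDerivAt F (g s) s := fun s =>
    (intervalIntegral.integral_hasDerivAt_right (hgi _ _)
      (hgs.continuous.stronglyMeasurableAtFilter _ _) hgs.continuous.continuousAt).const_add _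
  have hFd' : deriv F = g := funext fun s => (hFd s).deriv
  have hlap : ∀ s, 0 < s → radialLap d F s = 4 * s ^ (1 - (d : ℝ) / 2) * deriv θ s := by
    intro s hs
    have h1 := (hθd s).hasDerivAt.mul (Real.hasDerivAt_rpow_const (x := s) (p := -(d : ℝ) / 2)
      (Or.inl hs.ne'))
    have h2 : deriv g s = deriv θ s * s ^ (-(d : ℝ) / 2)
        + θ s * (-(d : ℝ) / 2 * s ^ (-(d : ℝ) / 2 - 1)) := h1.deriv
    rw [radialLap, hFd', h2]
    have e1 : s ^ (-(d : ℝ) / 2) = s * s ^ (-(d : ℝ) / 2 - 1) := by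
      rw [Real.rpow_sub_one hs.ne']; field_simp
    have e2 : s ^ (1 - (d : ℝ) / 2) = s * s ^ (-(d : ℝ) / 2) := by
      rw [sub_eq_add_neg, Real.rpow_add hs, Real.rpow_one, neg_div]
    simp only [hg]
    rw [e2, e1]
    ring
  have hlap0 : ∀ s < a, radialLap d F s = 0 := by
    intro s hs
    rw [radialLap, hFd', (hg0 s hs).deriv_eq, (hg0 s hs).eq_of_nhds]
    simp
  refine ⟨F, contDiff_infty_iff_deriv.2 ⟨fun s => (hFd s).differentiableAt, hFd' ▸ hgs⟩,
    ?_, ?_, ?_, ?_⟩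
  · intro s hs
    have hs' : 2 * a ≤ s := by nlinarith
    have h := intervalIntegral.integral_eq_sub_of_hasDerivAt (a := 2 * a) (b := s)
      (f := realProfile d) (f' := g) (fun t ht => by
        rw [uIcc_of_le hs'] at ht
        have := hasDerivAt_realProfile d (s := t) (by linarith [ht.1])
        simpa [hg, hθ1 t ht.1] using this) (hgi _ _)
    simp only [hF, h]
    ring
  · intro s
    rcases le_or_gt s 0 with h | h
    · rw [hlap0 s (by linarith)]
    · rw [hlap s h]
      have := hθm.deriv_nonneg (x := s)
      positivity
  · by_contra! hcon
    have hneg : ∀ s, deriv θ s ≤ 0 := by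
      intro s
      rcases lt_or_ge s a with h | h
      · have : θ =ᶠ[𝓝 s] fun _ => 0 := by
          filter_upwards [Iio_mem_nhds h] with t ht using hθ0 t (le_of_lt ht)
        rw [this.deriv_eq]; simp
      · have hs : 0 < s := by linarith
        have h1 := hcon s hs
        rw [hlap s hs] at h1
        have h2 : 0 < 4 * s ^ (1 - (d : ℝ) / 2) := by positivity
        exact nonpos_of_mul_nonpos_right h1 h2
    have := antitone_of_deriv_nonpos hθd hneg (show a ≤ 2 * a by linarith)
    rw [hθ0 a le_rfl, hθ1 _ le_rfl] at this
    linarith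
  · intro s hs
    have hs' : 2 * a < s := by nlinarith [ha0, ha]
    rw [hlap s (by linarith)]
    have : θ =ᶠ[𝓝 s] fun _ => 1 := by
      filter_upwards [Ioi_mem_nhds hs'] with t ht using hθ1 t (le_of_lt ht)
    rw [this.deriv_eq]; simp

/-- Partial derivative. -/
def pd {d : ℕ} (i : Fin d) (h : Euc d → ℝ) (x : Euc d) : ℝ :=
  fderiv ℝ h x (EuclideanSpace.single i 1)

/-- The Laplacian in coordinates. -/
def lap {d : ℕ} (h : Euc d → ℝ) (x : Euc d) : ℝ := ∑ i, pd i (pd i h) x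

lemma contDiff_pd {d : ℕ} {h : Euc d → ℝ} (hh : ContDiff ℝ (⊤ : ℕ∞) h) (i : Fin d) :
    ContDiff ℝ (⊤ : ℕ∞) (pd i h) :=
  (hh.fderiv_right (m := (⊤ : ℕ∞)) (by simp)).clm_apply contDiff_const

lemma hasCompactSupport_pd {d : ℕ} {h : Euc d → ℝ} (hh : HasCompactSupport h) (i : Fin d) :
    HasCompactSupport (pd i h) :=
  hh.fderiv_apply ℝ _

lemma contDiff_radial {d : ℕ} {F : ℝ → ℝ} (hF : ContDiff ℝ (⊤ : ℕ∞) F) :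
    ContDiff ℝ (⊤ : ℕ∞) fun x : Euc d => F (‖x‖ ^ 2) :=
  hF.comp (contDiff_norm_sq ℝ)

lemma pd_radial {d : ℕ} {F : ℝ → ℝ} (hF : Differentiable ℝ F) (i : Fin d) :
    pd i (fun x : Euc d => F (‖x‖ ^ 2)) = fun x => 2 * x i * deriv F (‖x‖ ^ 2) := by
  funext x
  have h1 : HasFDerivAt (fun x : Euc d => ‖x‖ ^ 2) (2 • innerSL ℝ x) x :=
    (hasStrictFDerivAt_norm_sq x).hasFDerivAt
  have h2 := (hF (‖x‖ ^ 2)).hasDerivAt.comp_hasFDerivAt x h1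
  have h3 : fderiv ℝ (fun x : Euc d => F (‖x‖ ^ 2)) x = _ := h2.fderiv
  rw [pd, h3]
  simp [EuclideanSpace.inner_single_right]
  ring

lemma lap_radial {d : ℕ} {F : ℝ → ℝ} (hF : ContDiff ℝ (⊤ : ℕ∞) F) :
    lap (fun x : Euc d => F (‖x‖ ^ 2)) = fun x => radialLap d F (‖x‖ ^ 2) := by
  have hF' : ContDiff ℝ (⊤ : ℕ∞) (deriv F) := (contDiff_infty_iff_deriv.1 hF).2
  have hd : Differentiable ℝ F := hF.differentiable (by simp)
  have hd' : Differentiable ℝ (deriv F) := hF'.differentiable (by simp)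
  funext x
  have key : ∀ i, pd i (pd i (fun x : Euc d => F (‖x‖ ^ 2))) x
      = 2 * deriv F (‖x‖ ^ 2) + 4 * (x i) ^ 2 * deriv (deriv F) (‖x‖ ^ 2) := by
    intro i
    rw [pd_radial hd]
    have h1 : HasFDerivAt (fun x : Euc d => 2 * x i)
        ((2 : ℝ) • (EuclideanSpace.proj i : Euc d →L[ℝ] ℝ)) x :=
      (EuclideanSpace.proj i : Euc d →L[ℝ] ℝ).hasFDerivAt.const_mul 2
    have h2 : HasFDerivAt (fun x : Euc d => deriv F (‖x‖ ^ 2))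
        (fderiv ℝ (fun x : Euc d => deriv F (‖x‖ ^ 2)) x) x :=
      ((contDiff_radial hF').differentiable (by simp) x).hasFDerivAt
    have h3 : pd i (fun x : Euc d => deriv F (‖x‖ ^ 2)) x = _ := congrFun (pd_radial hd' i) x
    have h4 : fderiv ℝ (fun x : Euc d => 2 * x i * deriv F (‖x‖ ^ 2)) x = _ := (h1.mul h2).fderiv
    rw [pd, h4]
    rw [pd] at h3
    simp [h3]
    ring
  rw [lap, Finset.sum_congr rfl fun i _ => key i, Finset.sum_add_distrib, ← Finset.sum_mul,
    ← Finset.sum_mul, ← Finset.mul_sum, radialLap, EuclideanSpace.real_norm_sq_eq]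
  simp
  ring

lemma integral_pd_mul {d : ℕ} {h w : Euc d → ℝ} (hh : ContDiff ℝ (⊤ : ℕ∞) h)
    (hw : ContDiff ℝ (⊤ : ℕ∞) w) (hwc : HasCompactSupport w) (i : Fin d) :
    ∫ x, pd i h x * w x = -∫ x, h x * pd i w x := by
  have h1 : Continuous (pd i h) := (contDiff_pd hh i).continuous
  have h2 : Continuous (pd i w) := (contDiff_pd hw i).continuous
  rw [eq_neg_iff_add_eq_zero, add_comm, ← eq_neg_iff_add_eq_zero]
  exact integral_mul_fderiv_eq_neg_fderiv_mul_of_integrable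
    ((h1.mul hw.continuous).integrable_of_hasCompactSupport hwc.mul_left)
    ((hh.continuous.mul h2).integrable_of_hasCompactSupport (hasCompactSupport_pd hwc i).mul_left)
    ((hh.continuous.mul hw.continuous).integrable_of_hasCompactSupport hwc.mul_left)
    (fun x _ => hh.differentiable (by simp) x) (fun x _ => hw.differentiable (by simp) x)

lemma integral_lap_mul {d : ℕ} {h w : Euc d → ℝ} (hh : ContDiff ℝ (⊤ : ℕ∞) h)
    (hw : ContDiff ℝ (⊤ : ℕ∞) w) (hwc : HasCompactSupport w) :
    ∫ x, lap h x * w x = ∫ x, h x * lap w x := by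
  have hi1 : ∀ i, Integrable fun x => pd i (pd i h) x * w x := fun i =>
    ((contDiff_pd (contDiff_pd hh i) i).continuous.mul
      hw.continuous).integrable_of_hasCompactSupport hwc.mul_left
  have hi2 : ∀ i, Integrable fun x => h x * pd i (pd i w) x := fun i =>
    (hh.continuous.mul
      (contDiff_pd (contDiff_pd hw i) i).continuous).integrable_of_hasCompactSupport
      (hasCompactSupport_pd (hasCompactSupport_pd hwc i) i).mul_left
  simp only [lap, Finset.sum_mul, Finset.mul_sum]
  rw [integral_finsetSum _ fun i _ => hi1 i, integral_finsetSum _ fun i _ => hi2 i]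
  refine Finset.sum_congr rfl fun i _ => ?_
  rw [integral_pd_mul (contDiff_pd hh i) hw hwc,
    integral_pd_mul hh (contDiff_pd hw i) (hasCompactSupport_pd hwc i), neg_neg]

lemma pd_comp_affine {d : ℕ} {h : Euc d → ℝ} (hh : Differentiable ℝ h) (i : Fin d) (x : Euc d)
    (t : ℝ) : pd i (fun y => h (x + t • y)) = fun y => t * pd i h (x + t • y) := by
  funext y
  have h1 : HasFDerivAt (fun y : Euc d => x + t • y) (t • ContinuousLinearMap.id ℝ (Euc d)) y :=
    ((hasFDerivAt_id y).const_smul t).const_add x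
  have h2 : fderiv ℝ (fun y => h (x + t • y)) y = _ :=
    ((hh (x + t • y)).hasFDerivAt.comp y h1).fderiv
  rw [pd, h2]
  simp [pd]

lemma hasCompactSupport_radial {d : ℕ} {k : ℝ → ℝ} {R : ℝ} (hR : 0 ≤ R)
    (hk : ∀ s, R ^ 2 ≤ s → k s = 0) : HasCompactSupport fun y : Euc d => k (‖y‖ ^ 2) := by
  refine HasCompactSupport.intro (isCompact_closedBall (0 : Euc d) R) fun y hy => hk _ ?_
  rw [mem_closedBall, dist_zero_right, not_le] at hy
  gcongr

lemma integral_radial_eq_of_lap_eq_zero {d : ℕ} {h : Euc d → ℝ} (hh : ContDiff ℝ (⊤ : ℕ∞) h)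
    {x : Euc d} {r : ℝ} (hr : 0 < r) (hlap : ∀ y ∈ closedBall x r, lap h y = 0)
    {k : ℝ → ℝ} (hk : ContDiff ℝ (⊤ : ℕ∞) k) (hk1 : ∀ s, 1 ≤ s → k s = 0) :
    ∫ y in closedBall (0 : Euc d) 1, h (x + r • y) * k (‖y‖ ^ 2)
      = ∫ y in closedBall (0 : Euc d) 1, h x * k (‖y‖ ^ 2) := by
  have hki : ∀ s t, IntervalIntegrable k volume s t := fun s t =>
    hk.continuous.intervalIntegrable s t
  set K : ℝ → ℝ := fun s => ∫ t in (1 : ℝ)..s, k t with hK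
  have hKd : ∀ s, HasDerivAt K (k s) s := fun s =>
    intervalIntegral.integral_hasDerivAt_right (hki _ _)
      (hk.continuous.stronglyMeasurableAtFilter _ _) hk.continuous.continuousAt
  have hKd' : deriv K = k := funext fun s => (hKd s).deriv
  have hKs : ContDiff ℝ (⊤ : ℕ∞) K :=
    contDiff_infty_iff_deriv.2 ⟨fun s => (hKd s).differentiableAt, hKd' ▸ hk⟩
  have hK1 : ∀ s, 1 ≤ s → K s = 0 := by
    intro s hs
    refine intervalIntegral.integral_zero_ae (ae_of_all _ fun t ht => hk1 t ?_)
    rw [uIoc_of_le hs] at ht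
    exact ht.1.le
  set w : Euc d → ℝ := fun y => K (‖y‖ ^ 2) with hw
  have hws : ContDiff ℝ (⊤ : ℕ∞) w := contDiff_radial hKs
  have hwc : HasCompactSupport w :=
    hasCompactSupport_radial zero_le_one (by simpa using hK1)
  have hwp : ∀ i, pd i w = fun y => 2 * y i * k (‖y‖ ^ 2) := fun i => by
    rw [hw, pd_radial (hKs.differentiable (by simp)), hKd']
  set G : ℝ → Euc d → ℝ := fun t y => ∑ i, pd i h (x + t • y) * (y i * k (‖y‖ ^ 2)) with hG
  have hGc : Continuous fun p : ℝ × Euc d => G p.1 p.2 := by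
    refine continuous_finsetSum _ fun i _ => ?_
    have h1 := (contDiff_pd hh i).continuous
    have h2 := hk.continuous
    fun_prop
  have hd1 : ∀ t y, HasDerivAt (fun t : ℝ => h (x + t • y) * k (‖y‖ ^ 2)) (G t y) t := by
    intro t y
    have h1 : HasDerivAt (fun t : ℝ => x + t • y) y t := by
      simpa using ((hasDerivAt_id t).smul_const y).const_add x
    have h2 := ((hh.differentiable (by simp) (x + t • y)).hasFDerivAt.comp_hasDerivAt t
      h1).mul_const (k (‖y‖ ^ 2))
    refine h2.congr_deriv ?_
    have h3 : ∀ L : Euc d →L[ℝ] ℝ, L y = ∑ i, y i * L (EuclideanSpace.single i 1) := by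
      intro L
      conv_lhs => rw [← (EuclideanSpace.basisFun (Fin d) ℝ).sum_repr y]
      simp
    rw [h3, Finset.sum_mul]
    exact Finset.sum_congr rfl fun i _ => by rw [pd]; ring
  have hcont : ∀ t : ℝ, Continuous fun y : Euc d => h (x + t • y) * k (‖y‖ ^ 2) := by
    intro t
    have h1 := hh.continuous
    have h2 := hk.continuous
    fun_prop
  have hderiv : ∀ t : ℝ, HasDerivAt
      (fun t : ℝ => ∫ y in closedBall (0 : Euc d) 1, h (x + t • y) * k (‖y‖ ^ 2))
      (∫ y in closedBall (0 : Euc d) 1, G t y) t := by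
    intro t
    obtain ⟨C, hC⟩ := ((isCompact_closedBall t 1).prod
      (isCompact_closedBall (0 : Euc d) 1)).exists_bound_of_continuousOn hGc.continuousOn
    refine (hasDerivAt_integral_of_dominated_loc_of_deriv_le (bound := fun _ => C)
      (closedBall_mem_nhds t one_pos) (Eventually.of_forall fun s =>
        (hcont s).aestronglyMeasurable) ?_ ?_ ?_ ?_ ?_).2
    · exact (hcont t).continuousOn.integrableOn_compact (isCompact_closedBall _ _)
    · exact (hGc.comp (Continuous.prodMk_right t)).aestronglyMeasurable
    · rw [ae_restrict_iff' measurableSet_closedBall]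
      exact ae_of_all _ fun y hy s hs => hC (s, y) ⟨hs, hy⟩
    · exact integrableOn_const (measure_closedBall_lt_top.ne)
    · exact ae_of_all _ fun y s _ => hd1 s y
  have hzero : ∀ t ∈ Ico 0 r, (∫ y in closedBall (0 : Euc d) 1, G t y) = 0 := by
    intro t ht
    have hsupp : ∀ y ∉ closedBall (0 : Euc d) 1, G t y = 0 := by
      intro y hy
      rw [mem_closedBall, dist_zero_right, not_le] at hy
      simp [hG, hk1 (‖y‖ ^ 2) (by nlinarith)]
    rw [setIntegral_eq_integral_of_forall_compl_eq_zero hsupp]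
    have haff : ContDiff ℝ (⊤ : ℕ∞) fun y : Euc d => x + t • y :=
      contDiff_const.add (contDiff_id.const_smul t)
    have hp : ∀ i, ContDiff ℝ (⊤ : ℕ∞) fun y => pd i h (x + t • y) := fun i =>
      (contDiff_pd hh i).comp haff
    have e1 : ∀ y, G t y = ∑ i, pd i h (x + t • y) * pd i w y * (1 / 2) := by
      intro y
      refine Finset.sum_congr rfl fun i _ => ?_
      rw [hwp]; ring
    have hi : ∀ i, Integrable fun y => pd i h (x + t • y) * pd i w y * (1 / 2) := fun i =>
      (((hp i).continuous.mul (contDiff_pd hws i).continuous).integrable_of_hasCompactSupport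
        (hasCompactSupport_pd hwc i).mul_left).mul_const _
    have hi2 : ∀ i, Integrable fun y => pd i (fun y => pd i h (x + t • y)) y * w y := fun i =>
      ((contDiff_pd (hp i) i).continuous.mul hws.continuous).integrable_of_hasCompactSupport
        hwc.mul_left
    simp only [e1]
    rw [integral_finsetSum _ fun i _ => hi i]
    have e2 : ∀ i, ∫ y, pd i h (x + t • y) * pd i w y * (1 / 2)
        = -(1 / 2) * ∫ y, pd i (fun y => pd i h (x + t • y)) y * w y := by
      intro i
      rw [integral_mul_const, integral_pd_mul (hp i) hws hwc]
      ring
    rw [Finset.sum_congr rfl fun i _ => e2 i, ← Finset.mul_sum,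
      ← integral_finsetSum _ fun i _ => hi2 i]
    have e3 : ∀ y, ∑ i, pd i (fun y => pd i h (x + t • y)) y * w y = 0 := by
      intro y
      rw [← Finset.sum_mul]
      by_cases hy : ‖y‖ ≤ 1
      · have : ∑ i, pd i (fun y => pd i h (x + t • y)) y = t * lap h (x + t • y) := by
          rw [lap, Finset.mul_sum]
          exact Finset.sum_congr rfl fun i _ =>
            congrFun (pd_comp_affine ((contDiff_pd hh i).differentiable (by simp)) i x t) y
        rw [this, hlap, mul_zero, zero_mul]
        rw [mem_closedBall, dist_eq_norm, add_sub_cancel_left, norm_smul, Real.norm_eq_abs,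
          abs_of_nonneg ht.1]
        nlinarith [ht.1, ht.2, norm_nonneg y]
      · rw [show w y = 0 from hK1 _ (by nlinarith), mul_zero]
    simp [e3]
  have hconst := constant_of_has_deriv_right_zero
    (f := fun t : ℝ => ∫ y in closedBall (0 : Euc d) 1, h (x + t • y) * k (‖y‖ ^ 2))
    (a := 0) (b := r) (fun t _ => (hderiv t).continuousAt.continuousWithinAt)
    (fun t ht => by
      have := (hderiv t).hasDerivWithinAt (s := Ici t)
      rwa [hzero t ht] at this) r ⟨hr.le, le_rfl⟩
  simpa using hconst

lemma integral_unitBall_eq_of_lap_eq_zero {d : ℕ} {h : Euc d → ℝ}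
    (hh : ContDiff ℝ (⊤ : ℕ∞) h) {x : Euc d} {r : ℝ} (hr : 0 < r)
    (hlap : ∀ y ∈ closedBall x r, lap h y = 0) :
    ∫ y in closedBall (0 : Euc d) 1, h (x + r • y) = ∫ _ in closedBall (0 : Euc d) 1, h x := by
  set k : ℕ → ℝ → ℝ := fun n s => Real.smoothTransition (n * (1 - s)) with hk
  have hks : ∀ n, ContDiff ℝ (⊤ : ℕ∞) (k n) := fun n =>
    Real.smoothTransition.contDiff.comp (contDiff_const.mul (contDiff_const.sub contDiff_id))
  have hk1 : ∀ n s, 1 ≤ s → k n s = 0 := fun n s hs =>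
    Real.smoothTransition.zero_of_nonpos
      (mul_nonpos_of_nonneg_of_nonpos (Nat.cast_nonneg n) (by linarith))
  have hlim : ∀ g : Euc d → ℝ, Continuous g →
      Tendsto (fun n => ∫ y in closedBall (0 : Euc d) 1, g y * k n (‖y‖ ^ 2)) atTop
        (𝓝 (∫ y in closedBall (0 : Euc d) 1, g y)) := by
    intro g hg
    refine tendsto_integral_of_dominated_convergence (fun y => ‖g y‖) (fun n => ?_) ?_ ?_ ?_
    · have := (hks n).continuous
      exact Continuous.aestronglyMeasurable (by fun_prop)
    · exact hg.norm.continuousOn.integrableOn_compact (isCompact_closedBall _ _)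
    · intro n
      refine ae_of_all _ fun y => ?_
      rw [norm_mul, Real.norm_eq_abs (k n _), abs_of_nonneg (Real.smoothTransition.nonneg _)]
      exact mul_le_of_le_one_right (norm_nonneg _) (Real.smoothTransition.le_one _)
    · have hs : ∀ᵐ y ∂(volume.restrict (closedBall (0 : Euc d) 1)), y ∉ sphere (0 : Euc d) 1 := by
        refine ae_restrict_of_ae ?_
        exact measure_eq_zero_iff_ae_notMem.1 (Measure.addHaar_sphere_of_ne_zero _ _ one_ne_zero)
      filter_upwards [hs, ae_restrict_mem measurableSet_closedBall] with y hy hyb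
      have hy1 : ‖y‖ < 1 := by
        refine lt_of_le_of_ne (by simpa using hyb) (by simpa using hy)
      have hpos : 0 < 1 - ‖y‖ ^ 2 := by nlinarith [norm_nonneg y]
      refine tendsto_const_nhds.congr' ?_
      filter_upwards [eventually_ge_atTop ⌈(1 - ‖y‖ ^ 2)⁻¹⌉₊] with n hn
      have : 1 ≤ (n : ℝ) * (1 - ‖y‖ ^ 2) := by
        have h1 : (1 - ‖y‖ ^ 2)⁻¹ ≤ (n : ℝ) := Nat.ceil_le.1 hn
        rwa [inv_le_iff_one_le_mul₀ hpos] at h1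
      rw [hk]
      simp [Real.smoothTransition.one_of_one_le this]
  have h1 := hlim (fun y => h (x + r • y)) (by have := hh.continuous; fun_prop)
  have h2 := hlim (fun _ => h x) continuous_const
  refine tendsto_nhds_unique h1 (h2.congr fun n => ?_)
  exact (integral_radial_eq_of_lap_eq_zero hh hr hlap (hks n) (hk1 n)).symm

lemma integral_mul_radial_eq_zero {d : ℕ} {v : Euc d → ℝ} {x : Euc d} {R : ℝ} (hR : 0 < R)
    (hv : IntegrableOn v (closedBall x R))
    (hv0 : ∀ r, 0 < r → r ≤ R → ∫ y in closedBall x r, v y = 0) {k : ℝ → ℝ}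
    (hk : ContDiff ℝ (⊤ : ℕ∞) k) (hkR : ∀ s, R ^ 2 ≤ s → k s = 0) :
    ∫ y in closedBall x R, v y * k (‖y - x‖ ^ 2) = 0 := by
  have hk' : Continuous (deriv k) := (contDiff_infty_iff_deriv.1 hk).2.continuous
  set D : Set (Euc d × ℝ) := {p | ‖p.1 - x‖ ^ 2 < p.2} with hD
  have hDm : MeasurableSet D := by
    refine (isOpen_lt ?_ ?_).measurableSet <;> fun_prop
  have hint : Integrable (D.indicator fun p : Euc d × ℝ => v p.1 * deriv k p.2)
      ((volume.restrict (closedBall x R)).prod (volume.restrict (Ioc 0 (R ^ 2)))) := by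
    refine Integrable.indicator ?_ hDm
    refine Integrable.mul_prod hv ?_
    exact (hk'.continuousOn.integrableOn_compact (isCompact_Icc (a := (0 : ℝ)) (b := R ^ 2))).mono_set
      Ioc_subset_Icc_self
  have hswap := integral_integral_swap (f := fun (y : Euc d) (t : ℝ) =>
    D.indicator (fun p : Euc d × ℝ => v p.1 * deriv k p.2) (y, t)) hint
  have hin1 : ∀ y ∈ closedBall x R, ∫ t in Ioc 0 (R ^ 2),
      D.indicator (fun p : Euc d × ℝ => v p.1 * deriv k p.2) (y, t)
        = -(v y * k (‖y - x‖ ^ 2)) := by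
    intro y hy
    rw [mem_closedBall, dist_eq_norm] at hy
    have hs : ‖y - x‖ ^ 2 ≤ R ^ 2 := by gcongr
    have e1 : ∀ t, D.indicator (fun p : Euc d × ℝ => v p.1 * deriv k p.2) (y, t)
        = (Ioi (‖y - x‖ ^ 2)).indicator (fun t => v y * deriv k t) t := by
      intro t
      simp only [indicator, hD, mem_ofPred_eq, mem_Ioi]
    simp only [e1]
    rw [setIntegral_indicator measurableSet_Ioi, inter_comm, ← Ioi_inter_Iic, ← inter_assoc,
      Ioi_inter_Ioi, sup_of_le_left (by positivity), Ioi_inter_Iic, integral_const_mul,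
      ← intervalIntegral.integral_of_le hs, intervalIntegral.integral_deriv_eq_sub
      (fun t _ => hk.differentiable (by simp) t) (hk'.intervalIntegrable _ _), hkR _ le_rfl]
    ring
  have hin2 : ∀ t ∈ Ioc 0 (R ^ 2), ∫ y in closedBall x R,
      D.indicator (fun p : Euc d × ℝ => v p.1 * deriv k p.2) (y, t) = 0 := by
    intro t ht
    have e1 : ∀ y, D.indicator (fun p : Euc d × ℝ => v p.1 * deriv k p.2) (y, t)
        = (ball x (√t)).indicator (fun y => v y * deriv k t) y := by
      intro y
      simp only [indicator, hD, mem_ofPred_eq, mem_ball, dist_eq_norm, Real.lt_sqrt (norm_nonneg _)]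
    have hsq : √t ≤ R := by rw [Real.sqrt_le_left hR.le]; exact ht.2
    have hsq0 : 0 < √t := Real.sqrt_pos.2 ht.1
    simp only [e1]
    rw [setIntegral_indicator measurableSet_ball,
      inter_eq_self_of_subset_right ((ball_subset_ball hsq).trans ball_subset_closedBall),
      integral_mul_const]
    have hae : ball x (√t) =ᵐ[volume] closedBall x (√t) := by
      rw [← ball_union_sphere]
      refine (union_ae_eq_left_of_ae_eq_empty ?_).symm
      exact ae_eq_empty.2 (Measure.addHaar_sphere_of_ne_zero _ _ hsq0.ne')
    rw [setIntegral_congr_set hae, hv0 _ hsq0 hsq, zero_mul]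
  rw [setIntegral_congr_fun measurableSet_closedBall hin1,
    setIntegral_congr_fun measurableSet_Ioc hin2] at hswap
  simpa [integral_neg] using hswap

lemma integrableOn_unitBall_affine {d : ℕ} {h : Euc d → ℝ} {x : Euc d} {r : ℝ} (hr : 0 ≤ r)
    (hh : ContinuousOn h (closedBall x r)) :
    IntegrableOn (fun y => h (x + r • y)) (closedBall (0 : Euc d) 1) := by
  refine ContinuousOn.integrableOn_compact (isCompact_closedBall _ _) (hh.comp (by fun_prop) ?_)
  intro y hy
  rw [mem_closedBall, dist_zero_right] at hy
  rw [mem_closedBall, dist_eq_norm, add_sub_cancel_left, norm_smul, Real.norm_eq_abs,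
    abs_of_nonneg hr]
  exact mul_le_of_le_one_right hr hy

/-- Functions continuous on a closed ball and satisfying the mean value equality over it,
written as an integral over the unit ball. -/
def meanValue {d : ℕ} (x : Euc d) (r : ℝ) (hr : 0 ≤ r) : Submodule ℝ (Euc d → ℝ) where
  carrier := {h | ContinuousOn h (closedBall x r) ∧
    ∫ y in closedBall (0 : Euc d) 1, h (x + r • y) = ∫ _ in closedBall (0 : Euc d) 1, h x}
  zero_mem' := ⟨continuousOn_const, by simp⟩
  add_mem' := by
    intro f g hf hg
    refine ⟨hf.1.add hg.1, ?_⟩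
    simp only [Pi.add_apply]
    rw [integral_add (integrableOn_unitBall_affine hr hf.1)
      (integrableOn_unitBall_affine hr hg.1), hf.2, hg.2, ← integral_add]
    · exact integrableOn_const measure_closedBall_lt_top.ne
    · exact integrableOn_const measure_closedBall_lt_top.ne
  smul_mem' := by
    intro c f hf
    refine ⟨hf.1.const_smul c, ?_⟩
    simp only [Pi.smul_apply]
    rw [integral_smul, hf.2, integral_smul]

lemma mem_meanValue_iff {d : ℕ} {h : Euc d → ℝ} {x : Euc d} {r : ℝ} (hr : 0 < r) :
    h ∈ meanValue x r hr.le ↔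
      ContinuousOn h (closedBall x r) ∧ h x = ⨍ y in closedBall x r, h y ∂volume := by
  have hv : 0 < volume.real (closedBall (0 : Euc d) 1) :=
    ENNReal.toReal_pos (measure_closedBall_pos volume _ one_pos).ne' measure_closedBall_lt_top.ne
  have h1 := Measure.setIntegral_comp_smul (volume : Measure (Euc d)) (fun y => h (x + y))
    (closedBall 0 1) hr.ne'
  have h2 : ∫ y in closedBall (0 : Euc d) r, h (x + y) = ∫ y in closedBall x r, h y := by
    have := (measurePreserving_add_left (volume : Measure (Euc d)) x).setIntegral_preimage_emb
      (MeasurableEquiv.addLeft x).measurableEmbedding h (closedBall x r)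
    rw [← this]
    congr 2
    ext y
    simp [dist_eq_norm]
  rw [smul_unitClosedBall_of_nonneg hr.le, h2] at h1
  have h3 : volume.real (closedBall x r)
      = r ^ Module.finrank ℝ (Euc d) * volume.real (closedBall (0 : Euc d) 1) :=
    Measure.addHaar_real_closedBall' _ _ hr.le
  have hrd : 0 < r ^ Module.finrank ℝ (Euc d) := pow_pos hr _
  refine and_congr_right fun _ => ?_
  rw [h1, setAverage_eq, h3, abs_of_pos (inv_pos.2 hrd), setIntegral_const, smul_eq_mul,
    smul_eq_mul, smul_eq_mul]
  generalize r ^ Module.finrank ℝ (Euc d) = a at *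
  generalize volume.real (closedBall (0 : Euc d) 1) = b at *
  generalize ∫ y in closedBall x r, h y = c
  constructor
  · intro e
    rw [mul_inv, mul_comm a⁻¹, mul_assoc, e]
    field_simp
  · intro e
    rw [e]
    field_simp

lemma mem_meanValue_of_mem_uniformApprox {d : ℕ} {h : Euc d → ℝ} {x : Euc d} {r : ℝ}
    (hr : 0 ≤ r) (hh : h ∈ uniformApprox (meanValue x r hr) (closedBall x r)) :
    h ∈ meanValue x r hr := by
  have hc : ContinuousOn h (closedBall x r) := by
    refine continuousOn_of_uniform_approx_of_continuousOn fun u hu => ?_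
    obtain ⟨ε, hε, hεu⟩ := Metric.mem_uniformity_dist.1 hu
    obtain ⟨g, hg, hgh⟩ := hh ε hε
    exact ⟨g, hg.1, fun y hy => hεu (by rw [Real.dist_eq]; exact hgh y hy)⟩
  refine ⟨hc, ?_⟩
  set V := volume.real (closedBall (0 : Euc d) 1) with hV
  have hV0 : 0 ≤ V := measureReal_nonneg
  refine eq_of_forall_dist_le fun ε hε => ?_
  obtain ⟨g, hg, hgh⟩ := hh (ε / (2 * V + 1)) (by positivity)
  have hxr : x ∈ closedBall x r := mem_closedBall_self hr
  have h1 : ‖∫ y in closedBall (0 : Euc d) 1, (h (x + r • y) - g (x + r • y))‖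
      ≤ ε / (2 * V + 1) * V := by
    refine norm_setIntegral_le_of_norm_le_const measure_closedBall_lt_top fun y hy => ?_
    refine (hgh _ ?_).le
    rw [mem_closedBall, dist_zero_right] at hy
    rw [mem_closedBall, dist_eq_norm, add_sub_cancel_left, norm_smul, Real.norm_eq_abs,
      abs_of_nonneg hr]
    exact mul_le_of_le_one_right hr hy
  have h2 : ‖∫ _ in closedBall (0 : Euc d) 1, (h x - g x)‖ ≤ ε / (2 * V + 1) * V :=
    norm_setIntegral_le_of_norm_le_const measure_closedBall_lt_top fun y _ => (hgh x hxr).le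
  rw [integral_sub (integrableOn_unitBall_affine hr hc) (integrableOn_unitBall_affine hr hg.1),
    Real.norm_eq_abs] at h1
  have hi : ∀ c : ℝ, Integrable (fun _ : Euc d => c) (volume.restrict (closedBall 0 1)) :=
    fun c => integrableOn_const measure_closedBall_lt_top.ne
  rw [integral_sub (hi _) (hi _), Real.norm_eq_abs, ← hg.2] at h2
  have h3 : ε / (2 * V + 1) * V + ε / (2 * V + 1) * V ≤ ε := by
    rw [← two_mul, ← mul_assoc, mul_div_assoc', div_mul_eq_mul_div, div_le_iff₀ (by positivity)]
    nlinarith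
  rw [Real.dist_eq]
  have h4 := abs_le.1 h1
  have h5 := abs_le.1 h2
  rw [abs_le]
  constructor <;> linarith [h4.1, h4.2, h5.1, h5.2]

/-- The space of harmonic functions on `O`, described ball by ball. -/
def harm {d : ℕ} (O : Set (Euc d)) : Submodule ℝ (Euc d → ℝ) :=
  ⨅ (x : Euc d) (r : ℝ) (hr : 0 < r) (_ : closedBall x r ⊆ O), meanValue x r hr.le

lemma mem_harm_iff_forall {d : ℕ} {h : Euc d → ℝ} {O : Set (Euc d)} :
    h ∈ harm O ↔ ∀ x r, ∀ hr : 0 < r, closedBall x r ⊆ O → h ∈ meanValue x r hr.le := by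
  simp [harm, Submodule.mem_iInf]

lemma mem_harm_iff {d : ℕ} {h : Euc d → ℝ} {O : Set (Euc d)} (hO : IsOpen O) :
    h ∈ harm O ↔ HarmOn h O := by
  rw [mem_harm_iff_forall]
  constructor
  · refine fun H => ⟨fun x hx => ?_, fun x r hr hxr =>
      ((mem_meanValue_iff hr).1 (H x r hr hxr)).2⟩
    obtain ⟨r, hr, hxr⟩ := nhds_basis_closedBall.mem_iff.1 (hO.mem_nhds hx)
    exact ((H x r hr hxr).1.continuousAt (closedBall_mem_nhds x hr)).continuousWithinAt
  · exact fun H x r hr hxr => (mem_meanValue_iff hr).2 ⟨H.1.mono hxr, H.2 x r hr hxr⟩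

lemma harm_mono {d : ℕ} {O U : Set (Euc d)} (hOU : O ⊆ U) : harm U ≤ harm O := fun _ hh =>
  mem_harm_iff_forall.2 fun x r hr hxr => mem_harm_iff_forall.1 hh x r hr (hxr.trans hOU)

lemma meanValue_comp_affine {d : ℕ} {h : Euc d → ℝ} {a x : Euc d} {r t : ℝ} (ht : 0 < t)
    (hr : 0 ≤ r) (hh : h ∈ meanValue (a + t • x) (t * r) (by positivity)) :
    (fun y => h (a + t • y)) ∈ meanValue x r hr := by
  refine ⟨hh.1.comp (by fun_prop) fun y hy => ?_, ?_⟩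
  · rw [mem_closedBall, dist_eq_norm] at hy ⊢
    rw [add_sub_add_left_eq_sub, ← smul_sub, norm_smul, Real.norm_eq_abs, abs_of_pos ht]
    gcongr
  · rw [← hh.2]
    congr 1
    ext y
    show h (a + t • (x + r • y)) = _
    rw [smul_add, smul_smul, add_assoc]

lemma newton_mem_meanValue {d : ℕ} {x : Euc d} {r : ℝ} (hr : 0 < r) (hx : r < ‖x‖) :
    newton d ∈ meanValue x r hr.le := by
  obtain ⟨F, hF, hFe, -, -, hF0⟩ := exists_regularized_profile d (sub_pos.2 hx)
  have hge : ∀ y ∈ closedBall x r, (‖x‖ - r) ^ 2 ≤ ‖y‖ ^ 2 := by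
    intro y hy
    rw [mem_closedBall, dist_eq_norm, norm_sub_rev] at hy
    have := norm_sub_norm_le x y
    have : 0 < ‖x‖ - r := sub_pos.2 hx
    gcongr
    linarith
  have hs : ContDiff ℝ (⊤ : ℕ∞) fun y : Euc d => F (‖y‖ ^ 2) := contDiff_radial hF
  refine mem_meanValue_of_mem_uniformApprox hr.le (uniformApprox_congr
    (subset_uniformApprox _ (f := fun y : Euc d => F (‖y‖ ^ 2)) ⟨hs.continuous.continuousOn, ?_⟩)
    fun y hy => hFe _ (hge y hy))
  refine integral_unitBall_eq_of_lap_eq_zero hs hr fun y hy => ?_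
  rw [lap_radial hF]
  exact hF0 _ (hge y hy)

lemma newtonCoeff_mem_uniformApprox {d : ℕ} {P : Submodule ℝ (Euc d → ℝ)} {K : Set (Euc d)}
    {p q : Euc d → Euc d} {m M Q τ : ℝ} (hm : 0 < m) (hQ : 0 < Q) (hτ : 0 < τ)
    (hmp : ∀ x ∈ K, m ≤ ‖p x‖) (hpM : ∀ x ∈ K, ‖p x‖ ≤ M) (hqQ : ∀ x ∈ K, ‖q x‖ ≤ Q)
    (hT : ∀ t : ℝ, 0 < t → t < τ → (fun x => newton d (p x + t • q x)) ∈ uniformApprox P K)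
    (n : ℕ) : (fun x => newtonCoeff d n (p x) (q x)) ∈ uniformApprox P K := by
  obtain ⟨C, hC0, hC⟩ := exists_newton_taylor_bound d (M := M) hm hQ
  refine coeff_mem_uniformApprox (T := fun t x => newton d (p x + t • q x))
    (c := fun n x => newtonCoeff d n (p x) (q x)) (τ := min τ (m / (8 * Q)))
    (lt_min hτ (by positivity)) (fun N => C * (4 * Q / m) ^ N) ?_
    (fun t ht0 ht => hT t ht0 (ht.trans_le (min_le_left _ _))) n
  intro t ht0 ht N x hx
  have := hC (p x) (q x) (hmp x hx) (hpM x hx) (hqQ x hx) t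
    (by rw [abs_of_pos ht0]; exact (ht.trans_le (min_le_right _ _)).le) N
  rw [abs_of_pos ht0, mul_pow] at this
  linarith

lemma newton_add_mem_uniformApprox {d : ℕ} {P : Submodule ℝ (Euc d → ℝ)} {K : Set (Euc d)}
    {p q : Euc d → Euc d} {m M Q : ℝ} (hQ : 0 < Q) (hQm : 8 * Q ≤ m)
    (hmp : ∀ x ∈ K, m ≤ ‖p x‖) (hpM : ∀ x ∈ K, ‖p x‖ ≤ M) (hqQ : ∀ x ∈ K, ‖q x‖ ≤ Q)
    (hc : ∀ n, (fun x => newtonCoeff d n (p x) (q x)) ∈ uniformApprox P K) :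
    (fun x => newton d (p x + q x)) ∈ uniformApprox P K := by
  have hm : 0 < m := by linarith
  obtain ⟨C, hC0, hC⟩ := exists_newton_taylor_bound d (M := M) hm hQ
  refine mem_uniformApprox_of_approx fun ε hε => ?_
  obtain ⟨N, hN⟩ := exists_pow_lt_of_lt_one (show 0 < ε / (C + 1) by positivity)
    (show (1 / 2 : ℝ) < 1 by norm_num)
  rw [lt_div_iff₀ (by positivity)] at hN
  refine ⟨∑ n ∈ Finset.range N, fun x => newtonCoeff d n (p x) (q x),
    Submodule.sum_mem _ fun n _ => hc n, fun x hx => ?_⟩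
  have h1 := hC (p x) (q x) (hmp x hx) (hpM x hx) (hqQ x hx) 1
    (by rw [abs_one, le_div_iff₀ (by positivity)]; linarith) N
  simp only [one_smul, abs_one, one_mul, one_pow, mul_one] at h1
  rw [Finset.sum_apply]
  refine h1.trans_lt ?_
  have h2 : 4 * Q / m ≤ 1 / 2 := by rw [div_le_iff₀ hm]; linarith
  calc C * (4 * Q / m) ^ N ≤ C * (1 / 2) ^ N := by gcongr
    _ ≤ (1 / 2) ^ N * (C + 1) := by nlinarith [pow_pos (show (0 : ℝ) < 1 / 2 by norm_num) N]
    _ < ε := hN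

lemma exists_pos_le_norm_sub {d : ℕ} {K : Set (Euc d)} (hK : IsCompact K) {y : Euc d}
    (hy : y ∉ K) : ∃ m > 0, ∀ x ∈ K, m ≤ ‖x - y‖ := by
  obtain ⟨m, hm, hmK⟩ := Metric.isOpen_iff.1 hK.isClosed.isOpen_compl y hy
  refine ⟨m, hm, fun x hx => ?_⟩
  by_contra! h
  exact hmK (by rwa [mem_ball, dist_eq_norm]) hx

lemma newtonCoeff_translate_mem_harm {d : ℕ} {O : Set (Euc d)} {y : Euc d} (hy : y ∉ O)
    (v : Euc d) (n : ℕ) : (fun x => newtonCoeff d n (x - y) v) ∈ harm O := by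
  refine mem_harm_iff_forall.2 fun x r hr hxr => mem_meanValue_of_mem_uniformApprox _ ?_
  have hyr : y ∉ closedBall x r := fun h => hy (hxr h)
  have hm : 0 < ‖x - y‖ - r := by
    rw [mem_closedBall, dist_eq_norm, norm_sub_rev] at hyr
    linarith
  have hv : 0 < ‖v‖ + 1 := by positivity
  refine newtonCoeff_mem_uniformApprox (p := fun x => x - y) (q := fun _ => v)
    (m := ‖x - y‖ - r) (M := ‖x - y‖ + r) (τ := (‖x - y‖ - r) / (‖v‖ + 1)) hm hv
    (by positivity) ?_ ?_ (fun _ _ => by linarith) ?_ n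
  · intro z hz
    rw [mem_closedBall, dist_eq_norm, norm_sub_rev] at hz
    have := norm_sub_le_norm_sub_add_norm_sub x z y
    linarith
  · intro z hz
    rw [mem_closedBall, dist_eq_norm] at hz
    have := norm_sub_le_norm_sub_add_norm_sub z x y
    linarith
  · intro t ht0 ht
    rw [lt_div_iff₀ hv] at ht
    refine subset_uniformApprox _ ?_
    have h1 := meanValue_comp_affine (h := newton d) (a := -y + t • v) (x := x) (r := r)
      (t := 1) one_pos hr.le ?_
    · convert h1 using 3
      rw [one_smul]; abel
    · have hlt : 1 * r < ‖-y + t • v + (1 : ℝ) • x‖ := by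
        have e : -y + t • v + (1 : ℝ) • x = (x - y) + t • v := by rw [one_smul]; abel
        have h2 := norm_sub_le (x - y + t • v) (t • v)
        rw [add_sub_cancel_right, norm_smul, Real.norm_eq_abs, abs_of_pos ht0] at h2
        rw [e]
        nlinarith
      exact newton_mem_meanValue (by linarith) hlt

lemma newtonCoeff_mem_harm_univ {d : ℕ} {y : Euc d} (hy : y ≠ 0) (n : ℕ) :
    (fun x => newtonCoeff d n y x) ∈ harm (univ : Set (Euc d)) := by
  refine mem_harm_iff_forall.2 fun x r hr _ => mem_meanValue_of_mem_uniformApprox _ ?_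
  have hm : 0 < ‖y‖ := norm_pos_iff.2 hy
  have hQ : 0 < ‖x‖ + r := by positivity
  refine newtonCoeff_mem_uniformApprox (p := fun _ => y) (q := fun x => x)
    (τ := ‖y‖ / (‖x‖ + r)) hm hQ (by positivity) (fun _ _ => le_rfl) (fun _ _ => le_rfl) ?_ ?_ n
  · intro z hz
    rw [mem_closedBall, dist_eq_norm] at hz
    have := norm_sub_norm_le z x
    linarith
  · intro t ht0 ht
    rw [lt_div_iff₀ hQ] at ht
    refine subset_uniformApprox _ (meanValue_comp_affine ht0 hr.le ?_)
    refine newton_mem_meanValue (by positivity) ?_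
    have h2 := norm_sub_le (y + t • x) (t • x)
    rw [add_sub_cancel_right, norm_smul, Real.norm_eq_abs, abs_of_pos ht0] at h2
    linarith

/-- The poles `y` for which the fundamental solution centred at `y` can be approximated uniformly
on `S` by harmonic functions on `O`. -/
def approxPoles {d : ℕ} (O S : Set (Euc d)) : Set (Euc d) :=
  {y | (fun x => newton d (x - y)) ∈ uniformApprox (harm O) S}

section Poles
variable {d : ℕ} {O S : Set (Euc d)} {y₀ y : Euc d} {m : ℝ}

lemma mem_approxPoles_of_coeff (hS : IsCompact S) (hm : ∀ x ∈ S, m ≤ ‖x - y₀‖)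
    (hy : 8 * ‖y - y₀‖ < m)
    (hc : ∀ n, (fun x => newtonCoeff d n (x - y₀) (y₀ - y)) ∈ uniformApprox (harm O) S) :
    y ∈ approxPoles O S := by
  obtain ⟨R, hR⟩ := hS.isBounded.exists_norm_le
  have hm0 : 0 < m := lt_of_le_of_lt (by positivity) hy
  have h1 := newton_add_mem_uniformApprox (p := fun x => x - y₀) (q := fun _ => y₀ - y)
    (Q := m / 8) (M := R + ‖y₀‖) (m := m) (K := S) (by positivity) (by linarith) hm
    (fun x hx => (norm_sub_le _ _).trans (by linarith [hR x hx]))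
    (fun _ _ => by rw [norm_sub_rev]; linarith) hc
  simpa [approxPoles] using h1

lemma mem_approxPoles_of_nhds (hS : IsCompact S) (hm : ∀ x ∈ S, m ≤ ‖x - y₀‖)
    (hy : 8 * ‖y - y₀‖ < m) (hG : approxPoles O S ∈ 𝓝 y₀) : y ∈ approxPoles O S := by
  refine mem_approxPoles_of_coeff hS hm hy fun n => ?_
  obtain ⟨R, hR⟩ := hS.isBounded.exists_norm_le
  obtain ⟨ε, hε, hεG⟩ := Metric.mem_nhds_iff.1 hG
  have hm0 : 0 < m := lt_of_le_of_lt (by positivity) hy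
  refine newtonCoeff_mem_uniformApprox (p := fun x => x - y₀) (q := fun _ => y₀ - y)
    (Q := m / 8) (M := R + ‖y₀‖) (m := m) (τ := ε / m) hm0 (by positivity) (by positivity) hm
    (fun x hx => (norm_sub_le _ _).trans (by linarith [hR x hx]))
    (fun _ _ => by rw [norm_sub_rev]; linarith) ?_ n
  intro t ht0 ht
  rw [lt_div_iff₀ hm0] at ht
  have h1 : y₀ + t • (y - y₀) ∈ approxPoles O S := hεG <| by
    rw [mem_ball, dist_eq_norm, add_sub_cancel_left, norm_smul, Real.norm_eq_abs, abs_of_pos ht0]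
    nlinarith [norm_nonneg (y - y₀)]
  have e : ∀ x, x - y₀ + t • (y₀ - y) = x - (y₀ + t • (y - y₀)) := fun x => by module
  simp only [e]
  exact h1

lemma mem_approxPoles_of_notMem (hS : IsCompact S) (hm : ∀ x ∈ S, m ≤ ‖x - y₀‖)
    (hy : 8 * ‖y - y₀‖ < m) (hO : y₀ ∉ O) : y ∈ approxPoles O S :=
  mem_approxPoles_of_coeff hS hm hy fun n =>
    subset_uniformApprox S (newtonCoeff_translate_mem_harm hO (y₀ - y) n)

lemma mem_approxPoles_of_large {R : ℝ} (hR : 0 < R) (hSR : ∀ x ∈ S, ‖x‖ ≤ R)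
    (hy : 8 * R ≤ ‖y‖) : y ∈ approxPoles O S := by
  have hy0 : -y ≠ 0 := by
    rw [neg_ne_zero, ← norm_pos_iff]
    linarith
  have h1 := newton_add_mem_uniformApprox (P := harm O) (K := S) (p := fun _ => -y)
    (q := fun x => x) (Q := R) (M := ‖y‖) (m := ‖y‖) hR hy
    (fun _ _ => (norm_neg y).ge) (fun _ _ => (norm_neg y).le) hSR
    fun n => subset_uniformApprox S (harm_mono (subset_univ O) (newtonCoeff_mem_harm_univ hy0 n))
  simpa [approxPoles, neg_add_eq_sub] using h1

end Poles

lemma compl_subset_of_isPreconnected_compl {d : ℕ} {O S Z : Set (Euc d)}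
    (hS : IsClosed S) (hconn : IsPreconnected ((inOnePoint O S)ᶜ : Set (OnePoint ↥O)))
    (hZ : IsOpen Z) (hOZ : Oᶜ ⊆ Z) (hZb : Bornology.IsBounded Zᶜ)
    (hZc : Sᶜ ∩ closure Z ⊆ Z) : Sᶜ ⊆ Z := by
  intro a ha
  by_contra haZ
  have hK : IsCompact Zᶜ := isCompact_of_isClosed_isBounded hZ.isClosed_compl hZb
  have hA : IsOpen (Sᶜ ∩ (closure Z)ᶜ) := hS.isOpen_compl.inter isClosed_closure.isOpen_compl
  have haO : a ∈ O := by
    by_contra h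
    exact haZ (hOZ h)
  have hmemA : ∀ x ∉ S, x ∉ Z → x ∈ Sᶜ ∩ (closure Z)ᶜ :=
    fun x hx hxZ => ⟨hx, fun h => hxZ (hZc ⟨hx, h⟩)⟩
  have haA : OnePoint.some (⟨a, haO⟩ : O) ∈
      OnePoint.some '' ((↑) ⁻¹' (Sᶜ ∩ (closure Z)ᶜ) : Set O) := ⟨⟨a, haO⟩, hmemA a ha haZ, rfl⟩
  have hsub : Zᶜ ⊆ O := compl_subset_comm.1 hOZ
  obtain ⟨w, -, ⟨x, hx, rfl⟩, hw⟩ := hconn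
    (OnePoint.some '' ((↑) ⁻¹' (Sᶜ ∩ (closure Z)ᶜ) : Set O))
    (OnePoint.some '' ((↑) ⁻¹' Zᶜ : Set O))ᶜ
    (OnePoint.isOpen_image_coe.2 (hA.preimage continuous_subtype_val))
    (OnePoint.isOpen_compl_image_coe.2 ⟨hZ.isClosed_compl.preimage continuous_subtype_val, by
      rw [Subtype.isCompact_iff, Subtype.image_preimage_coe, inter_eq_right.2 hsub]
      exact hK⟩)
    (by
      intro w hw
      induction w using OnePoint.rec with
      | infty => right; simp
      | coe x =>
        by_cases hx : (x : Euc d) ∈ Z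
        · right
          rintro ⟨x', hx', e⟩
          rw [OnePoint.coe_injective e] at hx'
          exact hx' hx
        · left
          exact ⟨x, hmemA x (fun h => hw ⟨x, h, rfl⟩) hx, rfl⟩)
    ⟨OnePoint.some ⟨a, haO⟩, by
      rintro ⟨x, hx, e⟩
      rw [OnePoint.coe_injective e] at hx
      exact ha hx, haA⟩
    ⟨∞, by rintro ⟨x, -, e⟩; exact OnePoint.coe_ne_infty x e, by simp⟩
  exact hw ⟨x, fun h => hx.2 (subset_closure h), rfl⟩

lemma compl_subset_approxPoles {d : ℕ} {O S : Set (Euc d)} (hSO : S ⊆ O)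
    (hS : IsCompact S) (hconn : IsPreconnected ((inOnePoint O S)ᶜ : Set (OnePoint ↥O))) :
    Sᶜ ⊆ approxPoles O S := by
  suffices h : Sᶜ ⊆ Sᶜ ∩ interior (approxPoles O S) from
    fun y hy => interior_subset (h hy).2
  obtain ⟨R, hR, hSR⟩ := hS.isBounded.exists_pos_norm_le
  have hlarge : ∀ y : Euc d, 8 * R < ‖y‖ → y ∈ Sᶜ ∩ interior (approxPoles O S) := by
    refine fun y hy => ⟨fun hyS => by linarith [hSR y hyS], ?_⟩
    refine mem_interior.2 ⟨{y | 8 * R < ‖y‖}, fun z hz => mem_approxPoles_of_large hR hSR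
      (le_of_lt hz), isOpen_lt continuous_const continuous_norm, hy⟩
  refine compl_subset_of_isPreconnected_compl hS.isClosed hconn
    (hS.isClosed.isOpen_compl.inter isOpen_interior) ?_ ?_ ?_
  · intro y hy
    have hyS : y ∉ S := fun h => hy (hSO h)
    obtain ⟨m, hm, hmS⟩ := exists_pos_le_norm_sub hS hyS
    refine ⟨hyS, mem_interior_iff_mem_nhds.2 (mem_of_superset
      (ball_mem_nhds y (show 0 < m / 8 by positivity)) fun z hz => ?_)⟩
    rw [mem_ball, dist_eq_norm] at hz
    exact mem_approxPoles_of_notMem hS hmS (by linarith) hy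
  · refine (isBounded_closedBall (x := (0 : Euc d)) (r := 8 * R)).subset fun y hy => ?_
    rw [mem_closedBall, dist_zero_right]
    by_contra! h
    exact hy (hlarge y h)
  · rintro y ⟨hyS, hyZ⟩
    obtain ⟨m, hm, hmS⟩ := exists_pos_le_norm_sub hS hyS
    obtain ⟨y₀, ⟨-, hy₀⟩, hd⟩ := Metric.mem_closure_iff.1 hyZ (m / 20) (by positivity)
    rw [dist_eq_norm] at hd
    refine ⟨hyS, mem_interior_iff_mem_nhds.2 (mem_of_superset
      (ball_mem_nhds y (show 0 < m / 40 by positivity)) fun z hz => ?_)⟩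
    rw [mem_ball, dist_eq_norm] at hz
    refine mem_approxPoles_of_nhds (y₀ := y₀) (m := m - m / 20) hS (fun x hx => ?_) ?_
      (mem_interior_iff_mem_nhds.1 hy₀)
    · have := norm_sub_le_norm_sub_add_norm_sub x y₀ y
      rw [norm_sub_rev y₀ y] at this
      linarith [hmS x hx]
    · have := norm_sub_le_norm_sub_add_norm_sub z y y₀
      linarith

/-- The continuous functions on `S` that are uniform limits of restrictions of members of `P`. -/
def approxContinuous {X : Type*} [TopologicalSpace X] (P : Submodule ℝ (X → ℝ)) (S : Set X) :
    Submodule ℝ C(S, ℝ) :=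
  (uniformApprox (P.map (LinearMap.funLeft ℝ ℝ ((↑) : S → X))) univ).comap
    (ContinuousMap.coeFnLinearMap ℝ)

lemma mem_approxContinuous_iff {X : Type*} [TopologicalSpace X] {P : Submodule ℝ (X → ℝ)}
    {S : Set X} {f : X → ℝ} {F : C(S, ℝ)} (hF : ∀ x : S, F x = f x) :
    F ∈ approxContinuous P S ↔ f ∈ uniformApprox P S := by
  constructor
  · intro h ε hε
    obtain ⟨-, ⟨g, hg, rfl⟩, hgF⟩ := h ε hε
    exact ⟨g, hg, fun x hx => by simpa [hF] using hgF ⟨x, hx⟩ (mem_univ _)⟩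
  · intro h ε hε
    obtain ⟨g, hg, hgf⟩ := h ε hε
    exact ⟨_, ⟨g, hg, rfl⟩, fun x _ => by simpa [hF] using hgf x x.2⟩

lemma isClosed_approxContinuous {X : Type*} [TopologicalSpace X] (P : Submodule ℝ (X → ℝ))
    (S : Set X) [CompactSpace S] : IsClosed (approxContinuous P S : Set C(S, ℝ)) := by
  refine isClosed_of_closure_subset fun F hF => ?_
  refine mem_uniformApprox_of_approx fun ε hε => ?_
  obtain ⟨G, hG, hFG⟩ := Metric.mem_closure_iff.1 hF ε hε
  exact ⟨G, hG, fun x _ => (ContinuousMap.dist_apply_le_dist x).trans_lt hFG⟩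

lemma integral_mem_uniformApprox {d : ℕ} {P : Submodule ℝ (Euc d → ℝ)} {S : Set (Euc d)}
    (hS : IsCompact S) {w : Euc d → ℝ} {E : Euc d → Euc d → ℝ} (hw : Continuous w)
    (hwc : HasCompactSupport w) (hE : Continuous E.uncurry)
    (hP : ∀ y, w y ≠ 0 → E y ∈ uniformApprox P S) :
    (fun x => ∫ y, w y * E y x) ∈ uniformApprox P S := by
  have := isCompact_iff_compactSpace.1 hS
  set N := approxContinuous P S
  have : CompleteSpace N := (isClosed_approxContinuous P S).completeSpace_coe
  let Φ : C(Euc d, C(S, ℝ)) := ContinuousMap.curry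
    ⟨fun p => w p.1 * E p.1 p.2, (hw.comp continuous_fst).mul
      (hE.comp (continuous_fst.prodMk (continuous_subtype_val.comp continuous_snd)))⟩
  have hΦ : ∀ y (x : S), Φ y x = w y * E y x := fun _ _ => rfl
  have hN : ∀ y, Φ y ∈ N := by
    intro y
    refine (mem_approxContinuous_iff (f := w y • E y) fun x => hΦ y x).2 ?_
    by_cases h : w y = 0
    · rw [h, zero_smul]
      exact Submodule.zero_mem _
    · exact Submodule.smul_mem _ _ (hP y h)
  let Ψ : Euc d → N := fun y => ⟨Φ y, hN y⟩
  have hΨ : Continuous Ψ := Φ.continuous.subtype_mk _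
  have hΨc : HasCompactSupport Ψ := hwc.mono fun y hy hwy => hy <| by
    refine Subtype.ext (ContinuousMap.ext fun x => ?_)
    show w y * E y x = 0
    rw [hwy, zero_mul]
  have hint : Integrable Ψ := hΨ.integrable_of_hasCompactSupport hΨc
  refine (mem_approxContinuous_iff (F := (∫ y, Ψ y : N)) fun x => ?_).1 (∫ y, Ψ y : N).2
  let L : N →L[ℝ] ℝ := (ContinuousMap.evalCLM ℝ x).comp N.subtypeL
  exact (ContinuousLinearMap.integral_comp_comm (𝕜 := ℝ) (Fₗ := ℝ) L hint).symm

lemma integral_mul_radial_eq {d : ℕ} {u g : Euc d → ℝ} {V : Set (Euc d)} (hu : HarmOn u V)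
    {y : Euc d} {R : ℝ} (hR : 0 < R) (hyV : closedBall y R ⊆ V)
    (hgu : ∀ z ∈ closedBall y R, g z = u z) {k : ℝ → ℝ} (hk : ContDiff ℝ (⊤ : ℕ∞) k)
    (hkR : ∀ s, R ^ 2 ≤ s → k s = 0) :
    ∫ z, g z * k (‖z - y‖ ^ 2) = u y * ∫ z : Euc d, k (‖z‖ ^ 2) := by
  have hc : ContinuousOn u (closedBall y R) := hu.1.mono hyV
  have hkc : Continuous fun z : Euc d => k (‖z - y‖ ^ 2) := hk.continuous.comp (by fun_prop)
  have hi : IntegrableOn (fun z => u z - u y) (closedBall y R) :=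
    (hc.sub continuousOn_const).integrableOn_compact (isCompact_closedBall _ _)
  have hout : ∀ z ∉ closedBall y R, k (‖z - y‖ ^ 2) = 0 := by
    intro z hz
    rw [mem_closedBall, dist_eq_norm, not_le] at hz
    exact hkR _ (by gcongr)
  have h0 := integral_mul_radial_eq_zero hR hi (fun r hr hrR => ?_) hk hkR
  · simp only [sub_mul] at h0
    have hi₁ : IntegrableOn (fun z => u z * k (‖z - y‖ ^ 2)) (closedBall y R) :=
      (hc.mul hkc.continuousOn).integrableOn_compact (isCompact_closedBall _ _)
    have hi₂ : IntegrableOn (fun z => u y * k (‖z - y‖ ^ 2)) (closedBall y R) :=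
      (continuousOn_const.mul hkc.continuousOn).integrableOn_compact (isCompact_closedBall _ _)
    rw [integral_sub hi₁ hi₂, sub_eq_zero] at h0
    rw [← setIntegral_eq_integral_of_forall_compl_eq_zero (s := closedBall y R)
      (fun z hz => by rw [hout z hz, mul_zero]),
      setIntegral_congr_fun isClosed_closedBall.measurableSet
        (g := fun z => u z * k (‖z - y‖ ^ 2)) (fun z hz => by simp only [hgu z hz]), h0,
      setIntegral_eq_integral_of_forall_compl_eq_zero
        (fun z hz => by rw [hout z hz, mul_zero]), integral_const_mul,
      integral_sub_right_eq_self (fun z : Euc d => k (‖z‖ ^ 2)) y]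
  · have hsub : closedBall y r ⊆ closedBall y R := closedBall_subset_closedBall hrR
    have hm : volume.real (closedBall y r) ≠ 0 :=
      (ENNReal.toReal_pos (measure_closedBall_pos volume _ hr).ne' measure_closedBall_lt_top.ne).ne'
    have h1 := hu.2 y r hr (hsub.trans hyV)
    rw [setAverage_eq, smul_eq_mul] at h1
    rw [integral_sub ((hc.mono hsub).integrableOn_compact (isCompact_closedBall _ _))
      (integrableOn_const measure_closedBall_lt_top.ne), setIntegral_const, smul_eq_mul]
    rw [h1]
    field_simp
    ring

lemma hasCompactSupport_mul_radial {d : ℕ} {g : Euc d → ℝ} (hg : HasCompactSupport g)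
    {k : ℝ → ℝ} {R : ℝ} (hR : 0 ≤ R) (hkR : ∀ s, R ^ 2 ≤ s → k s = 0) (a : Euc d → ℝ) :
    HasCompactSupport (fun y z : Euc d => g z * k (‖z - y‖ ^ 2) * a y).uncurry := by
  refine HasCompactSupport.intro ((hg.cthickening (r := R)).prod hg) ?_
  rintro ⟨y, z⟩ h
  by_contra h0
  refine h ?_
  have h0' : g z * k (‖z - y‖ ^ 2) * a y ≠ 0 := h0
  have hz : z ∈ tsupport g := subset_tsupport g (left_ne_zero_of_mul (left_ne_zero_of_mul h0'))
  refine ⟨mem_cthickening_of_dist_le y z R _ hz ?_, hz⟩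
  by_contra! hd
  rw [dist_eq_norm, norm_sub_rev] at hd
  exact right_ne_zero_of_mul (left_ne_zero_of_mul h0') (hkR _ (by gcongr))

lemma hasCompactSupport_integral_mul_radial {d : ℕ} {g : Euc d → ℝ} (hg : HasCompactSupport g)
    {k : ℝ → ℝ} {R : ℝ} (hR : 0 ≤ R) (hkR : ∀ s, R ^ 2 ≤ s → k s = 0) :
    HasCompactSupport fun y : Euc d => ∫ z, g z * k (‖z - y‖ ^ 2) := by
  refine HasCompactSupport.intro (hg.cthickening (r := R)) fun y hy => ?_
  refine integral_eq_zero_of_ae (Eventually.of_forall fun z => ?_)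
  by_contra h0
  have h0' : g z * k (‖z - y‖ ^ 2) ≠ 0 := h0
  have hz : z ∈ tsupport g := subset_tsupport g (left_ne_zero_of_mul h0')
  refine hy (mem_cthickening_of_dist_le y z R _ hz ?_)
  by_contra! hd
  rw [dist_eq_norm, norm_sub_rev] at hd
  exact right_ne_zero_of_mul h0' (hkR _ (by gcongr))

lemma continuous_integral_mul_radial {d : ℕ} {g : Euc d → ℝ} (hg : HasCompactSupport g)
    (hgc : Continuous g) {k : ℝ → ℝ} (hk : Continuous k) :
    Continuous fun y : Euc d => ∫ z, g z * k (‖z - y‖ ^ 2) := by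
  have h := continuous_parametric_integral_of_continuous (μ := volume)
    (f := fun y z : Euc d => g z * k (‖z - y‖ ^ 2)) (s := tsupport g)
    (by unfold Function.uncurry; fun_prop) hg
  convert h using 2 with y
  exact (setIntegral_eq_integral_of_forall_compl_eq_zero
    fun z hz => by rw [image_eq_zero_of_notMem_tsupport hz, zero_mul]).symm

lemma lap_comp_sub {d : ℕ} {h : Euc d → ℝ} (hh : ContDiff ℝ (⊤ : ℕ∞) h) (x : Euc d) :
    lap (fun y => h (y - x)) = fun y => lap h (y - x) := by
  have h1 : ∀ {h : Euc d → ℝ}, Differentiable ℝ h → ∀ i,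
      pd i (fun y => h (y - x)) = fun y => pd i h (y - x) := by
    intro h hh i
    have := pd_comp_affine hh i (-x) 1
    simpa [neg_add_eq_sub] using this
  funext y
  refine Finset.sum_congr rfl fun i _ => ?_
  rw [h1 (hh.differentiable (by simp)), h1 ((contDiff_pd hh i).differentiable (by simp))]

lemma contDiff_radialLap (d : ℕ) {F : ℝ → ℝ} (hF : ContDiff ℝ (⊤ : ℕ∞) F) :
    ContDiff ℝ (⊤ : ℕ∞) (radialLap d F) := by
  have h1 := (contDiff_infty_iff_deriv.1 hF).2
  have h2 := (contDiff_infty_iff_deriv.1 h1).2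
  unfold radialLap
  fun_prop

lemma radialLap_eq_zero_of_eventuallyEq_zero (d : ℕ) {F : ℝ → ℝ} {s : ℝ}
    (hF : F =ᶠ[𝓝 s] 0) : radialLap d F s = 0 := by
  have h1 : deriv F =ᶠ[𝓝 s] 0 := hF.deriv.trans (by simp)
  have h2 : deriv (deriv F) =ᶠ[𝓝 s] 0 := h1.deriv.trans (by simp)
  simp [radialLap, h1.eq_of_nhds, h2.eq_of_nhds]

/-- A smooth potential against a mollified Laplacian of a cut-off of a harmonic function
reproduces that function up to a constant factor. -/
lemma integral_potential_eq {d : ℕ} {u g : Euc d → ℝ} {V : Set (Euc d)} (hu : HarmOn u V)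
    (hg : Continuous g) (hgc : HasCompactSupport g) {F : ℝ → ℝ} (hF : ContDiff ℝ (⊤ : ℕ∞) F)
    {ε : ℝ} (hε : 0 < ε) (hF0 : ∀ s, ε ^ 2 ≤ s → radialLap d F s = 0) {x : Euc d}
    (hball : ∀ y ∈ closedBall x ε, closedBall y ε ⊆ V)
    (hgu : ∀ y ∈ closedBall x ε, ∀ z ∈ closedBall y ε, g z = u z) :
    ∫ y, (∫ z, g z * radialLap d (radialLap d F) (‖z - y‖ ^ 2)) * F (‖y - x‖ ^ 2)
      = (∫ z : Euc d, radialLap d F (‖z‖ ^ 2)) ^ 2 * u x := by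
  set k := radialLap d F with hkdef
  set c := ∫ z : Euc d, k (‖z‖ ^ 2)
  have hk : ContDiff ℝ (⊤ : ℕ∞) k := contDiff_radialLap d hF
  have hk₂ : ContDiff ℝ (⊤ : ℕ∞) (radialLap d k) := contDiff_radialLap d hk
  have hk₂0 : ∀ s, (2 * ε) ^ 2 ≤ s → radialLap d k s = 0 := fun s hs =>
    radialLap_eq_zero_of_eventuallyEq_zero d <| by
      filter_upwards [lt_mem_nhds (show ε ^ 2 < s by nlinarith)] with t ht using hF0 t ht.le
  have hxx : x ∈ closedBall x ε := mem_closedBall_self hε.le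
  have hFc : Continuous fun y => F (‖y - x‖ ^ 2) := hF.continuous.comp (by fun_prop)
  have hkc : Continuous fun y => k (‖y - x‖ ^ 2) := hk.continuous.comp (by fun_prop)
  have hfub : ∀ {q : ℝ → ℝ} {R : ℝ} {a : Euc d → ℝ}, Continuous q → 0 ≤ R →
      (∀ s, R ^ 2 ≤ s → q s = 0) → Continuous a →
      ∫ y, (∫ z, g z * q (‖z - y‖ ^ 2)) * a y = ∫ z, g z * ∫ y, q (‖z - y‖ ^ 2) * a y := by
    intro q R a hq hR hq0 ha
    simp only [← integral_mul_const, ← integral_const_mul]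
    rw [integral_integral_swap_of_hasCompactSupport (by unfold Function.uncurry; fun_prop)
      (hasCompactSupport_mul_radial hgc hR hq0 a)]
    simp only [mul_assoc]
  have hgreen : ∀ z : Euc d, ∫ y, radialLap d k (‖z - y‖ ^ 2) * F (‖y - x‖ ^ 2)
      = ∫ y, k (‖z - y‖ ^ 2) * k (‖y - x‖ ^ 2) := by
    intro z
    have h1 := integral_lap_mul (h := fun y => F (‖y - x‖ ^ 2)) (w := fun y => k (‖y - z‖ ^ 2))
      ((contDiff_radial hF).comp (contDiff_id.sub contDiff_const))
      ((contDiff_radial hk).comp (contDiff_id.sub contDiff_const))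
      ((hasCompactSupport_radial hε.le hF0).comp_homeomorph (Homeomorph.subRight z))
    rw [lap_comp_sub (contDiff_radial hF) x, lap_comp_sub (contDiff_radial hk) z,
      lap_radial hF, lap_radial hk] at h1
    simp only [norm_sub_rev z, mul_comm (radialLap d k _), mul_comm (k (‖_ - z‖ ^ 2))]
    exact h1.symm
  rw [hfub hk₂.continuous (by positivity) hk₂0 hFc]
  simp only [hgreen]
  rw [← hfub hk.continuous hε.le hF0 hkc]
  have h1 : ∀ y, (∫ z, g z * k (‖z - y‖ ^ 2)) * k (‖y - x‖ ^ 2)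
      = c * (u y * k (‖y - x‖ ^ 2)) := by
    intro y
    by_cases hy : y ∈ closedBall x ε
    · rw [integral_mul_radial_eq hu hε (hball y hy) (hgu y hy) hk hF0]
      ring
    · rw [mem_closedBall, dist_eq_norm, not_le] at hy
      rw [hF0 (‖y - x‖ ^ 2) (by gcongr)]
      simp
  simp only [h1]
  rw [integral_const_mul, integral_mul_radial_eq hu hε (hball x hxx) (fun _ _ => rfl) hk hF0]
  ring

lemma exists_cutoff {d : ℕ} {u : Euc d → ℝ} {S V : Set (Euc d)} (hS : IsCompact S)
    (hV : IsOpen V) (hSV : S ⊆ V) (hu : ContinuousOn u V) :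
    ∃ δ > 0, cthickening δ S ⊆ V ∧ ∃ g : Euc d → ℝ, Continuous g ∧ HasCompactSupport g ∧
      ∀ z ∈ cthickening δ S, g z = u z := by
  obtain ⟨δ, hδ, hδV⟩ := hS.exists_cthickening_subset_open hV hSV
  have hsub : cthickening (δ / 2) S ⊆ thickening δ S :=
    cthickening_subset_thickening' hδ (by linarith) S
  obtain ⟨φ, hφ1, hφ0, hφc, -⟩ := exists_continuous_one_zero_of_isCompact
    (hS.cthickening (r := δ / 2)) (isOpen_thickening (δ := δ) (E := S)).isClosed_compl
    (disjoint_compl_right_iff_subset.2 hsub)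
  refine ⟨δ / 2, by positivity, hsub.trans ((thickening_subset_cthickening δ S).trans hδV),
    fun z => φ z * u z, ?_, hφc.mul_right, fun z hz => by simp [hφ1 hz]⟩
  refine (φ.continuous.continuousOn.mul hu).continuous_of_tsupport_subset hV ?_
  refine Subset.trans (closure_minimal ?_ isClosed_cthickening) hδV
  intro z hz
  by_contra h
  refine hz ?_
  have : φ z = 0 := hφ0 fun h' => h (thickening_subset_cthickening δ S h')
  simp [this]

lemma integral_radialLap_eq_zero {d : ℕ} {k : ℝ → ℝ} (hk : ContDiff ℝ (⊤ : ℕ∞) k) {R : ℝ}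
    (hR : 0 ≤ R) (hkR : ∀ s, R ^ 2 ≤ s → k s = 0) :
    ∫ z : Euc d, radialLap d k (‖z‖ ^ 2) = 0 := by
  have h := integral_lap_mul (d := d) (h := fun _ => 1) contDiff_const (contDiff_radial hk)
    (hasCompactSupport_radial hR hkR)
  rw [lap_radial hk] at h
  have h0 : ∀ c : ℝ, ∀ i, pd i (fun _ : Euc d => c) = fun _ => 0 := fun c i => by
    funext x
    simp [pd]
  simpa [lap, h0] using h.symm

lemma mem_uniformApprox_of_compl_subset_approxPoles {d : ℕ} (hd : 0 < d) {u : Euc d → ℝ}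
    {O S V : Set (Euc d)} (hS : IsCompact S) (hpoles : Sᶜ ⊆ approxPoles O S) (hV : IsOpen V)
    (hSV : S ⊆ V) (hu : HarmOn u V) : u ∈ uniformApprox (harm O) S := by
  obtain ⟨δ, hδ, hδV, g, hg, hgc, hgu⟩ := exists_cutoff hS hV hSV hu.1
  obtain ⟨ε, hε, hεδ⟩ : ∃ ε > 0, 4 * ε = δ := ⟨δ / 4, by positivity, by ring⟩
  obtain ⟨F, hF, hFe, hF1, ⟨s, hs, hFs⟩, hF0⟩ := exists_regularized_profile d hε
  set k := radialLap d F with hkdef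
  have hk : ContDiff ℝ (⊤ : ℕ∞) k := contDiff_radialLap d hF
  have hk₂ : ContDiff ℝ (⊤ : ℕ∞) (radialLap d k) := contDiff_radialLap d hk
  have hk₂0 : ∀ s, (2 * ε) ^ 2 ≤ s → radialLap d k s = 0 := fun s hs =>
    radialLap_eq_zero_of_eventuallyEq_zero d <| by
      filter_upwards [lt_mem_nhds (show ε ^ 2 < s by nlinarith)] with t ht using hF0 t ht.le
  have hnear : ∀ x ∈ S, ∀ y, ‖y - x‖ ≤ 2 * ε → closedBall y (2 * ε) ⊆ cthickening δ S := by
    intro x hx y hy z hz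
    refine mem_cthickening_of_dist_le z x δ S hx ((dist_triangle z y x).trans ?_)
    rw [mem_closedBall] at hz
    rw [dist_eq_norm y x]
    linarith
  set w : Euc d → ℝ := fun y => ∫ z, g z * radialLap d k (‖z - y‖ ^ 2) with hw
  have hwS : ∀ y, w y ≠ 0 → ∀ x ∈ S, 2 * ε < ‖y - x‖ := by
    intro y hy x hx
    by_contra! h
    have hb := hnear x hx y h
    refine hy ?_
    rw [hw]
    simp only
    rw [integral_mul_radial_eq hu (by positivity) (hb.trans hδV) (fun z hz => hgu z (hb hz))
      hk₂ hk₂0, integral_radialLap_eq_zero hk hε.le hF0, mul_zero]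
  have hmem := integral_mem_uniformApprox (P := harm O) hS (w := w)
    (E := fun y x => F (‖y - x‖ ^ 2))
    (continuous_integral_mul_radial hgc hg hk₂.continuous)
    (hasCompactSupport_integral_mul_radial hgc (by positivity) hk₂0)
    (hF.continuous.comp (by fun_prop)) (fun y hy => by
      have hyS : y ∉ S := fun h => by
        have := hwS y hy y h
        rw [sub_self, norm_zero] at this
        linarith
      refine uniformApprox_congr (hpoles hyS) fun x hx => ?_
      have := hwS y hy x hx
      rw [hFe _ (by gcongr; linarith), norm_sub_rev y x]
      rfl)
  have hpos : 0 < ∫ z : Euc d, k (‖z‖ ^ 2) := by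
    refine Continuous.integral_pos_of_hasCompactSupport_nonneg_nonzero
      (x := EuclideanSpace.single (⟨0, hd⟩ : Fin d) (√s))
      (contDiff_radial hk).continuous (hasCompactSupport_radial hε.le hF0)
      (fun z => hF1 _) ?_
    rw [PiLp.norm_single, Real.norm_eq_abs, sq_abs, Real.sq_sqrt hs.le]
    exact hFs.ne'
  refine uniformApprox_congr (Submodule.smul_mem _ ((∫ z : Euc d, k (‖z‖ ^ 2)) ^ 2)⁻¹ hmem)
    fun x hx => ?_
  have hin : ∀ y ∈ closedBall x ε, closedBall y ε ⊆ cthickening δ S := fun y hy =>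
    (closedBall_subset_closedBall (by linarith)).trans
      (hnear x hx y (by rw [mem_closedBall, dist_eq_norm] at hy; linarith))
  rw [Pi.smul_apply, integral_potential_eq hu hg hgc hF hε hF0
    (fun y hy => (hin y hy).trans hδV) (fun y hy z hz => hgu z (hin y hy hz)), smul_eq_mul,
    inv_mul_cancel_left₀ (by positivity)]

/-- Let `S` be a compact subset of an open set `O ⊆ ℝ^d` such that
`O_∞ \ S` is connected. Then every function harmonic on an open neighbourhood of `S`
can be uniformly approximated on `S`, within any error `b > 0`, by functions harmonic on `O`. -/
theorem stmt_4 {d : ℕ} (O : Set (Euc d)) (hO : IsOpen O) (hOne : O.Nonempty)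
    (S : Set (Euc d)) (hSO : S ⊆ O) (hS : IsCompact S)
    (hconn : IsConnected ((inOnePoint O S)ᶜ : Set (OnePoint ↥O))) :
    ∀ u : Euc d → ℝ, ∀ V : Set (Euc d), IsOpen V → S ⊆ V → HarmOn u V →
      ∀ b : ℝ, 0 < b → ∃ h : Euc d → ℝ, HarmOn h O ∧ ∀ x ∈ S, |u x - h x| < b := by
  intro u V hV hSV hu b hb
  have hmem : u ∈ uniformApprox (harm O) S := by
    rcases Nat.eq_zero_or_pos d with rfl | hd
    · rcases S.eq_empty_or_nonempty with rfl | hne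
      · exact fun ε hε => ⟨0, Submodule.zero_mem _, by simp⟩
      · have hOV : O ⊆ V := (subset_univ O).trans (Subsingleton.eq_univ_of_nonempty
          (hne.mono hSV)).ge
        exact subset_uniformApprox S ((mem_harm_iff hO).2
          ⟨hu.1.mono hOV, fun x r hr hx => hu.2 x r hr (hx.trans hOV)⟩)
    · exact mem_uniformApprox_of_compl_subset_approxPoles hd hS
        (compl_subset_approxPoles hSO hS hconn.isPreconnected) hV hSV hu
  obtain ⟨h, hh, hhu⟩ := hmem b hb
  exact ⟨h, (mem_harm_iff hO).1 hh, hhu⟩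
end
end

section
/- Let O ⊆ ℝ^d be an open set and let S ⊆ O be compact. For every function h harmonic on an open neighborhood of infill_O S, there exists a sequence (h_j) of functions harmonic on O that converges to h uniformly on infill_O S. -/
open MeasureTheory Metric Set Filter
open scoped ENNReal Topology OnePoint

noncomputable section

/-- The radial profile of the fundamental solution of the Laplacian on `Euc d`, as a function of
the squared norm, normalized so that its derivative is `s ^ (-d / 2)`. -/
def profile (d : ℕ) (s : ℝ) : ℝ :=
  if d = 2 then Real.log s else s ^ (1 - (d : ℝ) / 2) / (1 - (d : ℝ) / 2)

lemma one_sub_half_ne_zero {d : ℕ} (hd : d ≠ 2) : (1 - (d : ℝ) / 2) ≠ 0 := by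
  intro h
  apply hd
  have : (d : ℝ) = 2 := by linarith
  exact_mod_cast this

lemma hasDerivAt_profile (d : ℕ) {s : ℝ} (hs : 0 < s) :
    HasDerivAt (profile d) (s ^ (-((d : ℝ) / 2))) s := by
  by_cases hd : d = 2
  · have : profile d = Real.log := by ext t; simp [profile, hd]
    rw [this]
    convert Real.hasDerivAt_log hs.ne' using 1
    subst hd
    rw [show (-(((2 : ℕ) : ℝ) / 2)) = -1 by norm_num, Real.rpow_neg_one]
  · have : profile d = fun t => t ^ (1 - (d : ℝ) / 2) / (1 - (d : ℝ) / 2) := by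
      ext t; simp [profile, hd]
    rw [this]
    have h0 := one_sub_half_ne_zero hd
    have h1 := (Real.hasDerivAt_rpow_const (p := 1 - (d : ℝ) / 2) (Or.inl hs.ne')).div_const
      (1 - (d : ℝ) / 2)
    rw [mul_div_cancel_left₀ _ h0] at h1
    rwa [show -((d : ℝ) / 2) = 1 - (d : ℝ) / 2 - 1 by ring]

lemma continuousOn_profile (d : ℕ) : ContinuousOn (profile d) (Ioi 0) := fun _ hs =>
  (hasDerivAt_profile d hs).continuousAt.continuousWithinAt

lemma strictMonoOn_profile (d : ℕ) : StrictMonoOn (profile d) (Ioi 0) := by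
  refine strictMonoOn_of_deriv_pos (convex_Ioi 0) (continuousOn_profile d) ?_
  intro s hs
  rw [interior_Ioi] at hs
  rw [(hasDerivAt_profile d hs).deriv]
  exact Real.rpow_pos_of_pos hs _

lemma profile_mul (d : ℕ) : ∃ α β : ℝ → ℝ, ContinuousOn α (Ioi 0) ∧ ContinuousOn β (Ioi 0) ∧
    ∀ l s, 0 < l → 0 < s → profile d (l * s) = α l * profile d s + β l := by
  by_cases hd : d = 2
  · refine ⟨fun _ => 1, Real.log, continuousOn_const,
      fun s hs => (Real.continuousAt_log (ne_of_gt hs)).continuousWithinAt, ?_⟩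
    intro l s hl hs
    simp only [profile, hd, if_true]
    rw [Real.log_mul hl.ne' hs.ne']
    ring
  · refine ⟨fun l => l ^ (1 - (d : ℝ) / 2), fun _ => 0,
      fun s hs => (Real.continuousAt_rpow_const _ _
        (Or.inl (ne_of_gt hs))).continuousWithinAt, continuousOn_const, ?_⟩
    intro l s hl hs
    simp only [profile, hd, if_false]
    rw [Real.mul_rpow hl.le hs.le]
    ring

lemma analyticAt_profile_one (d : ℕ) : AnalyticAt ℝ (profile d) 1 := by
  by_cases hd : d = 2
  · have : profile d = Real.log := by ext t; simp [profile, hd]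
    rw [this]
    exact analyticAt_log one_pos
  · have : profile d = fun t => t ^ (1 - (d : ℝ) / 2) / (1 - (d : ℝ) / 2) := by
      ext t; simp [profile, hd]
    rw [this]
    have h1 : AnalyticAt ℝ (fun t => Real.exp (Real.log t * (1 - (d : ℝ) / 2))) 1 :=
      ((analyticAt_log one_pos).mul analyticAt_const).rexp
    have h2 : AnalyticAt ℝ (fun t : ℝ => t ^ (1 - (d : ℝ) / 2)) 1 := by
      refine h1.congr ?_
      filter_upwards [lt_mem_nhds one_pos] with t ht
      rw [Real.rpow_def_of_pos ht]
    exact h2.div_const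

section Superposition

variable {X : Type*} [TopologicalSpace X]

/-- The superposition operator `u ↦ f ∘ u` on continuous functions, with value `0` where the
composition is not continuous. -/
def superpose (f : ℝ → ℝ) (u : C(X, ℝ)) : C(X, ℝ) := by
  classical exact if h : Continuous (f ∘ u) then ⟨f ∘ u, h⟩ else 0

lemma superpose_apply {f : ℝ → ℝ} (hf : ContinuousOn f (Ioi 0)) {u : C(X, ℝ)}
    (hu : ∀ x, 0 < u x) (x : X) : superpose f u x = f (u x) := by
  have : Continuous (f ∘ u) := hf.comp_continuous u.continuous hu
  simp [superpose, this]

variable [CompactSpace X]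

lemma exists_analyticAt_superpose_one_add [Nonempty X] {f : ℝ → ℝ} (hf : AnalyticAt ℝ f 1) :
    ∃ Ψ : C(X, ℝ) → C(X, ℝ), AnalyticAt ℝ Ψ 0 ∧ ∀ᶠ v in 𝓝 0, ∀ x, Ψ v x = f (1 + v x) := by
  obtain ⟨p, r, hp⟩ := hf
  set q := FormalMultilinearSeries.ofScalars C(X, ℝ) (fun n => p.coeff n) with hq
  have hrad : p.radius ≤ q.radius := by
    refine ENNReal.le_of_forall_nnreal_lt fun r' hr' => ?_
    obtain ⟨C, -, hC⟩ := p.norm_mul_pow_le_of_lt_radius hr'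
    refine q.le_radius_of_bound C fun n => ?_
    rw [hq, FormalMultilinearSeries.ofScalars_norm,
      ← FormalMultilinearSeries.norm_apply_eq_norm_coef]
    exact hC n
  have hrq : r ≤ q.radius := hp.r_le.trans hrad
  have hqs := q.hasFPowerSeriesOnBall (hp.r_pos.trans_le hrq)
  refine ⟨q.sum, hqs.analyticAt, ?_⟩
  filter_upwards [Metric.eball_mem_nhds (0 : C(X, ℝ)) hp.r_pos] with v hv x
  have h1 := hqs.hasSum (Metric.eball_subset_eball hrq hv)
  have h2 := (ContinuousMap.evalCLM ℝ x).hasSum h1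
  have hvx : v x ∈ Metric.eball (0 : ℝ) r := by
    rw [Metric.mem_eball, edist_zero_right] at hv ⊢
    refine lt_of_le_of_lt ?_ hv
    simp only [enorm_le_iff_norm_le]
    exact v.norm_coe_le_norm x
  have h3 := hp.hasSum hvx
  refine HasSum.unique ?_ h3
  have e1 : ∀ n, ContinuousMap.evalCLM ℝ x (q n fun _ => v) = p n fun _ => v x := by
    intro n
    simp [hq, FormalMultilinearSeries.ofScalars, mul_comm]
  simp only [e1, zero_add] at h2
  exact h2

lemma analyticAt_superpose_profile (d : ℕ) {u₀ : C(X, ℝ)} (hu : ∀ x, 0 < u₀ x) :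
    AnalyticAt ℝ (superpose (profile d)) u₀ := by
  rcases isEmpty_or_nonempty X with hX | hX
  · have : (superpose (profile d) : C(X, ℝ) → C(X, ℝ)) = fun _ => 0 := by
      ext u x; exact hX.elim x
    rw [this]
    exact analyticAt_const
  obtain ⟨Ψ, hΨ, hΨf⟩ := exists_analyticAt_superpose_one_add (X := X) (analyticAt_profile_one d)
  obtain ⟨α, β, hα, hβ, hαβ⟩ := profile_mul d
  let A : C(X, ℝ) := ⟨_, hα.comp_continuous u₀.continuous hu⟩
  let B : C(X, ℝ) := ⟨_, hβ.comp_continuous u₀.continuous hu⟩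
  let I : C(X, ℝ) := ⟨fun x => (u₀ x)⁻¹, u₀.continuous.inv₀ fun x => (hu x).ne'⟩
  have hlin : AnalyticAt ℝ (fun u : C(X, ℝ) => I * (u - u₀)) u₀ :=
    analyticAt_const.mul (analyticAt_id.sub analyticAt_const)
  have h0 : I * (u₀ - u₀) = 0 := by simp
  have hΨ' : AnalyticAt ℝ Ψ (I * (u₀ - u₀)) := by rwa [h0]
  have hcomp : AnalyticAt ℝ (fun u : C(X, ℝ) => A * Ψ (I * (u - u₀)) + B) u₀ :=
    (analyticAt_const.mul (AnalyticAt.fun_comp (f := fun u : C(X, ℝ) => I * (u - u₀))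
      hΨ' hlin)).add analyticAt_const
  refine hcomp.congr ?_
  have ht : Tendsto (fun u : C(X, ℝ) => I * (u - u₀)) (𝓝 u₀) (𝓝 0) := by
    have := hlin.continuousAt.tendsto
    rwa [h0] at this
  filter_upwards [ht.eventually hΨf, ht.eventually (Metric.ball_mem_nhds 0 one_pos)] with u h1 h2
  have hpos : ∀ x, 0 < 1 + (u₀ x)⁻¹ * (u x - u₀ x) := by
    intro x
    have h3 := (ContinuousMap.norm_coe_le_norm (I * (u - u₀)) x).trans_lt (mem_ball_zero_iff.1 h2)
    rw [Real.norm_eq_abs, abs_lt] at h3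
    have : (I * (u - u₀)) x = (u₀ x)⁻¹ * (u x - u₀ x) := rfl
    rw [this] at h3
    linarith [h3.1]
  have hprod : ∀ x, u₀ x * (1 + (u₀ x)⁻¹ * (u x - u₀ x)) = u x := by
    intro x
    have := (hu x).ne'
    field_simp
    ring
  ext x
  rw [superpose_apply (continuousOn_profile d)
    (fun x => by rw [← hprod x]; exact mul_pos (hu x) (hpos x)), ← hprod x,
    hαβ _ _ (hu x) (hpos x)]
  have := h1 x
  change α (u₀ x) * Ψ (I * (u - u₀)) x + β (u₀ x) = _
  rw [this]
  rfl

end Superposition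

section Divergence

variable {d : ℕ}

lemma lipschitzWith_one_sub_min_norm_sq :
    LipschitzWith 2 (fun y : Euc d => 1 - (min ‖y‖ 1) ^ 2) := by
  refine LipschitzWith.of_dist_le_mul fun y z => ?_
  have h1 : |min ‖y‖ 1 - min ‖z‖ 1| ≤ dist y z := by
    refine (abs_min_sub_min_le_max _ _ _ _).trans ?_
    simp only [sub_self, abs_zero]
    rw [max_eq_left (abs_nonneg _), dist_eq_norm]
    exact abs_norm_sub_norm_le y z
  have hy0 : 0 ≤ min ‖y‖ 1 := le_min (norm_nonneg _) zero_le_one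
  have hz0 : 0 ≤ min ‖z‖ 1 := le_min (norm_nonneg _) zero_le_one
  have hy1 : min ‖y‖ 1 ≤ 1 := min_le_right _ _
  have hz1 : min ‖z‖ 1 ≤ 1 := min_le_right _ _
  rw [Real.dist_eq]
  have : 1 - min ‖y‖ 1 ^ 2 - (1 - min ‖z‖ 1 ^ 2)
      = -((min ‖y‖ 1 + min ‖z‖ 1) * (min ‖y‖ 1 - min ‖z‖ 1)) := by ring
  rw [this, abs_neg, abs_mul]
  refine mul_le_mul ?_ h1 (abs_nonneg _) (by norm_num)
  rw [abs_of_nonneg (by linarith)]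
  simp only [NNReal.coe_ofNat]
  linarith

lemma lineDeriv_one_sub_min_norm_sq (y v : Euc d) (hy : ‖y‖ ≠ 1) :
    lineDeriv ℝ (fun y : Euc d => 1 - (min ‖y‖ 1) ^ 2) y v
      = (ball (0 : Euc d) 1).indicator (fun y => -2 * inner ℝ y v) y := by
  rcases lt_or_gt_of_ne hy with h | h
  · rw [indicator_of_mem (by simpa using h)]
    have h1 : HasFDerivAt (fun y : Euc d => 1 - ‖y‖ ^ 2) (-(2 • innerSL ℝ y)) y :=
      (hasStrictFDerivAt_norm_sq y).hasFDerivAt.const_sub 1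
    have h2 : (fun y : Euc d => 1 - (min ‖y‖ 1) ^ 2) =ᶠ[𝓝 y] fun y => 1 - ‖y‖ ^ 2 := by
      filter_upwards [continuous_norm.continuousAt.eventually (gt_mem_nhds h)] with z hz
      rw [min_eq_left hz.le]
    rw [((h1.congr_of_eventuallyEq h2).hasLineDerivAt v).lineDeriv]
    simp
  · rw [indicator_of_notMem (by simpa using h.le)]
    have h2 : (fun y : Euc d => 1 - (min ‖y‖ 1) ^ 2) =ᶠ[𝓝 y] fun _ => 0 := by
      filter_upwards [continuous_norm.continuousAt.eventually (lt_mem_nhds h)] with z hz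
      rw [min_eq_right hz.le]
      norm_num
    rw [(((hasFDerivAt_const (𝕜 := ℝ) (0 : ℝ) y).congr_of_eventuallyEq h2).hasLineDerivAt v).lineDeriv]
    simp

lemma integral_lineDeriv_mul_one_sub_min_norm_sq {g : Euc d → ℝ} {D : NNReal}
    (hg : LipschitzWith D g) (hc : HasCompactSupport g) (v : Euc d) :
    ∫ y in closedBall (0 : Euc d) 1, 2 * inner ℝ y v * g y
      = ∫ y, lineDeriv ℝ g y v * (1 - (min ‖y‖ 1) ^ 2) := by
  have h := lipschitzWith_one_sub_min_norm_sq.integral_lineDeriv_mul_eq (μ := volume) hg hc v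
  simp only [lineDeriv_neg, neg_mul, integral_neg] at h
  rw [← neg_eq_iff_eq_neg] at h
  rw [← h, ← integral_neg, ← integral_indicator measurableSet_closedBall]
  refine integral_congr_ae ?_
  have hs : ∀ᵐ y : Euc d, y ∉ sphere (0 : Euc d) 1 := by
    rw [← measure_eq_zero_iff_ae_notMem]
    exact Measure.addHaar_sphere_of_ne_zero _ _ one_ne_zero
  filter_upwards [hs] with y hy
  have hy1 : ‖y‖ ≠ 1 := by simpa using hy
  rw [lineDeriv_one_sub_min_norm_sq y v hy1]
  rcases lt_or_gt_of_ne hy1 with h | h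
  · rw [indicator_of_mem (by simpa using h.le), indicator_of_mem (by simpa using h)]
    ring
  · rw [indicator_of_notMem (by simpa using h), indicator_of_notMem (by simpa using h.le)]
    ring

lemma integral_inner_eq_zero_of_divergence_eq_zero {u : Euc d → Euc d} {U : Set (Euc d)}
    (hU : IsOpen U) (hBU : closedBall 0 1 ⊆ U) (hu : ContDiffOn ℝ 1 u U)
    (hdiv : ∀ y ∈ ball (0 : Euc d) 1,
      ∑ i, lineDeriv ℝ (fun y => u y i) y (EuclideanSpace.single i (1 : ℝ)) = 0) :
    ∫ y in closedBall (0 : Euc d) 1, inner ℝ y (u y) = 0 := by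
  obtain ⟨δ, hδ, hδU⟩ := (isCompact_closedBall (0 : Euc d) 1).exists_cthickening_subset_open hU hBU
  rw [cthickening_closedBall hδ.le zero_le_one] at hδU
  let χ : ContDiffBump (0 : Euc d) := ⟨1 + δ / 2, 1 + δ, by linarith, by linarith⟩
  have hsupp : tsupport χ ⊆ U := by
    rw [χ.tsupport_eq]
    refine Subset.trans (closedBall_subset_closedBall ?_) hδU
    change 1 + δ ≤ δ + 1
    linarith
  let g : Fin d → Euc d → ℝ := fun i y => χ y * u y i
  have hgc : ∀ i, HasCompactSupport (g i) := fun i => χ.hasCompactSupport.mul_right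
  have hg : ∀ i, ContDiff ℝ 1 (g i) := by
    intro i
    rw [contDiff_iff_contDiffAt]
    intro y
    by_cases hy : y ∈ U
    · have h1 : ContDiffAt ℝ 1 u y := hu.contDiffAt (hU.mem_nhds hy)
      have h2 : ContDiffAt ℝ 1 (fun y => u y i) y := (contDiffAt_euclidean (𝕜 := ℝ)).1 h1 i
      exact χ.contDiff.contDiffAt.mul h2
    · have h1 : (χ : Euc d → ℝ) =ᶠ[𝓝 y] 0 :=
        notMem_tsupport_iff_eventuallyEq.1 fun h => hy (hsupp h)
      refine contDiffAt_const (c := (0 : ℝ)).congr_of_eventuallyEq ?_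
      filter_upwards [h1] with z hz
      simp [g, hz]
  have hone : ∀ y ∈ closedBall (0 : Euc d) 1, (χ : Euc d → ℝ) =ᶠ[𝓝 y] 1 := by
    intro y hy
    refine χ.eventuallyEq_one_of_mem_ball ?_
    rw [mem_ball]
    rw [mem_closedBall] at hy
    change _ < 1 + δ / 2
    linarith
  have hgi : ∀ i, ∫ y in closedBall (0 : Euc d) 1,
      2 * inner ℝ y (EuclideanSpace.single i (1 : ℝ)) * g i y
      = ∫ y, lineDeriv ℝ (g i) y (EuclideanSpace.single i (1 : ℝ)) * (1 - (min ‖y‖ 1) ^ 2) := by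
    intro i
    obtain ⟨D, hD⟩ := ContDiff.lipschitzWith_of_hasCompactSupport (hgc i) (hg i) one_ne_zero
    exact integral_lineDeriv_mul_one_sub_min_norm_sq hD (hgc i) _
  have hsum := Finset.sum_congr (s₁ := Finset.univ) rfl fun i _ => hgi i
  rw [← integral_finsetSum, ← integral_finsetSum] at hsum
  rotate_left
  · intro i _
    have h1 : ∀ y v, lineDeriv ℝ (g i) y v = fderiv ℝ (g i) y v := fun y v =>
      ((hg i).differentiable one_ne_zero y).lineDeriv_eq_fderiv
    simp only [h1]
    refine Continuous.integrable_of_hasCompactSupport ?_ ?_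
    · exact (((hg i).continuous_fderiv one_ne_zero).clm_apply continuous_const).mul (by fun_prop)
    · refine HasCompactSupport.mul_right ?_
      exact ((hgc i).fderiv (𝕜 := ℝ)).comp_left (g := fun L => L (EuclideanSpace.single i (1 : ℝ)))
        (by simp)
  · intro i _
    refine ContinuousOn.integrableOn_compact (isCompact_closedBall _ _) (Continuous.continuousOn ?_)
    have := (hg i).continuous
    fun_prop
  have hL : ∫ y in closedBall (0 : Euc d) 1,
      ∑ i, 2 * inner ℝ y (EuclideanSpace.single i (1 : ℝ)) * g i y
      = 2 * ∫ y in closedBall (0 : Euc d) 1, inner ℝ y (u y) := by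
    rw [← integral_const_mul]
    refine setIntegral_congr_fun measurableSet_closedBall fun y hy => ?_
    simp only [g, (hone y hy).eq_of_nhds, PiLp.inner_apply, Finset.mul_sum]
    refine Finset.sum_congr rfl fun i _ => ?_
    simp
    ring
  have hR : ∫ y, ∑ i, lineDeriv ℝ (g i) y (EuclideanSpace.single i (1 : ℝ))
      * (1 - (min ‖y‖ 1) ^ 2) = 0 := by
    rw [← integral_zero (α := Euc d) (G := ℝ) (μ := volume)]
    congr 1
    ext y
    rw [← Finset.sum_mul]
    by_cases hy : ‖y‖ < 1
    · have h1 : ∀ i, lineDeriv ℝ (g i) y (EuclideanSpace.single i (1 : ℝ))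
          = lineDeriv ℝ (fun y => u y i) y (EuclideanSpace.single i (1 : ℝ)) := by
        intro i
        refine Filter.EventuallyEq.lineDeriv_eq ?_
        filter_upwards [hone y (by simpa using hy.le)] with z hz
        simp [g, hz]
      simp only [h1]
      rw [hdiv y (by simpa using hy), zero_mul]
    · rw [min_eq_right (not_lt.1 hy)]
      norm_num
  rw [hL, hR] at hsum
  linarith

end Divergence

section Average

variable {d : ℕ}

lemma setAverage_closedBall_eq (F : Euc d → ℝ) (x : Euc d) {r : ℝ} (hr : r ≠ 0) :
    ⨍ y in closedBall x |r|, F y = ⨍ y in closedBall (0 : Euc d) 1, F (x + r • y) := by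
  set c : ℝ := |(r ^ Module.finrank ℝ (Euc d))⁻¹| with hc
  have hc0 : c ≠ 0 := abs_ne_zero.2 (inv_ne_zero (pow_ne_zero _ hr))
  have key : ∀ G : Euc d → ℝ, ∫ y in closedBall (0 : Euc d) 1, G (x + r • y)
      = c * ∫ y in closedBall x |r|, G y := by
    intro G
    rw [Measure.setIntegral_comp_smul volume (fun z => G (x + z)) _ hr, _root_.smul_closedBall _ _ zero_le_one,
      smul_zero, mul_one, Real.norm_eq_abs, smul_eq_mul]
    congr 1
    have h := (measurePreserving_add_left (volume : Measure (Euc d)) x).setIntegral_preimage_emb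
      (measurableEmbedding_addLeft x) G (closedBall x |r|)
    rw [← h, preimage_add_closedBall, sub_self]
  have h1 := key fun _ => 1
  simp only [setIntegral_const, smul_eq_mul, mul_one] at h1
  rw [setAverage_eq, setAverage_eq, key F, h1, smul_eq_mul, smul_eq_mul, mul_inv]
  field_simp

end Average

section Curves

variable {X : Type*} [TopologicalSpace X]

/-- The curve `t ↦ a + t b + t² c` of continuous functions. -/
def quadCurve (a b c : C(X, ℝ)) (t : ℝ) : C(X, ℝ) := a + t • b + t ^ 2 • c

lemma quadCurve_apply (a b c : C(X, ℝ)) (t : ℝ) (x : X) :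
    quadCurve a b c t x = a x + t * b x + t ^ 2 * c x := rfl

variable [CompactSpace X]

lemma eventually_forall_pos {u₀ : C(X, ℝ)} (hu : ∀ x, 0 < u₀ x) :
    ∀ᶠ u in 𝓝 u₀, ∀ x, 0 < u x := by
  have h := (ContinuousMap.isOpen_setOfPred_mapsTo (X := X) (Y := ℝ) isCompact_univ
    (isOpen_Ioi (a := (0 : ℝ)))).mem_nhds (show u₀ ∈ _ from fun x _ => hu x)
  filter_upwards [h] with u hu x using hu (mem_univ x)

lemma analyticAt_quadCurve (a b c : C(X, ℝ)) (t : ℝ) : AnalyticAt ℝ (quadCurve a b c) t :=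
  (analyticAt_const.add (analyticAt_id.smul analyticAt_const)).add
    ((analyticAt_id.pow 2).smul analyticAt_const)

lemma analyticAt_superpose_quadCurve (d : ℕ) (a b c : C(X, ℝ)) {t : ℝ}
    (h : ∀ x, 0 < a x + t * b x + t ^ 2 * c x) :
    AnalyticAt ℝ (fun t => superpose (profile d) (quadCurve a b c t)) t :=
  AnalyticAt.fun_comp (f := quadCurve a b c) (analyticAt_superpose_profile d h)
    (analyticAt_quadCurve a b c t)

lemma eventually_superpose_quadCurve (d : ℕ) (a b c : C(X, ℝ)) {t : ℝ}
    (h : ∀ x, 0 < a x + t * b x + t ^ 2 * c x) :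
    ∀ᶠ s in 𝓝 t, ∀ x, superpose (profile d) (quadCurve a b c s) x
      = profile d (a x + s * b x + s ^ 2 * c x) := by
  filter_upwards [(analyticAt_quadCurve a b c t).continuousAt.eventually
    (eventually_forall_pos (u₀ := quadCurve a b c t) h)] with s hs x
  rw [superpose_apply (continuousOn_profile d) hs, quadCurve_apply]

/-- Integration against a finite measure as a continuous linear functional on continuous
functions. -/
def integralFunctional [MeasurableSpace X] [BorelSpace X] (μ : Measure X) [IsFiniteMeasure μ] :
    C(X, ℝ) →L[ℝ] ℝ :=
  LinearMap.mkContinuous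
    { toFun := fun φ => ∫ x, φ x ∂μ
      map_add' := fun φ ψ => integral_add
        (φ.continuous.integrable_of_hasCompactSupport (HasCompactSupport.of_compactSpace _))
        (ψ.continuous.integrable_of_hasCompactSupport (HasCompactSupport.of_compactSpace _))
      map_smul' := fun c φ => integral_const_mul c _ }
    (μ.real univ) fun φ => by
      rw [mul_comm]
      exact norm_integral_le_of_norm_le_const (Eventually.of_forall φ.norm_coe_le_norm)

lemma integralFunctional_apply [MeasurableSpace X] [BorelSpace X] (μ : Measure X)
    [IsFiniteMeasure μ] (φ : C(X, ℝ)) : integralFunctional μ φ = ∫ x, φ x ∂μ := rfl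

end Curves

section MeanValue

variable {d : ℕ}

instance isFiniteMeasure_comap_closedBall (x : Euc d) (r : ℝ) :
    IsFiniteMeasure (Measure.comap ((↑) : closedBall x r → Euc d) volume) := by
  refine ⟨?_⟩
  rw [comap_subtype_coe_apply measurableSet_closedBall, image_univ, Subtype.range_coe]
  exact measure_closedBall_lt_top

lemma norm_add_smul_sq (x y : Euc d) (s : ℝ) :
    ‖x + s • y‖ ^ 2 = ‖x‖ ^ 2 + s * (2 * inner ℝ x y) + s ^ 2 * ‖y‖ ^ 2 := by
  rw [norm_add_sq_real, inner_smul_right, norm_smul, mul_pow, Real.norm_eq_abs, sq_abs]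
  ring

lemma integral_inner_rpow_eq_zero (x : Euc d) (s : ℝ)
    (h : ∀ y ∈ closedBall (0 : Euc d) 1, x + s • y ≠ 0) :
    ∫ y in closedBall (0 : Euc d) 1,
      inner ℝ y ((‖x + s • y‖ ^ 2) ^ (-((d : ℝ) / 2)) • (x + s • y)) = 0 := by
  have hcont : Continuous fun y : Euc d => x + s • y := by fun_prop
  refine integral_inner_eq_zero_of_divergence_eq_zero (U := {y | x + s • y ≠ 0})
    (isOpen_ne.preimage hcont) h ?_ ?_
  · intro y hy
    have hy' : ‖x + s • y‖ ^ 2 ≠ 0 := by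
      have : x + s • y ≠ 0 := hy
      positivity
    have h1 : ContDiffAt ℝ 1 (fun y : Euc d => x + s • y) y := by fun_prop
    exact (((h1.norm_sq ℝ).rpow_const_of_ne hy').smul h1).contDiffWithinAt
  · intro y hy
    set z := x + s • y with hz
    have hz0 : z ≠ 0 := h y (ball_subset_closedBall hy)
    have hQ : 0 < ‖z‖ ^ 2 := by positivity
    set p : ℝ := -((d : ℝ) / 2) with hp
    have hder : ∀ i, lineDeriv ℝ (fun y => ((‖x + s • y‖ ^ 2) ^ p • (x + s • y)) i) y
        (EuclideanSpace.single i (1 : ℝ))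
        = 2 * s * p * (‖z‖ ^ 2) ^ (p - 1) * z i ^ 2 + s * (‖z‖ ^ 2) ^ p := by
      intro i
      refine HasLineDerivAt.lineDeriv ?_
      unfold HasLineDerivAt
      have e1 : ∀ t : ℝ, x + s • (y + t • EuclideanSpace.single i (1 : ℝ))
          = z + (t * s) • EuclideanSpace.single i (1 : ℝ) := by
        intro t
        rw [hz, smul_add, smul_smul, add_assoc, mul_comm s t]
      have e2 : ∀ t : ℝ, ‖z + (t * s) • EuclideanSpace.single i (1 : ℝ)‖ ^ 2
          = ‖z‖ ^ 2 + t * (2 * s * z i) + t ^ 2 * s ^ 2 := by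
        intro t
        rw [norm_add_smul_sq, EuclideanSpace.inner_single_right]
        simp
        ring
      simp only [e1, PiLp.smul_apply, e2, PiLp.add_apply, PiLp.single_apply, if_true,
        smul_eq_mul, mul_one]
      have d1 : HasDerivAt (fun t : ℝ => ‖z‖ ^ 2 + t * (2 * s * z i) + t ^ 2 * s ^ 2)
          (2 * s * z i) 0 := by
        have := (((hasDerivAt_id (0 : ℝ)).mul_const (2 * s * z i)).const_add (‖z‖ ^ 2)).add
          (((hasDerivAt_id (0 : ℝ)).pow 2).mul_const (s ^ 2))
        convert! this using 1
        simp
      have d2 : HasDerivAt (fun t : ℝ => z i + t * s) s 0 := by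
        simpa using ((hasDerivAt_id (0 : ℝ)).mul_const s).const_add (z i)
      have d3 := (d1.rpow_const (p := p) (Or.inl (by simpa using hQ.ne'))).mul d2
      convert! d3 using 1
      simp
      ring
    simp only [hder]
    rw [Finset.sum_add_distrib, ← Finset.mul_sum]
    have hn : ∑ i, z i ^ 2 = ‖z‖ ^ 2 := (EuclideanSpace.real_norm_sq_eq z).symm
    rw [hn, mul_assoc, ← Real.rpow_add_one hQ.ne', sub_add_cancel]
    simp [hp]
    ring

/-- The mean value property of the fundamental solution away from its pole. -/
lemma profile_norm_sq_eq_setAverage {x : Euc d} {r : ℝ} (hr : 0 < r)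
    (h0 : (0 : Euc d) ∉ closedBall x r) :
    profile d (‖x‖ ^ 2) = ⨍ y in closedBall x r, profile d (‖y‖ ^ 2) := by
  rw [← abs_of_pos hr, setAverage_closedBall_eq _ _ hr.ne']
  let a : C(closedBall (0 : Euc d) 1, ℝ) := .const _ (‖x‖ ^ 2)
  let b : C(closedBall (0 : Euc d) 1, ℝ) := ⟨fun y => 2 * inner ℝ x (y : Euc d), by fun_prop⟩
  let c : C(closedBall (0 : Euc d) 1, ℝ) := ⟨fun y => ‖(y : Euc d)‖ ^ 2, by fun_prop⟩
  have hq : ∀ (s : ℝ) (y : closedBall (0 : Euc d) 1),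
      a y + s * b y + s ^ 2 * c y = ‖x + s • (y : Euc d)‖ ^ 2 := by
    intro s y
    rw [norm_add_smul_sq]
    rfl
  have hne : ∀ s ∈ Icc 0 r, ∀ y ∈ closedBall (0 : Euc d) 1, x + s • y ≠ 0 := by
    intro s hs y hy h
    apply h0
    rw [mem_closedBall, dist_comm, dist_zero_right, eq_neg_of_add_eq_zero_left h, norm_neg,
      norm_smul, Real.norm_eq_abs, abs_of_nonneg hs.1]
    rw [mem_closedBall_zero_iff] at hy
    nlinarith [hs.1, hs.2, norm_nonneg y]
  have hpos : ∀ s ∈ Icc 0 r, ∀ y : closedBall (0 : Euc d) 1,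
      0 < a y + s * b y + s ^ 2 * c y := by
    intro s hs y
    rw [hq]
    have := hne s hs y y.2
    positivity
  set J : ℝ → C(closedBall (0 : Euc d) 1, ℝ) :=
    fun s => superpose (profile d) (quadCurve a b c s) with hJ
  have hJa : ∀ s ∈ Icc 0 r, AnalyticAt ℝ J s := fun s hs =>
    analyticAt_superpose_quadCurve d a b c (hpos s hs)
  have hJv : ∀ s ∈ Icc 0 r, ∀ y, J s y = profile d (‖x + s • (y : Euc d)‖ ^ 2) := by
    intro s hs y
    rw [← hq]
    exact (eventually_superpose_quadCurve d a b c (hpos s hs)).self_of_nhds y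
  let Λ := integralFunctional
    (Measure.comap ((↑) : closedBall (0 : Euc d) 1 → Euc d) volume)
  have hder : ∀ s ∈ Icc 0 r, HasDerivAt (fun s => Λ (J s)) 0 s := by
    intro s hs
    have h1 := (hJa s hs).differentiableAt.hasDerivAt
    have h2 : ∀ y : closedBall (0 : Euc d) 1, deriv J s y
        = 2 * inner ℝ (y : Euc d)
          ((‖x + s • (y : Euc d)‖ ^ 2) ^ (-((d : ℝ) / 2)) • (x + s • (y : Euc d))) := by
      intro y
      have h3 := (ContinuousMap.evalCLM ℝ y).hasFDerivAt.comp_hasDerivAt s h1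
      have h4 : HasDerivAt (fun t => a y + t * b y + t ^ 2 * c y)
          (b y + 2 * s * c y) s := by
        have := (((hasDerivAt_id s).mul_const (b y)).const_add (a y)).add
          (((hasDerivAt_id s).pow 2).mul_const (c y))
        convert! this using 1
        simp
      have h5 := (hasDerivAt_profile d (hpos s hs y)).comp s h4
      have h6 := h5.congr_of_eventuallyEq (f₁ := fun t => J t y) (by
        filter_upwards [eventually_superpose_quadCurve d a b c (hpos s hs)] with t ht using ht y)
      have h7 := h3.unique h6
      change deriv J s y = _ at h7
      rw [h7, hq, inner_smul_right, inner_add_right, inner_smul_right, real_inner_self_eq_norm_sq,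
        real_inner_comm]
      change _ * (2 * inner ℝ x (y : Euc d) + 2 * s * ‖(y : Euc d)‖ ^ 2) = _
      ring
    have h8 := Λ.hasFDerivAt.comp_hasDerivAt s h1
    have h9 : Λ (deriv J s) = 0 := by
      rw [integralFunctional_apply]
      simp only [h2]
      rw [integral_subtype_comap measurableSet_closedBall (fun y : Euc d => 2 * inner ℝ y
          ((‖x + s • y‖ ^ 2) ^ (-((d : ℝ) / 2)) • (x + s • y))), integral_const_mul,
        integral_inner_rpow_eq_zero x s (hne s hs), mul_zero]
    rwa [h9] at h8
  have hconst := constant_of_has_deriv_right_zero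
    (fun s hs => (hder s hs).continuousAt.continuousWithinAt)
    (fun s hs => (hder s (Ico_subset_Icc_self hs)).hasDerivWithinAt) r (right_mem_Icc.2 hr.le)
  have hΛ : ∀ s ∈ Icc 0 r,
      Λ (J s) = ∫ y in closedBall (0 : Euc d) 1, profile d (‖x + s • y‖ ^ 2) := by
    intro s hs
    rw [integralFunctional_apply]
    simp only [hJv s hs]
    exact integral_subtype_comap measurableSet_closedBall
      (fun y : Euc d => profile d (‖x + s • y‖ ^ 2))
  rw [hΛ r (right_mem_Icc.2 hr.le), hΛ 0 (left_mem_Icc.2 hr.le)] at hconst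
  have hv : (volume : Measure (Euc d)).real (closedBall 0 1) ≠ 0 :=
    (ENNReal.toReal_pos (measure_closedBall_pos _ _ one_pos).ne' measure_closedBall_lt_top.ne).ne'
  rw [setAverage_eq, hconst]
  simp only [zero_smul, add_zero, setIntegral_const, smul_eq_mul]
  field_simp

end MeanValue

section HarmonicFamilies

variable {d : ℕ}

lemma HarmOn.add {f g : Euc d → ℝ} {O : Set (Euc d)} (hf : HarmOn f O) (hg : HarmOn g O) :
    HarmOn (fun x => f x + g x) O := by
  refine ⟨hf.1.add hg.1, fun x r hr hB => ?_⟩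
  change f x + g x = _
  rw [hf.2 x r hr hB, hg.2 x r hr hB, setAverage_eq, setAverage_eq, setAverage_eq, integral_add
    ((hf.1.mono hB).integrableOn_compact (isCompact_closedBall x r))
    ((hg.1.mono hB).integrableOn_compact (isCompact_closedBall x r)), smul_add]

lemma HarmOn.const_mul {f : Euc d → ℝ} {O : Set (Euc d)} (hf : HarmOn f O) (c : ℝ) :
    HarmOn (fun x => c * f x) O := by
  refine ⟨continuousOn_const.mul hf.1, fun x r hr hB => ?_⟩
  change c * f x = _
  rw [hf.2 x r hr hB, setAverage_eq, setAverage_eq, integral_const_mul, smul_eq_mul, smul_eq_mul]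
  ring

lemma harmOn_zero (O : Set (Euc d)) : HarmOn (fun _ => 0) O :=
  ⟨continuousOn_const, fun x r _ _ => by simp⟩

/-- The restrictions to `K` of the functions harmonic on `O`. -/
def harmRestrict (O K : Set (Euc d)) : Submodule ℝ C(K, ℝ) where
  carrier := {φ | ∃ h, HarmOn h O ∧ ∀ x : K, φ x = h x}
  add_mem' := by
    rintro φ ψ ⟨h, hh, hφ⟩ ⟨k, hk, hψ⟩
    exact ⟨_, hh.add hk, fun x => by simp [hφ, hψ]⟩
  zero_mem' := ⟨_, harmOn_zero O, fun x => rfl⟩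
  smul_mem' := by
    rintro c φ ⟨h, hh, hφ⟩
    exact ⟨_, hh.const_mul c, fun x => by simp [hφ]⟩

lemma iteratedDeriv_clm_comp {E : Type*} [NormedAddCommGroup E] [NormedSpace ℝ E] [CompleteSpace E]
    (Λ : E →L[ℝ] ℝ) {J : ℝ → E} {t : ℝ} (hJ : AnalyticAt ℝ J t) (n : ℕ) :
    iteratedDeriv n (fun s => Λ (J s)) t = Λ (iteratedDeriv n J t) := by
  have h := Λ.iteratedFDeriv_comp_left (hJ.contDiffAt (n := n)) (i := n) le_rfl
  change iteratedFDeriv ℝ n (Λ ∘ J) t _ = _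
  rw [h]
  rfl

variable (a b c : C(Euc d, ℝ))

/-- The curve `t ↦ profile d (a + t b + t² c)` of continuous functions on `L`. -/
def profileCurve (L : Set (Euc d)) (t : ℝ) : C(L, ℝ) :=
  superpose (profile d) (quadCurve (a.restrict L) (b.restrict L) (c.restrict L) t)

lemma analyticAt_profileCurve {L : Set (Euc d)} [CompactSpace L] {t : ℝ}
    (h : ∀ x ∈ L, 0 < a x + t * b x + t ^ 2 * c x) :
    AnalyticAt ℝ (profileCurve a b c L) t := by
  exact analyticAt_superpose_quadCurve d _ _ _ fun x => h x x.2

lemma eventually_profileCurve {L : Set (Euc d)} [CompactSpace L] {t : ℝ}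
    (h : ∀ x ∈ L, 0 < a x + t * b x + t ^ 2 * c x) :
    ∀ᶠ s in 𝓝 t, ∀ x : L, profileCurve a b c L s x
      = profile d (a x + s * b x + s ^ 2 * c x) := by
  exact eventually_superpose_quadCurve d _ _ _ fun x => h x x.2

lemma iteratedDeriv_profileCurve {L : Set (Euc d)} [CompactSpace L]
    (h : ∀ x ∈ L, 0 < a x) (n : ℕ) (x : L) :
    iteratedDeriv n (profileCurve a b c L) 0 x
      = iteratedDeriv n (fun t => profile d (a x + t * b x + t ^ 2 * c x)) 0 := by
  have h' : ∀ x ∈ L, 0 < a x + 0 * b x + 0 ^ 2 * c x := by simpa using h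
  have h1 := iteratedDeriv_clm_comp (ContinuousMap.evalCLM ℝ x)
    (analyticAt_profileCurve a b c h') n
  rw [ContinuousMap.evalCLM_apply] at h1
  rw [← h1]
  refine Filter.EventuallyEq.iteratedDeriv_eq n ?_
  filter_upwards [eventually_profileCurve a b c h'] with s hs using hs x

/-- The Taylor coefficients in the parameter of an analytic family of harmonic functions are
harmonic. -/
lemma harmOn_iteratedDeriv {U : Set (Euc d)} (hU : IsOpen U) (hpos : ∀ x ∈ U, 0 < a x)
    (hmean : ∀ x r, 0 < r → closedBall x r ⊆ U → ∀ᶠ t in 𝓝 (0 : ℝ),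
      profile d (a x + t * b x + t ^ 2 * c x)
        = ⨍ y in closedBall x r, profile d (a y + t * b y + t ^ 2 * c y)) (n : ℕ) :
    HarmOn (fun x => iteratedDeriv n (fun t => profile d (a x + t * b x + t ^ 2 * c x)) 0) U := by
  have hcont : ∀ L ⊆ U, IsCompact L → ContinuousOn
      (fun x => iteratedDeriv n (fun t => profile d (a x + t * b x + t ^ 2 * c x)) 0) L := by
    intro L hLU hL
    rw [continuousOn_iff_continuous_domRestrict]
    have := isCompact_iff_compactSpace.1 hL
    convert! (iteratedDeriv n (profileCurve a b c L) 0).continuous using 1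
    ext x
    rw [iteratedDeriv_profileCurve a b c (fun x hx => hpos x (hLU hx)) n x]
    rfl
  constructor
  · intro x hx
    obtain ⟨ε, hε, hεU⟩ := nhds_basis_closedBall.mem_iff.1 (hU.mem_nhds hx)
    exact ((hcont _ hεU (isCompact_closedBall x ε)).continuousAt
      (closedBall_mem_nhds x hε)).continuousWithinAt
  · intro x r hr hB
    set L := closedBall x r with hL
    have hLs : CompactSpace L := isCompact_iff_compactSpace.1 (isCompact_closedBall x r)
    have hposL : ∀ x ∈ L, 0 < a x := fun x hx => hpos x (hB hx)
    have hposL' : ∀ x ∈ L, 0 < a x + 0 * b x + 0 ^ 2 * c x := by simpa using hposL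
    let x₀ : L := ⟨x, mem_closedBall_self hr.le⟩
    let Λ : C(L, ℝ) →L[ℝ] ℝ := ContinuousMap.evalCLM ℝ x₀ - ((volume : Measure (Euc d)).real L)⁻¹ •
      integralFunctional (Measure.comap ((↑) : L → Euc d) volume)
    have hΛ : ∀ (φ : C(L, ℝ)) (g : Euc d → ℝ), (∀ y : L, φ y = g y) →
        Λ φ = g x - ⨍ y in L, g y := by
      intro φ g hg
      rw [setAverage_eq, ← integral_subtype_comap measurableSet_closedBall]
      simp only [← hg]
      change φ x₀ - _ = _
      rw [hg]
      rfl
    have h0 : Λ (iteratedDeriv n (profileCurve a b c L) 0) = 0 := by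
      rw [← iteratedDeriv_clm_comp Λ (analyticAt_profileCurve a b c hposL') n]
      have : (fun s => Λ (profileCurve a b c L s)) =ᶠ[𝓝 0] fun _ => 0 := by
        filter_upwards [hmean x r hr hB, eventually_profileCurve a b c hposL'] with s h1 h2
        rw [hΛ _ (fun y => profile d (a y + s * b y + s ^ 2 * c y)) h2, h1, sub_self]
      rw [this.iteratedDeriv_eq n]
      simp
    rw [hΛ _ (fun y => iteratedDeriv n (fun t => profile d (a y + t * b y + t ^ 2 * c y)) 0)
      (iteratedDeriv_profileCurve a b c hposL n)] at h0
    linarith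

lemma eventually_eq_zero_of_iteratedDeriv_eq_zero {f : ℝ → ℝ} {t : ℝ} (hf : AnalyticAt ℝ f t)
    (h : ∀ n, iteratedDeriv n f t = 0) : ∀ᶠ s in 𝓝 t, f s = 0 := by
  have h1 := hf.hasFPowerSeriesAt
  simp only [h, zero_div] at h1
  have h2 : FormalMultilinearSeries.ofScalars ℝ (fun _ : ℕ => (0 : ℝ)) = 0 :=
    FormalMultilinearSeries.ofScalars_series_eq_zero_of_scalar_zero ℝ ℝ
  rw [h2] at h1
  exact h1.eventually_eq_zero

/-- A functional annihilating the functions harmonic on `O` annihilates the endpoint of an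
analytic family whose initial Taylor coefficients are harmonic on `O`. -/
lemma apply_profileCurve_one_eq_zero {O K : Set (Euc d)} (hO : IsOpen O) [CompactSpace K]
    (hKO : K ⊆ O) {ℓ : C(K, ℝ) →L[ℝ] ℝ} (hℓ : ∀ φ ∈ harmRestrict O K, ℓ φ = 0)
    (hpos : ∀ x ∈ O, 0 < a x)
    (hmean : ∀ x r, 0 < r → closedBall x r ⊆ O → ∀ᶠ t in 𝓝 (0 : ℝ),
      profile d (a x + t * b x + t ^ 2 * c x)
        = ⨍ y in closedBall x r, profile d (a y + t * b y + t ^ 2 * c y))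
    (hposK : ∀ t ∈ Icc (0 : ℝ) 1, ∀ x ∈ K, 0 < a x + t * b x + t ^ 2 * c x) :
    ℓ (profileCurve a b c K 1) = 0 := by
  have hA : AnalyticOnNhd ℝ (fun t => ℓ (profileCurve a b c K t)) (Icc 0 1) := fun t ht =>
    (ℓ.analyticAt _).comp (analyticAt_profileCurve a b c (hposK t ht))
  have h0 : (0 : ℝ) ∈ Icc (0 : ℝ) 1 := ⟨le_rfl, zero_le_one⟩
  refine hA.eqOn_zero_of_preconnected_of_eventuallyEq_zero isPreconnected_Icc h0 ?_
    (right_mem_Icc.2 zero_le_one)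
  refine eventually_eq_zero_of_iteratedDeriv_eq_zero (hA 0 h0) fun n => ?_
  rw [iteratedDeriv_clm_comp ℓ (analyticAt_profileCurve a b c (hposK 0 h0)) n]
  exact hℓ _ ⟨_, harmOn_iteratedDeriv a b c hO hpos hmean n,
    iteratedDeriv_profileCurve a b c (fun x hx => hpos x (hKO hx)) n⟩

end HarmonicFamilies

section Poles

variable {d : ℕ}

lemma setAverage_closedBall_sub (F : Euc d → ℝ) (x p : Euc d) {r : ℝ} (hr : 0 < r) :
    ⨍ y in closedBall x r, F (y - p) = ⨍ y in closedBall (x - p) r, F y := by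
  rw [← abs_of_pos hr, setAverage_closedBall_eq _ _ hr.ne', setAverage_closedBall_eq _ _ hr.ne']
  simp only [sub_add_eq_add_sub]

/-- The mean value property of the fundamental solution with pole `p` away from `p`. -/
lemma profile_norm_sub_sq_eq_setAverage {x p : Euc d} {r : ℝ} (hr : 0 < r)
    (hp : p ∉ closedBall x r) :
    profile d (‖x - p‖ ^ 2) = ⨍ y in closedBall x r, profile d (‖y - p‖ ^ 2) := by
  rw [setAverage_closedBall_sub (fun y => profile d (‖y‖ ^ 2)) x p hr]
  refine profile_norm_sq_eq_setAverage hr fun h => hp ?_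
  rw [mem_closedBall, dist_eq_norm] at h ⊢
  simpa using h

/-- The squared distance to `y`, as a continuous function on `K`. -/
def sqDist (K : Set (Euc d)) (y : Euc d) : C(K, ℝ) := ⟨fun x => ‖(x : Euc d) - y‖ ^ 2, by fun_prop⟩

/-- The fundamental solution with pole `y`, as a continuous function on `K`. -/
def poleFun (K : Set (Euc d)) (y : Euc d) : C(K, ℝ) := superpose (profile d) (sqDist K y)

lemma sqDist_pos {K : Set (Euc d)} {y : Euc d} (hy : y ∉ K) (x : K) : 0 < sqDist K y x := by
  have : (x : Euc d) - y ≠ 0 := sub_ne_zero.2 fun h => hy (h ▸ x.2)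
  change 0 < ‖(x : Euc d) - y‖ ^ 2
  positivity

lemma poleFun_apply {K : Set (Euc d)} {y : Euc d} (hy : y ∉ K) (x : K) :
    poleFun K y x = profile d (‖(x : Euc d) - y‖ ^ 2) :=
  superpose_apply (continuousOn_profile d) (sqDist_pos hy) x

variable {K : Set (Euc d)} [CompactSpace K]

lemma analyticAt_sqDist (y : Euc d) : AnalyticAt ℝ (sqDist K) y := by
  let A : Euc d →ₗ[ℝ] C(K, ℝ) :=
    { toFun := fun v => ⟨fun x => inner ℝ (x : Euc d) v, by fun_prop⟩
      map_add' := fun v w => by ext x; exact inner_add_right (x : Euc d) v w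
      map_smul' := fun c v => by ext x; exact inner_smul_right (x : Euc d) v c }
  have h : sqDist K = fun v => sqDist K 0 - (2 : ℝ) • LinearMap.toContinuousLinearMap A v
      + ‖v‖ ^ 2 • ContinuousMap.const K (1 : ℝ) := by
    ext v x
    change ‖(x : Euc d) - v‖ ^ 2
      = ‖(x : Euc d) - 0‖ ^ 2 - 2 * inner ℝ (x : Euc d) v + ‖v‖ ^ 2 * 1
    rw [norm_sub_sq_real, sub_zero, mul_one]
  have hn : AnalyticAt ℝ (fun v : Euc d => ‖v‖ ^ 2) y := by
    simp only [EuclideanSpace.real_norm_sq_eq]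
    refine Finset.analyticAt_fun_sum _ fun i _ => ?_
    exact ((EuclideanSpace.proj (𝕜 := ℝ) i : Euc d →L[ℝ] ℝ).analyticAt y).pow 2
  rw [h]
  exact (analyticAt_const.fun_sub (analyticAt_const.fun_smul
    (ContinuousLinearMap.analyticAt _ y))).fun_add (hn.fun_smul analyticAt_const)

lemma analyticAt_poleFun {y : Euc d} (hy : y ∉ K) : AnalyticAt ℝ (poleFun K) y :=
  AnalyticAt.fun_comp (f := sqDist K) (analyticAt_superpose_profile d (sqDist_pos hy))
    (analyticAt_sqDist y)

variable {O : Set (Euc d)} {ℓ : C(K, ℝ) →L[ℝ] ℝ}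

/-- A pole outside `O` can be moved within a ball that does not meet `K`. -/
lemma apply_poleFun_add_eq_zero (hO : IsOpen O) (hKO : K ⊆ O)
    (hℓ : ∀ φ ∈ harmRestrict O K, ℓ φ = 0) {y v : Euc d} {ρ : ℝ} (hy : y ∉ O)
    (hρ : Disjoint (ball y ρ) K) (hv : ‖v‖ < ρ) : ℓ (poleFun K (y + v)) = 0 := by
  let a : C(Euc d, ℝ) := ⟨fun x => ‖x - y‖ ^ 2, by fun_prop⟩
  let b : C(Euc d, ℝ) := ⟨fun x => 2 * inner ℝ (x - y) (-v), by fun_prop⟩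
  let c : C(Euc d, ℝ) := .const _ (‖v‖ ^ 2)
  have hq : ∀ (t : ℝ) (x : Euc d), a x + t * b x + t ^ 2 * c x = ‖x - (y + t • v)‖ ^ 2 := by
    intro t x
    rw [show x - (y + t • v) = (x - y) + t • (-v) by rw [smul_neg]; abel, norm_add_smul_sq,
      norm_neg]
    rfl
  have hne : ∀ t ∈ Icc (0 : ℝ) 1, y + t • v ∉ K := by
    intro t ht hK
    refine Set.disjoint_left.1 hρ ?_ hK
    rw [mem_ball_iff_norm, add_sub_cancel_left, norm_smul, Real.norm_eq_abs, abs_of_nonneg ht.1]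
    nlinarith [ht.1, ht.2, norm_nonneg v]
  have hposK : ∀ t ∈ Icc (0 : ℝ) 1, ∀ x ∈ K, 0 < a x + t * b x + t ^ 2 * c x := by
    intro t ht x hx
    rw [hq]
    exact sqDist_pos (hne t ht) ⟨x, hx⟩
  have key := apply_profileCurve_one_eq_zero a b c hO hKO hℓ
    (fun x hx => sqDist_pos hy ⟨x, hx⟩) (fun x r hr hB => ?_) hposK
  · convert key using 2
    unfold poleFun profileCurve
    congr 1
    ext x
    have := hq 1 x
    rw [one_smul] at this
    exact this.symm
  · have hcont : Continuous fun t : ℝ => y + t • v := by fun_prop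
    have hev : ∀ᶠ t in 𝓝 (0 : ℝ), y + t • v ∈ (closedBall x r)ᶜ :=
      hcont.continuousAt.eventually_mem (isClosed_closedBall.isOpen_compl.mem_nhds
        (by simpa using fun h => hy (hB h)))
    filter_upwards [hev] with t ht
    simp only [hq]
    exact profile_norm_sub_sq_eq_setAverage hr ht

/-- A pole outside a ball containing `K` can be moved to infinity. -/
lemma apply_poleFun_eq_zero_of_lt_norm (hO : IsOpen O) (hKO : K ⊆ O)
    (hℓ : ∀ φ ∈ harmRestrict O K, ℓ φ = 0) {y : Euc d} {R : ℝ} (hR : K ⊆ closedBall 0 R)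
    (hR0 : 0 ≤ R) (hy : R < ‖y‖) : ℓ (poleFun K y) = 0 := by
  let a : C(Euc d, ℝ) := .const _ (‖y‖ ^ 2)
  let b : C(Euc d, ℝ) := ⟨fun x => 2 * inner ℝ (-y) x, by fun_prop⟩
  let c : C(Euc d, ℝ) := ⟨fun x => ‖x‖ ^ 2, by fun_prop⟩
  have hq : ∀ (t : ℝ) (x : Euc d), a x + t * b x + t ^ 2 * c x = ‖-y + t • x‖ ^ 2 := by
    intro t x
    rw [norm_add_smul_sq, norm_neg]
    rfl
  have hy0 : 0 < ‖y‖ := hR0.trans_lt hy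
  have hpos : ∀ (t : ℝ) (x : Euc d), |t| * ‖x‖ < ‖y‖ → 0 < ‖-y + t • x‖ ^ 2 := by
    intro t x h
    have : -y + t • x ≠ 0 := by
      intro h0
      rw [neg_add_eq_zero] at h0
      rw [h0, norm_smul, Real.norm_eq_abs] at h
      exact lt_irrefl _ h
    positivity
  have hposK : ∀ t ∈ Icc (0 : ℝ) 1, ∀ x ∈ K, 0 < a x + t * b x + t ^ 2 * c x := by
    intro t ht x hx
    rw [hq]
    refine hpos t x ?_
    have := mem_closedBall_zero_iff.1 (hR hx)
    rw [abs_of_nonneg ht.1]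
    nlinarith [ht.1, ht.2, norm_nonneg x]
  have key := apply_profileCurve_one_eq_zero a b c hO hKO hℓ
    (fun x _ => by change 0 < ‖y‖ ^ 2; positivity) (fun x r hr hB => ?_) hposK
  · convert key using 2
    unfold poleFun profileCurve
    congr 1
    ext x
    have := hq 1 x
    rw [one_smul, neg_add_eq_sub] at this
    exact this.symm
  · have hcont : Continuous fun t : ℝ => |t| * (‖x‖ + r) := by fun_prop
    have hev : ∀ᶠ t in 𝓝 (0 : ℝ), |t| * (‖x‖ + r) < ‖y‖ :=
      hcont.continuousAt.eventually_lt_const (by simpa using hy0)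
    filter_upwards [hev] with t ht
    simp only [hq]
    rcases eq_or_ne t 0 with rfl | ht0
    · have hv : (volume : Measure (Euc d)).real (closedBall x r) ≠ 0 :=
        (ENNReal.toReal_pos (measure_closedBall_pos _ _ hr).ne' measure_closedBall_lt_top.ne).ne'
      simp only [zero_smul, setAverage_eq, setIntegral_const, smul_eq_mul]
      field_simp
    · have ht1 : 0 < |t| := abs_pos.2 ht0
      have htr : t * r ≠ 0 := mul_ne_zero ht0 hr.ne'
      have e1 := setAverage_closedBall_eq (fun z => profile d (‖-y + t • z‖ ^ 2)) x hr.ne'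
      have e2 := setAverage_closedBall_eq (fun z => profile d (‖z‖ ^ 2)) (-y + t • x) htr
      rw [abs_of_pos hr] at e1
      rw [e1]
      simp only [smul_add, smul_smul, ← add_assoc]
      rw [← e2]
      refine profile_norm_sq_eq_setAverage (abs_pos.2 htr) fun h => ?_
      rw [mem_closedBall, dist_comm, dist_zero_right, abs_mul, abs_of_pos hr] at h
      have h2 := norm_sub_norm_le y (t • x)
      rw [norm_sub_rev y (t • x), norm_smul, Real.norm_eq_abs] at h2
      rw [neg_add_eq_sub] at h
      linarith [mul_add |t| ‖x‖ r]

/-- Vanishing of a functional on the fundamental solutions propagates along connected sets of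
poles. -/
lemma apply_poleFun_eq_zero_of_isPreconnected {C : Set (Euc d)} (hC : IsPreconnected C)
    (hCK : Disjoint C K) {y₀ y : Euc d} (hy₀ : y₀ ∈ C) (hy : y ∈ C)
    (h : ∀ᶠ z in 𝓝 y₀, ℓ (poleFun K z) = 0) : ℓ (poleFun K y) = 0 := by
  have hA : AnalyticOnNhd ℝ (fun z => ℓ (poleFun K z)) C := fun z hz =>
    (ℓ.analyticAt _).comp (analyticAt_poleFun (Set.disjoint_left.1 hCK hz))
  exact hA.eqOn_zero_of_preconnected_of_eventuallyEq_zero hC hy₀ h hy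

end Poles

section Filling

variable {d : ℕ} {O S : Set (Euc d)}

lemma mem_connectedComponentIn_of_mem_closure {F : Set (Euc d)} (hF : IsOpen F) {x y : Euc d}
    (hy : y ∈ closure (connectedComponentIn F x)) (hyF : y ∈ F) :
    y ∈ connectedComponentIn F x := by
  obtain ⟨z, hzy, hzx⟩ := mem_closure_iff_nhds.1 hy _
    (connectedComponentIn_mem_nhds (hF.mem_nhds hyF))
  rw [connectedComponentIn_eq hzx, ← connectedComponentIn_eq hzy]
  exact mem_connectedComponentIn hyF

lemma subset_connectedComponentIn_of_closure_subset (hO : IsOpen O) (hS : IsClosed S) {x : Euc d}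
    (hC : closure (connectedComponentIn (O \ S) x) ⊆ O) {B : Set (Euc d)} (hB : IsPreconnected B)
    (hBS : Disjoint B S) (hBC : (B ∩ connectedComponentIn (O \ S) x).Nonempty) :
    B ⊆ connectedComponentIn (O \ S) x := by
  have hX : IsOpen (O \ S) := hO.sdiff hS
  refine hB.subset_left_of_subset_union hX.connectedComponentIn isClosed_closure.isOpen_compl
    (disjoint_compl_right_iff_subset.2 subset_closure) (fun y hy => ?_) hBC
  by_cases h : y ∈ closure (connectedComponentIn (O \ S) x)
  · exact Or.inl (mem_connectedComponentIn_of_mem_closure hX h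
      ⟨hC h, Set.disjoint_left.1 hBS hy⟩)
  · exact Or.inr h

lemma disjoint_infill_of_isPreconnected (hO : IsOpen O) (hS : IsClosed S) {B : Set (Euc d)}
    (hB : IsPreconnected B) (hBS : Disjoint B S) {y : Euc d} (hy : y ∈ B)
    (hyK : y ∉ infill O S) : Disjoint B (infill O S) := by
  refine Set.disjoint_left.2 fun z hzB hzK => ?_
  rcases hzK with hzS | ⟨x, hx, hzC, hcomp, hCO⟩
  · exact Set.disjoint_left.1 hBS hzB hzS
  · exact hyK (Or.inr ⟨x, hx, subset_connectedComponentIn_of_closure_subset hO hS hCO hB hBS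
      ⟨z, hzB, hzC⟩ hy, hcomp, hCO⟩)

lemma infill_subset (hSO : S ⊆ O) : infill O S ⊆ O := by
  rintro y (hy | ⟨x, -, hy, -⟩)
  · exact hSO hy
  · exact (connectedComponentIn_subset _ _ hy).1

lemma isClosed_infill (hO : IsOpen O) (hS : IsClosed S) : IsClosed (infill O S) := by
  rw [← isOpen_compl_iff, isOpen_iff_mem_nhds]
  intro y hy
  obtain ⟨ε, hε, hB⟩ := Metric.isOpen_iff.1 hS.isOpen_compl y fun h => hy (Or.inl h)
  refine mem_of_superset (ball_mem_nhds y hε) ?_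
  exact (disjoint_infill_of_isPreconnected hO hS (convex_ball y ε).isPreconnected
    (disjoint_left.2 hB) (mem_ball_self hε) hy).subset_compl_right

lemma infill_subset_closedBall (hO : IsOpen O) (hS : IsClosed S) {R : ℝ}
    (hR : S ⊆ closedBall 0 R) (hR0 : 0 ≤ R) : infill O S ⊆ closedBall 0 R := by
  rintro z (hz | ⟨x, hx, hzC, hcomp, hCO⟩)
  · exact hR hz
  by_contra hzR
  rw [mem_closedBall_zero_iff, not_le] at hzR
  have hz0 : 0 < ‖z‖ := hR0.trans_lt hzR
  have hray : IsPreconnected ((fun t : ℝ => t • z) '' Ici 1) :=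
    isPreconnected_Ici.image _ (by fun_prop)
  have hdisj : Disjoint ((fun t : ℝ => t • z) '' Ici 1) S := by
    refine disjoint_left.2 ?_
    rintro _ ⟨t, ht, rfl⟩ hS'
    have := mem_closedBall_zero_iff.1 (hR hS')
    rw [norm_smul, Real.norm_eq_abs, abs_of_pos (one_pos.trans_le ht)] at this
    have ht : (1 : ℝ) ≤ t := ht
    nlinarith
  have hsub := subset_connectedComponentIn_of_closure_subset hO hS hCO hray hdisj
    ⟨z, ⟨1, mem_Ici.2 le_rfl, one_smul _ _⟩, hzC⟩
  obtain ⟨M, hM⟩ := (hcomp.isBounded.subset subset_closure).exists_norm_le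
  have h1 := hM _ (hsub ⟨max 1 ((M + 1) / ‖z‖), mem_Ici.2 (le_max_left _ _), rfl⟩)
  rw [norm_smul, Real.norm_eq_abs, abs_of_pos (one_pos.trans_le (le_max_left _ _))] at h1
  have h2 : (M + 1) / ‖z‖ * ‖z‖ ≤ max 1 ((M + 1) / ‖z‖) * ‖z‖ := by
    gcongr
    exact le_max_right _ _
  rw [div_mul_cancel₀ _ hz0.ne'] at h2
  linarith

lemma isCompact_infill (hO : IsOpen O) (hS : IsCompact S) : IsCompact (infill O S) := by
  obtain ⟨R, hR⟩ := hS.isBounded.subset_closedBall (0 : Euc d)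
  exact (isCompact_closedBall 0 (max R 0)).of_isClosed_subset (isClosed_infill hO hS.isClosed)
    (infill_subset_closedBall hO hS.isClosed
      (hR.trans (closedBall_subset_closedBall (le_max_left _ _))) (le_max_right _ _))

/-- A functional annihilating the functions harmonic on `O` annihilates every fundamental solution
with pole off the filling. -/
lemma apply_poleFun_infill_eq_zero (hO : IsOpen O) (hSO : S ⊆ O) (hS : IsCompact S)
    [CompactSpace (infill O S)] {ℓ : C(infill O S, ℝ) →L[ℝ] ℝ}
    (hℓ : ∀ φ ∈ harmRestrict O (infill O S), ℓ φ = 0) {y : Euc d} (hy : y ∉ infill O S) :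
    ℓ (poleFun (infill O S) y) = 0 := by
  have hKO := infill_subset hSO
  have hclosed := isClosed_infill hO hS.isClosed
  have hball : ∀ p, p ∉ O → ∃ ρ > 0, ∀ w ∈ ball p ρ, ℓ (poleFun (infill O S) w) = 0 := by
    intro p hp
    obtain ⟨ρ, hρ, hB⟩ := Metric.isOpen_iff.1 hclosed.isOpen_compl p fun h => hp (hKO h)
    refine ⟨ρ, hρ, fun w hw => ?_⟩
    rw [← add_sub_cancel p w]
    exact apply_poleFun_add_eq_zero hO hKO hℓ hp (disjoint_left.2 hB) (mem_ball_iff_norm.1 hw)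
  by_cases hyO : y ∈ O
  · have hyS : y ∉ S := fun h => hy (Or.inl h)
    have hyC : y ∈ connectedComponentIn (O \ S) y := mem_connectedComponentIn ⟨hyO, hyS⟩
    have hCS : Disjoint (connectedComponentIn (O \ S) y) S :=
      disjoint_left.2 fun z hz => (connectedComponentIn_subset _ _ hz).2
    have hCK := disjoint_infill_of_isPreconnected hO hS.isClosed isPreconnected_connectedComponentIn
      hCS hyC hy
    obtain ⟨R, hR⟩ := hS.isBounded.subset_closedBall (0 : Euc d)
    have hR' : infill O S ⊆ closedBall 0 (max R 0) := infill_subset_closedBall hO hS.isClosed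
      (hR.trans (closedBall_subset_closedBall (le_max_left _ _))) (le_max_right _ _)
    by_cases hCR : connectedComponentIn (O \ S) y ⊆ closedBall 0 (max R 0)
    · have hcomp : IsCompact (closure (connectedComponentIn (O \ S) y)) :=
        (isCompact_closedBall (0 : Euc d) (max R 0)).of_isClosed_subset isClosed_closure
          (closure_minimal hCR isClosed_closedBall)
      have hnot : ¬ closure (connectedComponentIn (O \ S) y) ⊆ O := fun h =>
        hy (Or.inr ⟨y, ⟨hyO, hyS⟩, hyC, hcomp, h⟩)
      obtain ⟨p, hpC, hpO⟩ := Set.not_subset.1 hnot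
      obtain ⟨ρ, hρ, hw⟩ := hball p hpO
      obtain ⟨z, hzB, hzC⟩ := mem_closure_iff_nhds.1 hpC _ (ball_mem_nhds p hρ)
      refine apply_poleFun_eq_zero_of_isPreconnected isPreconnected_connectedComponentIn hCK hzC
        hyC ?_
      filter_upwards [isOpen_ball.mem_nhds hzB] with w hwB using hw w hwB
    · obtain ⟨z, hzC, hzR⟩ := Set.not_subset.1 hCR
      refine apply_poleFun_eq_zero_of_isPreconnected isPreconnected_connectedComponentIn hCK hzC
        hyC ?_
      filter_upwards [isClosed_closedBall.isOpen_compl.mem_nhds hzR] with w hwR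
      refine apply_poleFun_eq_zero_of_lt_norm hO hKO hℓ hR' (le_max_right _ _) ?_
      rwa [mem_compl_iff, mem_closedBall_zero_iff, not_le] at hwR
  · obtain ⟨ρ, hρ, hw⟩ := hball y hyO
    exact hw y (mem_ball_self hρ)

end Filling

section BallDefect

variable {d : ℕ}

/-- The unnormalized difference between the average of `F` over a ball and its value at the
center. -/
def ballDefect (r : ℝ) (F : Euc d → ℝ) (z : Euc d) : ℝ :=
  ∫ v in closedBall (0 : Euc d) r, (F (z + v) - F z)

lemma continuous_ballDefect (r : ℝ) {F : Euc d → ℝ} (hF : Continuous F) :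
    Continuous (ballDefect r F) :=
  continuous_parametric_integral_of_continuous (f := fun z v => F (z + v) - F z) (by fun_prop)
    (isCompact_closedBall 0 r)

lemma ballDefect_eq_zero_of_forall {r : ℝ} {F : Euc d → ℝ} {z : Euc d} {c : ℝ}
    (hr : 0 ≤ r) (h : ∀ y ∈ closedBall z r, F y = c) : ballDefect r F z = 0 := by
  refine setIntegral_eq_zero_of_forall_eq_zero fun v hv => ?_
  rw [h z (mem_closedBall_self hr), h (z + v), sub_self]
  rw [mem_closedBall_iff_norm, add_sub_cancel_left]
  exact mem_closedBall_zero_iff.1 hv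

lemma volume_real_closedBall_ne_zero (x : Euc d) {r : ℝ} (hr : 0 < r) :
    (volume : Measure (Euc d)).real (closedBall x r) ≠ 0 :=
  (ENNReal.toReal_pos (measure_closedBall_pos _ _ hr).ne' measure_closedBall_lt_top.ne).ne'

lemma ballDefect_eq_zero_of_setAverage {r : ℝ} (hr : 0 < r) {F : Euc d → ℝ}
    {z : Euc d} (hF : ContinuousOn F (closedBall z r))
    (h : F z = ⨍ y in closedBall z r, F y) : ballDefect r F z = 0 := by
  have hc : ContinuousOn (fun v => F (z + v)) (closedBall 0 r) := by
    refine hF.comp (by fun_prop) fun v hv => ?_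
    rw [mem_closedBall_iff_norm, add_sub_cancel_left]
    exact mem_closedBall_zero_iff.1 hv
  have e := setAverage_closedBall_sub (fun v => F (z + v)) z z hr
  simp only [add_sub_cancel, sub_self] at e
  rw [← h, setAverage_eq, smul_eq_mul] at e
  have hb := volume_real_closedBall_ne_zero (0 : Euc d) hr
  rw [ballDefect, integral_sub (hc.integrableOn_compact (isCompact_closedBall 0 r))
    (continuousOn_const.integrableOn_compact (isCompact_closedBall 0 r)), setIntegral_const,
    smul_eq_mul, e]
  field_simp
  ring

lemma integral_closedBall_comp_isometry (r : ℝ) (L : Euc d ≃ₗᵢ[ℝ] Euc d) (F : Euc d → ℝ) :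
    ∫ v in closedBall (0 : Euc d) r, F (L v) = ∫ v in closedBall (0 : Euc d) r, F v := by
  have h := L.measurePreserving.setIntegral_preimage_emb
    L.toHomeomorph.measurableEmbedding F (closedBall (0 : Euc d) r)
  rw [← h]
  congr 2
  ext v
  simp

lemma ballDefect_comp_isometry (r : ℝ) (L : Euc d ≃ₗᵢ[ℝ] Euc d) {F : Euc d → ℝ}
    (hF : ∀ z, F (L z) = F z) (z : Euc d) : ballDefect r F (L z) = ballDefect r F z := by
  rw [ballDefect, ← integral_closedBall_comp_isometry r L]
  simp only [← map_add, hF]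
  rfl

lemma integral_setIntegral_closedBall_swap (r : ℝ) {f : Euc d → Euc d → ℝ}
    (hf : Continuous f.uncurry) {R : ℝ}
    (hR : ∀ z, ∀ v ∈ closedBall (0 : Euc d) r, z ∉ closedBall (0 : Euc d) R → f z v = 0) :
    ∫ z, ∫ v in closedBall (0 : Euc d) r, f z v = ∫ v in closedBall (0 : Euc d) r, ∫ z, f z v := by
  have := isCompact_iff_compactSpace.1 (isCompact_closedBall (0 : Euc d) r)
  simp only [← integral_subtype_comap (measurableSet_closedBall (x := (0 : Euc d)) (ε := r))]
  refine integral_integral_swap_of_hasCompactSupport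
    (f := fun z (v : closedBall (0 : Euc d) r) => f z v) ?_ ?_
  · exact hf.comp (by fun_prop : Continuous fun p : Euc d × closedBall (0 : Euc d) r =>
      (p.1, (p.2 : Euc d)))
  · refine HasCompactSupport.intro ((isCompact_closedBall (0 : Euc d) R).prod isCompact_univ) ?_
    rintro ⟨z, v⟩ hzv
    exact hR z v v.2 fun hz => hzv ⟨hz, mem_univ _⟩

/-- Averaging over balls is symmetric. -/
lemma integral_ballDefect_mul (r : ℝ) {F G : Euc d → ℝ} (hF : Continuous F)
    (hFc : HasCompactSupport F) (hG : Continuous G) :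
    ∫ z, ballDefect r F z * G z = ∫ z, F z * ballDefect r G z := by
  obtain ⟨R, hR⟩ := hFc.isCompact.isBounded.subset_closedBall (0 : Euc d)
  have hF0 : ∀ z, R < ‖z‖ → F z = 0 := fun z hz => by
    by_contra h
    exact hz.not_ge (mem_closedBall_zero_iff.1 (hR (subset_tsupport _ h)))
  have e1 : ∫ z, ballDefect r F z * G z
      = ∫ v in closedBall (0 : Euc d) r, ∫ z, (F (z + v) - F z) * G z := by
    rw [← integral_setIntegral_closedBall_swap r (f := fun z v => (F (z + v) - F z) * G z)
      (by fun_prop) (R := R + |r|)]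
    · simp only [integral_mul_const]
      rfl
    · intro z v hv hz
      rw [mem_closedBall_zero_iff] at hv hz
      have h1 : ‖z‖ ≤ ‖z + v‖ + ‖v‖ := by simpa using norm_sub_le (z + v) v
      rw [hF0 z (by linarith [abs_nonneg r]), hF0 (z + v) (by linarith [le_abs_self r])]
      simp
  have e2 : ∫ z, F z * ballDefect r G z
      = ∫ v in closedBall (0 : Euc d) r, ∫ z, F z * (G (z + v) - G z) := by
    rw [← integral_setIntegral_closedBall_swap r (f := fun z v => F z * (G (z + v) - G z))
      (by fun_prop) (R := R)]
    · simp only [integral_const_mul]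
      rfl
    · intro z v hv hz
      rw [mem_closedBall_zero_iff, not_le] at hz
      rw [hF0 z hz, zero_mul]
  rw [e1, e2, ← integral_closedBall_comp_isometry r (LinearIsometryEquiv.neg ℝ)]
  refine setIntegral_congr_fun measurableSet_closedBall fun v _ => ?_
  have hi : ∀ H : Euc d → ℝ, Continuous H → Integrable fun z => F z * H z := fun H hH =>
    (hF.mul hH).integrable_of_hasCompactSupport hFc.mul_right
  have e3 := integral_add_right_eq_self (μ := (volume : Measure (Euc d)))
    (fun z => F (z + -v) * G z) v
  have hi2 : Integrable fun z => F (z + -v) * G z := by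
    refine Continuous.integrable_of_hasCompactSupport (by fun_prop) ?_
    exact (hFc.comp_homeomorph (Homeomorph.addRight (-v))).mul_right
  simp only [add_neg_cancel_right] at e3
  simp only [LinearIsometryEquiv.coe_neg, sub_mul, mul_sub]
  rw [integral_sub hi2 (hi G hG), integral_sub (hi _ (by fun_prop)) (hi G hG), e3]

/-- Integrating against a radial kernel reproduces a function with the mean value property. -/
lemma integral_closedBall_mul_radial {H : Euc d → ℝ} (hH : Continuous H) {x : Euc d} {ρ : ℝ}
    (hmean : ∀ t, 0 < t → t ≤ ρ → H x = ⨍ y in closedBall x t, H y)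
    {φ : ℝ → ℝ} (hφ : Continuous φ) :
    ∫ y in closedBall x ρ, H y * φ (dist y x) = H x * ∫ y in closedBall x ρ, φ (dist y x) := by
  obtain ⟨C, hC⟩ := (isCompact_closedBall x ρ).exists_bound_of_continuousOn hH.continuousOn
  rcases lt_or_ge ρ 0 with hρ | hρ
  · simp [closedBall_eq_empty.2 hρ]
  have hC' : ∀ y ∈ closedBall x ρ, 0 ≤ H y + C := fun y hy => by
    have := abs_le.1 (hC y hy)
    linarith [this.1]
  have hx := hC' x (mem_closedBall_self hρ)
  have hfi : ∀ {f : Euc d → ℝ} (t : ℝ), Continuous f → IntegrableOn f (closedBall x t) :=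
    fun t hf => hf.continuousOn.integrableOn_compact (isCompact_closedBall x t)
  let m : (Euc d → ℝ) → Measure ℝ := fun F =>
    ((volume.restrict (closedBall x ρ)).withDensity fun y => ENNReal.ofReal (F y + C)).map
      fun y => dist y x
  have hd : Measurable fun y : Euc d => dist y x := by fun_prop
  have hmφ : ∀ F : Euc d → ℝ, Continuous F → (∀ y ∈ closedBall x ρ, 0 ≤ F y + C) →
      ∫ s, φ s ∂(m F) = ∫ y in closedBall x ρ, (F y + C) * φ (dist y x) := by
    intro F hF hF0
    rw [integral_map hd.aemeasurable hφ.aestronglyMeasurable,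
      integral_withDensity_eq_integral_toReal_smul (by fun_prop) (by simp)]
    refine setIntegral_congr_fun measurableSet_closedBall fun y hy => ?_
    simp [ENNReal.toReal_ofReal (hF0 y hy)]
  have hmI : ∀ F : Euc d → ℝ, Continuous F → (∀ y ∈ closedBall x ρ, 0 ≤ F y + C) →
      ∀ s, m F (Iic s) = ENNReal.ofReal (∫ y in closedBall x (min s ρ), (F y + C)) := by
    intro F hF hF0 s
    have hset : (fun y => dist y x) ⁻¹' Iic s ∩ closedBall x ρ = closedBall x (min s ρ) := by
      ext y
      simp
    rw [Measure.map_apply hd measurableSet_Iic, withDensity_apply _ (hd measurableSet_Iic),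
      Measure.restrict_restrict (hd measurableSet_Iic), hset, ofReal_integral_eq_lintegral_ofReal]
    · exact hfi _ (by fun_prop)
    · filter_upwards [ae_restrict_mem measurableSet_closedBall] with y hy
      exact hF0 y (closedBall_subset_closedBall (min_le_right _ _) hy)
  have hfin : IsFiniteMeasure (m H) := by
    refine ⟨?_⟩
    rw [Measure.map_apply hd MeasurableSet.univ, preimage_univ, withDensity_apply _ .univ,
      Measure.restrict_univ, ← ofReal_integral_eq_lintegral_ofReal]
    · exact ENNReal.ofReal_lt_top
    · exact hfi _ (by fun_prop)
    · filter_upwards [ae_restrict_mem measurableSet_closedBall] with y hy using hC' y hy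
  have heq : m H = m fun _ => H x := by
    refine Measure.ext_of_Iic _ _ fun s => ?_
    rw [hmI H hH hC', hmI _ continuous_const fun _ _ => hx]
    congr 1
    rcases le_or_gt (min s ρ) 0 with ht | ht
    · refine setIntegral_congr_fun measurableSet_closedBall fun y hy => ?_
      rw [dist_le_zero.1 ((mem_closedBall.1 hy).trans ht)]
    · rw [integral_add (hfi _ hH) (hfi _ continuous_const),
        integral_add (hfi _ continuous_const) (hfi _ continuous_const)]
      congr 1
      have := hmean _ ht (min_le_right _ _)
      rw [setAverage_eq, smul_eq_mul] at this
      have hb := volume_real_closedBall_ne_zero x ht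
      rw [setIntegral_const, smul_eq_mul]
      field_simp at this
      linarith
  have h1 := hmφ H hH hC'
  rw [heq, hmφ _ continuous_const fun _ _ => hx] at h1
  simp only [add_mul] at h1
  rw [integral_add (hfi _ (by fun_prop)) (hfi _ (by fun_prop)),
    integral_add (hfi _ (by fun_prop)) (hfi _ (by fun_prop)), integral_const_mul] at h1
  linarith

end BallDefect

section Representation

variable {d : ℕ}

/-- The fundamental solution truncated to be constant on the ball of radius `δ`. -/
def truncProfile (δ : ℝ) (z : Euc d) : ℝ := profile d (max (‖z‖ ^ 2) (δ ^ 2))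

lemma continuous_truncProfile {δ : ℝ} (hδ : 0 < δ) :
    Continuous (truncProfile δ : Euc d → ℝ) := by
  refine (continuousOn_profile d).comp_continuous (by fun_prop) fun z => ?_
  exact mem_Ioi.2 (lt_max_of_lt_right (by positivity : 0 < δ ^ 2))

lemma truncProfile_of_le {δ : ℝ} (hδ : 0 ≤ δ) {z : Euc d} (hz : δ ≤ ‖z‖) :
    truncProfile δ z = profile d (‖z‖ ^ 2) := by
  rw [truncProfile, max_eq_left (pow_le_pow_left₀ hδ hz 2)]

lemma profile_le_truncProfile {δ : ℝ} {z : Euc d} (hz : z ≠ 0) :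
    profile d (‖z‖ ^ 2) ≤ truncProfile δ z := by
  have : 0 < ‖z‖ ^ 2 := by positivity
  exact (strictMonoOn_profile d).monotoneOn this (lt_max_of_lt_left this) (le_max_left _ _)

lemma profile_sq_le_truncProfile {δ : ℝ} (hδ : 0 < δ) (z : Euc d) :
    profile d (δ ^ 2) ≤ truncProfile δ z := by
  have : 0 < δ ^ 2 := by positivity
  exact (strictMonoOn_profile d).monotoneOn this (lt_max_of_lt_right this) (le_max_right _ _)

lemma ballDefect_profile_eq_zero {r : ℝ} (hr : 0 < r) {z : Euc d} (hz : r < ‖z‖) :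
    ballDefect r (fun y => profile d (‖y‖ ^ 2)) z = 0 := by
  have h0 : (0 : Euc d) ∉ closedBall z r := by
    rwa [mem_closedBall, dist_comm, dist_zero_right, not_le]
  refine ballDefect_eq_zero_of_setAverage hr ?_ (profile_norm_sq_eq_setAverage hr h0)
  refine (continuousOn_profile d).comp (by fun_prop) fun y hy => ?_
  have : y ≠ 0 := fun h => h0 (h ▸ hy)
  exact (by positivity : 0 < ‖y‖ ^ 2)

lemma ballDefect_truncProfile_eq_zero {r δ : ℝ} (hr : 0 < r) (hδ : 0 ≤ δ) {z : Euc d}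
    (hz : δ + r < ‖z‖) : ballDefect r (truncProfile δ) z = 0 := by
  rw [← ballDefect_profile_eq_zero (d := d) hr (z := z) (by linarith)]
  refine setIntegral_congr_fun measurableSet_closedBall fun v hv => ?_
  rw [mem_closedBall_zero_iff] at hv
  have h1 : ‖z‖ ≤ ‖z + v‖ + ‖v‖ := by simpa using norm_sub_le (z + v) v
  simp only
  rw [truncProfile_of_le hδ (by linarith), truncProfile_of_le hδ (by linarith)]

lemma ballDefect_truncProfile_nonneg {r δ : ℝ} (hr : 0 < r) (hδ : r < δ) (z : Euc d) :
    0 ≤ ballDefect r (truncProfile δ) z := by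
  have hδ0 : 0 < δ := hr.trans hδ
  rcases lt_or_ge ‖z‖ δ with hz | hz
  · refine setIntegral_nonneg measurableSet_closedBall fun v _ => sub_nonneg.2 ?_
    convert! profile_sq_le_truncProfile hδ0 (z + v) using 1
    rw [truncProfile, max_eq_right (pow_le_pow_left₀ (norm_nonneg z) hz.le 2)]
  · have hne : ∀ v ∈ closedBall (0 : Euc d) r, z + v ≠ 0 := by
      intro v hv h
      rw [mem_closedBall_zero_iff, ← norm_neg, ← eq_neg_of_add_eq_zero_left h] at hv
      linarith
    rw [← ballDefect_profile_eq_zero (d := d) hr (z := z) (by linarith)]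
    refine setIntegral_mono_on ?_ ?_ measurableSet_closedBall fun v hv => ?_
    · refine ContinuousOn.integrableOn_compact (isCompact_closedBall 0 r) ?_
      refine ContinuousOn.sub ?_ continuousOn_const
      refine (continuousOn_profile d).comp (by fun_prop) fun v hv => ?_
      have := hne v hv
      exact (by positivity : 0 < ‖z + v‖ ^ 2)
    · have := continuous_truncProfile (d := d) hδ0
      exact ContinuousOn.integrableOn_compact (isCompact_closedBall 0 r) (by fun_prop)
    · rw [truncProfile_of_le hδ0.le hz]
      exact sub_le_sub_right (profile_le_truncProfile (hne v hv)) _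

lemma ballDefect_truncProfile_pos {r δ : ℝ} (hr : 0 < r) (hδ : 0 < δ) {z : Euc d}
    (hz : ‖z‖ = δ) : 0 < ballDefect r (truncProfile δ) z := by
  have hcont := continuous_truncProfile (d := d) hδ
  have hcont' : Continuous fun v => truncProfile δ (z + v) - truncProfile δ z := by fun_prop
  have hzv : truncProfile δ z = profile d (δ ^ 2) := by rw [truncProfile_of_le hδ.le hz.ge, hz]
  rw [ballDefect, setIntegral_pos_iff_support_of_nonneg_ae
    (Eventually.of_forall fun v => sub_nonneg.2 (hzv ▸ profile_sq_le_truncProfile hδ _))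
    (hcont'.continuousOn.integrableOn_compact (isCompact_closedBall 0 r))]
  have hopen : IsOpen ((Function.support fun v => truncProfile δ (z + v) - truncProfile δ z)
      ∩ ball 0 r) := hcont'.isOpen_support.inter isOpen_ball
  refine (hopen.measure_pos volume ⟨(r / (2 * δ)) • z, ?_, ?_⟩).trans_le
    (measure_mono (inter_subset_inter_right _ ball_subset_closedBall))
  · have hn : ‖z + (r / (2 * δ)) • z‖ = δ + r / 2 := by
      rw [show z + (r / (2 * δ)) • z = (1 + r / (2 * δ)) • z by rw [add_smul, one_smul],
        norm_smul, Real.norm_eq_abs, abs_of_pos (by positivity), hz]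
      field_simp
    rw [Function.mem_support, sub_ne_zero, hzv, truncProfile_of_le hδ.le (by rw [hn]; linarith), hn]
    have h1 : (0 : ℝ) < δ ^ 2 := by positivity
    have h2 : (0 : ℝ) < (δ + r / 2) ^ 2 := by positivity
    exact ((strictMonoOn_profile d) h1 h2 (by gcongr; linarith)).ne'
  · rw [mem_ball_zero_iff, norm_smul, Real.norm_eq_abs, abs_of_pos (by positivity), hz]
    field_simp
    linarith

lemma ballDefect_truncProfile_eq_of_norm_eq (r δ : ℝ) {z w : Euc d} (h : ‖z‖ = ‖w‖) :
    ballDefect r (truncProfile δ) z = ballDefect r (truncProfile δ) w := by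
  rw [← Submodule.reflection_sub h]
  exact (ballDefect_comp_isometry r _ (fun y => by
    rw [truncProfile, LinearIsometryEquiv.norm_map, truncProfile]) z).symm

/-- The truncated fundamental solution with pole `x` recovers the value at `x` of a function that
is harmonic near `x` from its averaging defect. -/
lemma integral_ballDefect_mul_truncProfile (i : Fin d) {r δ : ℝ} (hr : 0 < r) (hδ : r < δ)
    {H : Euc d → ℝ} (hH : Continuous H) (hHc : HasCompactSupport H) {x : Euc d}
    (hmean : ∀ t, 0 < t → t ≤ δ + r → H x = ⨍ y in closedBall x t, H y) :
    ∫ z, ballDefect r H z * truncProfile δ (z - x)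
      = H x * ∫ z : Euc d, ballDefect r (truncProfile δ) z := by
  have hδ0 : 0 < δ := hr.trans hδ
  have hU := continuous_truncProfile (d := d) hδ0
  have hψ := continuous_ballDefect r hU
  let φ : ℝ → ℝ := fun s => ballDefect r (truncProfile δ) (s • EuclideanSpace.single i (1 : ℝ))
  have hφ : Continuous φ := by fun_prop
  have hradial : ∀ y, ballDefect r (truncProfile δ) (y - x) = φ (dist y x) := fun y => by
    refine ballDefect_truncProfile_eq_of_norm_eq r δ ?_
    rw [norm_smul, dist_eq_norm]
    simp
  have hvanish : ∀ y, y ∉ closedBall x (δ + r) → ballDefect r (truncProfile δ) (y - x) = 0 := by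
    intro y hy
    rw [mem_closedBall_iff_norm, not_le] at hy
    exact ballDefect_truncProfile_eq_zero hr hδ0.le hy
  have htrans : ∀ z, ballDefect r (fun z => truncProfile δ (z - x)) z
      = ballDefect r (truncProfile δ) (z - x) := fun z => by
    simp only [ballDefect, add_sub_right_comm]
  rw [integral_ballDefect_mul r hH hHc (by fun_prop)]
  simp only [htrans]
  rw [← integral_sub_right_eq_self (ballDefect r (truncProfile δ)) x,
    ← setIntegral_eq_integral_of_forall_compl_eq_zero (s := closedBall x (δ + r)) hvanish,
    ← setIntegral_eq_integral_of_forall_compl_eq_zero (s := closedBall x (δ + r))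
      (fun y hy => by rw [hvanish y hy, mul_zero])]
  simp only [hradial]
  exact integral_closedBall_mul_radial hH hmean hφ

lemma integral_ballDefect_truncProfile_pos (i : Fin d) {r δ : ℝ} (hr : 0 < r) (hδ : r < δ) :
    0 < ∫ z : Euc d, ballDefect r (truncProfile δ) z := by
  have hδ0 : 0 < δ := hr.trans hδ
  refine (continuous_ballDefect r
    (continuous_truncProfile hδ0)).integral_pos_of_hasCompactSupport_nonneg_nonzero
    (x := EuclideanSpace.single i δ) ?_ (ballDefect_truncProfile_nonneg hr hδ) ?_
  · refine HasCompactSupport.intro (isCompact_closedBall 0 (δ + r)) fun z hz => ?_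
    rw [mem_closedBall_zero_iff, not_le] at hz
    exact ballDefect_truncProfile_eq_zero hr hδ0.le hz
  · refine (ballDefect_truncProfile_pos hr hδ0 ?_).ne'
    simp [abs_of_pos hδ0]

lemma setAverage_closedBall_congr {F G : Euc d → ℝ} {x : Euc d} {r : ℝ}
    (h : EqOn F G (closedBall x r)) : ⨍ y in closedBall x r, F y = ⨍ y in closedBall x r, G y := by
  rw [setAverage_eq, setAverage_eq, setIntegral_congr_fun measurableSet_closedBall h]

/-- A functional annihilating the fundamental solutions with poles off `K` annihilates every
function harmonic near `K`. -/
lemma apply_eq_zero_of_apply_poleFun_eq_zero (i : Fin d) {K V : Set (Euc d)} [CompactSpace K]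
    (hV : IsOpen V) (hKV : K ⊆ V) {h : Euc d → ℝ} (hh : HarmOn h V) {ℓ : C(K, ℝ) →L[ℝ] ℝ}
    (hℓ : ∀ y ∉ K, ℓ (poleFun K y) = 0) {φ : C(K, ℝ)} (hφ : ∀ x : K, φ x = h x) : ℓ φ = 0 := by
  have hK : IsCompact K := isCompact_iff_compactSpace.2 ‹_›
  obtain ⟨ε, hε, hεV⟩ := hK.exists_cthickening_subset_open hV hKV
  set r : ℝ := ε / 3 with hr
  set δ : ℝ := 2 * r with hδ
  have hr0 : 0 < r := by positivity
  have hrδ : r < δ := by linarith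
  have hδε : δ + r = ε := by rw [hδ, hr]; ring
  obtain ⟨χ, hχ1, hχc, hχV, -⟩ := exists_continuousMap_one_of_isCompact_subset_isOpen
    (hK.cthickening (r := ε)) hV hεV
  let H : Euc d → ℝ := fun y => χ y * h y
  have hHχ : tsupport H ⊆ tsupport χ := closure_mono (Function.support_mul_subset_left _ _)
  have hHc : HasCompactSupport H := hχc.of_isClosed_subset isClosed_closure hHχ
  have hH : Continuous H := (χ.continuous.continuousOn.mul hh.1).continuous_of_tsupport_subset hV
    (hHχ.trans hχV)
  have hHh : EqOn H h (cthickening ε K) := fun y hy => by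
    change χ y * h y = h y
    rw [hχ1 hy, Pi.one_apply, one_mul]
  have hball : ∀ x ∈ K, ∀ z, dist z x + r ≤ ε → closedBall z r ⊆ cthickening ε K := by
    intro x hx z hz y hy
    refine mem_cthickening_of_dist_le y x ε K hx ?_
    have := dist_triangle y z x
    linarith [mem_closedBall.1 hy]
  have hzero : ∀ z, ∀ x ∈ K, dist z x < δ → ballDefect r H z = 0 := by
    intro z x hx hzx
    have hB := hball x hx z (by linarith)
    refine ballDefect_eq_zero_of_setAverage hr0 hH.continuousOn ?_
    rw [hHh (hB (mem_closedBall_self hr0.le)), setAverage_closedBall_congr (hHh.mono hB)]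
    exact hh.2 z r hr0 (hB.trans hεV)
  have hk := continuous_ballDefect r hH
  have hU := continuous_truncProfile (d := d) (hr0.trans hrδ)
  let Φ : C(Euc d, C(K, ℝ)) := ContinuousMap.curry
    ⟨fun p : Euc d × K => ballDefect r H p.1 * truncProfile δ (p.1 - (p.2 : Euc d)), by fun_prop⟩
  have hΦ : ∀ z (x : K), Φ z x = ballDefect r H z * truncProfile δ (z - (x : Euc d)) :=
    fun _ _ => rfl
  have hΦ0 : ∀ z, ℓ (Φ z) = 0 := by
    intro z
    by_cases hz : ballDefect r H z = 0
    · have : Φ z = 0 := by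
        ext x
        rw [hΦ, hz, zero_mul, ContinuousMap.zero_apply]
      rw [this, map_zero]
    · have hfar : ∀ x ∈ K, δ ≤ dist z x := fun x hx => not_lt.1 fun hlt => hz (hzero z x hx hlt)
      have hzK : z ∉ K := fun hzK => by
        have := hfar z hzK
        rw [dist_self] at this
        linarith
      have : Φ z = ballDefect r H z • poleFun K z := by
        ext x
        rw [hΦ, ContinuousMap.smul_apply, poleFun_apply hzK, smul_eq_mul,
          truncProfile_of_le (hr0.trans hrδ).le (by rw [← dist_eq_norm]; exact hfar x x.2),
          norm_sub_rev]
      rw [this, map_smul, hℓ z hzK, smul_zero]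
  have hΦi : Integrable Φ := by
    refine Φ.continuous.integrable_of_hasCompactSupport ?_
    refine HasCompactSupport.intro (hHc.isCompact.cthickening (r := r)) fun z hz => ?_
    have hd : ballDefect r H z = 0 := by
      refine ballDefect_eq_zero_of_forall (c := 0) hr0.le fun y hy => ?_
      by_contra hy0
      refine hz (mem_cthickening_of_dist_le z y r _ (subset_tsupport _ hy0) ?_)
      rw [dist_comm]
      exact mem_closedBall.1 hy
    ext x
    rw [hΦ, hd, zero_mul, ContinuousMap.zero_apply]
  set c := ∫ z : Euc d, ballDefect r (truncProfile δ) z with hc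
  have hc0 : 0 < c := integral_ballDefect_truncProfile_pos i hr0 hrδ
  have hΦint : ∫ z, Φ z = c • φ := by
    ext x
    have h1 := (ContinuousMap.evalCLM ℝ x).integral_comp_comm hΦi
    simp only [ContinuousMap.evalCLM_apply, hΦ] at h1
    have hxK : ∀ t ≤ ε, closedBall (x : Euc d) t ⊆ cthickening ε K := fun t ht y hy =>
      mem_cthickening_of_dist_le y x ε K x.2 ((mem_closedBall.1 hy).trans ht)
    have hHx : H x = h x := hHh (self_subset_cthickening _ x.2)
    rw [← h1, integral_ballDefect_mul_truncProfile i hr0 hrδ hH hHc, ContinuousMap.smul_apply,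
      hφ, hHx, smul_eq_mul, mul_comm]
    intro t ht htε
    have hB := hxK t (by linarith)
    rw [hHx, setAverage_closedBall_congr (hHh.mono hB)]
    exact hh.2 x t ht (hB.trans hεV)
  have h2 := ℓ.integral_comp_comm hΦi
  simp only [hΦ0, integral_zero, hΦint, map_smul, smul_eq_mul] at h2
  exact (mul_eq_zero.1 h2.symm).resolve_left hc0.ne'

end Representation

section Approximation

variable {d : ℕ}

lemma mem_topologicalClosure_of_forall_dual {E : Type*} [NormedAddCommGroup E] [NormedSpace ℝ E]
    {p : Submodule ℝ E} {x : E} (h : ∀ ℓ : E →L[ℝ] ℝ, (∀ y ∈ p, ℓ y = 0) → ℓ x = 0) :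
    x ∈ p.topologicalClosure := by
  by_contra hx
  obtain ⟨ℓ, u, hu, hux⟩ := geometric_hahn_banach_closed_point p.topologicalClosure.convex
    p.isClosed_topologicalClosure hx
  have hp : ∀ y ∈ p, ℓ y = 0 := by
    intro y hy
    by_contra hy0
    have h1 := hu (((u + 1) / ℓ y) • y) (p.le_topologicalClosure (p.smul_mem _ hy))
    rw [map_smul, smul_eq_mul, div_mul_cancel₀ _ hy0] at h1
    linarith
  have h0 := hu 0 (zero_mem _)
  rw [map_zero] at h0
  rw [h ℓ hp] at hux
  exact lt_asymm h0 hux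

lemma harmOn_of_subsingleton [Subsingleton (Euc d)] (h : Euc d → ℝ) (O : Set (Euc d)) :
    HarmOn h O := by
  refine ⟨fun x _ => (continuous_of_discreteTopology (f := h)).continuousWithinAt,
    fun x r hr _ => ?_⟩
  have hv := volume_real_closedBall_ne_zero x hr
  rw [setAverage_eq, show h = fun _ => h x from funext fun y => by rw [Subsingleton.elim y x],
    setIntegral_const, smul_eq_mul, smul_eq_mul]
  field_simp

/-- A function harmonic near the filling lies in the uniform closure of the functions harmonic on
`O`. -/
lemma exists_harmOn_dist_lt (i : Fin d) {O S V : Set (Euc d)} (hO : IsOpen O) (hSO : S ⊆ O)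
    (hS : IsCompact S) (hV : IsOpen V) (hSV : infill O S ⊆ V) {h : Euc d → ℝ} (hh : HarmOn h V)
    {ε : ℝ} (hε : 0 < ε) : ∃ g, HarmOn g O ∧ ∀ x ∈ infill O S, dist (h x) (g x) < ε := by
  have := isCompact_iff_compactSpace.1 (isCompact_infill hO hS)
  let φ : C(infill O S, ℝ) := ⟨fun x => h x,
    continuousOn_iff_continuous_domRestrict.1 (hh.1.mono hSV)⟩
  have hmem : φ ∈ (harmRestrict O (infill O S)).topologicalClosure :=
    mem_topologicalClosure_of_forall_dual fun ℓ hℓ =>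
      apply_eq_zero_of_apply_poleFun_eq_zero i hV hSV hh
        (fun y hy => apply_poleFun_infill_eq_zero hO hSO hS hℓ hy) fun _ => rfl
  obtain ⟨ψ, ⟨g, hg, hψ⟩, hdist⟩ := Metric.mem_closure_iff.1 hmem ε hε
  refine ⟨g, hg, fun x hx => ?_⟩
  have h1 := (ContinuousMap.dist_lt_iff hε).1 hdist ⟨x, hx⟩
  rwa [hψ] at h1

end Approximation

/-- Let `S` be a compact subset of an open set `O ⊆ ℝ^d`. Every function
harmonic on an open neighbourhood of `infill O S` is the uniform limit on `infill O S`
of a sequence of functions harmonic on `O`. -/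
theorem stmt_5 {d : ℕ} (O : Set (Euc d)) (hO : IsOpen O) (hOne : O.Nonempty)
    (S : Set (Euc d)) (hSO : S ⊆ O) (hS : IsCompact S) :
    ∀ h : Euc d → ℝ, ∀ V : Set (Euc d), IsOpen V → infill O S ⊆ V → HarmOn h V →
      ∃ hseq : ℕ → Euc d → ℝ, (∀ j : ℕ, HarmOn (hseq j) O) ∧
        TendstoUniformlyOn hseq h atTop (infill O S) := by
  intro h V hV hSV hh
  rcases isEmpty_or_nonempty (Fin d) with hd | ⟨⟨i⟩⟩
  · exact ⟨fun _ => h, fun _ => harmOn_of_subsingleton h O,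
      fun u hu => Eventually.of_forall fun _ _ _ => refl_mem_uniformity hu⟩
  · choose g hg hgh using fun j : ℕ => exists_harmOn_dist_lt i hO hSO hS hV hSV hh
      (Nat.one_div_pos_of_nat (α := ℝ) (n := j))
    refine ⟨g, hg, Metric.tendstoUniformlyOn_iff.2 fun ε hε => ?_⟩
    filter_upwards [tendsto_one_div_add_atTop_nhds_zero_nat.eventually_lt_const hε] with j hj x hx
    exact (hgh j x hx).trans hj
end
end
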